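/- arXiv:math/0304464 — 7 statements merged into one kernel-verified Lean document; each statement's English description precedes it below -/
import Mathlib

section
/- A graph G is perfect if and only if its complement is perfect (Perfect Graph Theorem). -/
open SimpleGraph

/-- A graph is perfect if, in every induced subgraph, the clique number equals
the chromatic number. -/
def IsPerfect {V : Type*} (G : SimpleGraph V) : Prop :=
  ∀ S : Set V, ((G.induce S).cliqueNum : ℕ∞) = (G.induce S).chromaticNumber

/-- The function `c` properly colours the vertices in `S` with colours less than `k`. -/
def ColorsWithin {V : Type*} (G : SimpleGraph V) (S : Finset V) (k : ℕ) (c : V → ℕ) : Prop :=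
  (∀ v ∈ S, c v < k) ∧ ∀ u ∈ S, ∀ v ∈ S, G.Adj u v → c u ≠ c v

/-- The vertex set `S` contains a clique with as many vertices as some proper colouring of `S`
has colours. -/
def CliqueMatchesColoring {V : Type*} (G : SimpleGraph V) (S : Finset V) : Prop :=
  ∃ k : ℕ, (∃ K ⊆ S, G.IsNClique k K) ∧ ∃ c : V → ℕ, ColorsWithin G S k c

/-- The size of `S` is at most the product of the sizes of a clique and a stable set in `S`. -/
def CardLeCliqueMulStable {V : Type*} (G : SimpleGraph V) (S : Finset V) : Prop :=
  ∃ K ⊆ S, ∃ A ⊆ S, G.IsClique (K : Set V) ∧ Gᶜ.IsClique (A : Set V) ∧ S.card ≤ K.card * A.card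

lemma ColorsWithin.mono {V : Type*} {G : SimpleGraph V} {S : Finset V} {k l : ℕ} {c : V → ℕ}
    (h : ColorsWithin G S k c) (hkl : k ≤ l) : ColorsWithin G S l c :=
  ⟨fun v hv => (h.1 v hv).trans_le hkl, h.2⟩

lemma CardLeCliqueMulStable.compl {V : Type*} {G : SimpleGraph V} {S : Finset V}
    (h : CardLeCliqueMulStable G S) : CardLeCliqueMulStable Gᶜ S := by
  obtain ⟨K, hK, A, hA, h1, h2, h3⟩ := h
  exact ⟨A, hA, K, hK, h2, by rwa [compl_compl], by rwa [mul_comm]⟩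

/-- A largest colour class together with a clique of matching size gives the product bound. -/
lemma CliqueMatchesColoring.cardLeCliqueMulStable {V : Type*} {G : SimpleGraph V} {S : Finset V}
    (h : CliqueMatchesColoring G S) : CardLeCliqueMulStable G S := by
  classical
  obtain ⟨k, ⟨K, hKS, hK⟩, c, hc, hadj⟩ := h
  rcases S.eq_empty_or_nonempty with rfl | ⟨v, hv⟩
  · exact ⟨∅, by simp, ∅, by simp, by simp, by simp, by simp⟩
  obtain ⟨i, -, hi⟩ := Finset.exists_max_image (Finset.range k)
    (fun i => (S.filter (fun v => c v = i)).card) ⟨c v, Finset.mem_range.2 (hc v hv)⟩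
  refine ⟨K, hKS, S.filter (fun v => c v = i), Finset.filter_subset _ _, hK.1, ?_, ?_⟩
  · intro u hu w hw huw
    simp only [Finset.coe_filter, Set.mem_ofPred_eq] at hu hw
    rw [compl_adj]
    exact ⟨huw, fun h => hadj u hu.1 w hw.1 h (hu.2.trans hw.2.symm)⟩
  · rw [Finset.card_eq_sum_card_fiberwise (f := c) (t := Finset.range k)
      (fun v hv => by simpa using hc v hv), hK.2]
    simpa using Finset.sum_le_card_nsmul _ _ _ hi

/-- If two families of finite sets indexed by `ι` have disjoint diagonal pairs and off-diagonal
pairs meeting in exactly one point, then a set containing all members of one family has at least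
as many elements as `ι`. -/
lemma card_le_of_inter_card_eq_one {V ι : Type*} [DecidableEq V] [Fintype ι] [DecidableEq ι]
    (S : Finset V) (A K : ι → Finset V) (hK : ∀ i, K i ⊆ S) (hι : 2 ≤ Fintype.card ι)
    (hdiag : ∀ i, (K i ∩ A i).card = 0) (hoff : ∀ i j, j ≠ i → (K i ∩ A j).card = 1) :
    Fintype.card ι ≤ S.card := by
  let f : ι → (S → ℚ) := fun j v => if (v : V) ∈ A j then 1 else 0
  have hf : LinearIndependent ℚ f := by
    rw [Fintype.linearIndependent_iff]
    intro g hg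
    have hdot : ∀ i, ∑ j, g j = g i := by
      intro i
      have h1 : ∑ v ∈ K i, ∑ j, g j * (if v ∈ A j then (1 : ℚ) else 0) = 0 := by
        refine Finset.sum_eq_zero fun v hv => ?_
        have := congrFun hg ⟨v, hK i hv⟩
        simpa [f] using this
      rw [Finset.sum_comm] at h1
      have h2 : ∀ j, ∑ v ∈ K i, g j * (if v ∈ A j then (1 : ℚ) else 0)
          = g j - if j = i then g j else 0 := by
        intro j
        rw [← Finset.mul_sum, Finset.sum_boole, Finset.filter_mem_eq_inter]
        split_ifs with h
        · rw [h, hdiag i]; simp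
        · rw [hoff i j h]; simp
      simp only [h2, Finset.sum_sub_distrib, Finset.sum_ite_eq', Finset.mem_univ, if_true] at h1
      linarith
    have hsum : ∑ j, g j = Fintype.card ι * ∑ j, g j := by
      calc ∑ j, g j = ∑ _i : ι, ∑ j, g j := Finset.sum_congr rfl fun i _ => (hdot i).symm
        _ = _ := by simp
    have hι' : (2 : ℚ) ≤ Fintype.card ι := by exact_mod_cast hι
    have hzero : ∑ j, g j = 0 := by
      have : ((Fintype.card ι : ℚ) - 1) * ∑ j, g j = 0 := by linarith
      rcases mul_eq_zero.1 this with h | h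
      · linarith
      · exact h
    intro i
    rw [← hdot i, hzero]
  simpa using hf.fintype_card_le_finrank

lemma IsClique.card_inter_le_one {V : Type*} [DecidableEq V] {G : SimpleGraph V} {K A : Finset V}
    (hK : G.IsClique (K : Set V)) (hA : Gᶜ.IsClique (A : Set V)) : (K ∩ A).card ≤ 1 := by
  rw [Finset.card_le_one]
  intro u hu v hv
  rw [Finset.mem_inter] at hu hv
  by_contra huv
  exact (compl_adj _ _ _ |>.1 (hA hu.2 hv.2 huv)).2 (hK hu.1 hv.1 huv)

/-- In a smallest vertex set that cannot be coloured with as many colours as its largest clique,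
every stable set is avoided by a largest clique. -/
lemma exists_isNClique_disjoint {V : Type*} [DecidableEq V] {G : SimpleGraph V} {S : Finset V}
    {w : ℕ} (ih : ∀ T ⊂ S, CliqueMatchesColoring G T) (hw : ∃ K ⊆ S, G.IsNClique w K)
    (hmax : ∀ K ⊆ S, G.IsClique (K : Set V) → K.card ≤ w) (hcol : ∀ c, ¬ ColorsWithin G S w c)
    {A : Finset V} (hAS : A ⊆ S) (hA : Gᶜ.IsClique (A : Set V)) :
    ∃ K ⊆ S, G.IsNClique w K ∧ (K ∩ A).card = 0 := by
  rcases A.eq_empty_or_nonempty with rfl | hne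
  · obtain ⟨K, h1, h2⟩ := hw
    exact ⟨K, h1, h2, by simp⟩
  obtain ⟨k, ⟨K, hKT, hK⟩, c, hc, hadj⟩ := ih (S \ A) (Finset.sdiff_ssubset hAS hne)
  have hKS : K ⊆ S := hKT.trans Finset.sdiff_subset
  have hkw : k ≤ w := hK.2 ▸ hmax K hKS hK.1
  rcases hkw.eq_or_lt with rfl | hlt
  · refine ⟨K, hKS, hK, ?_⟩
    rw [Finset.card_eq_zero, ← Finset.disjoint_iff_inter_eq_empty]
    exact Finset.disjoint_of_subset_left hKT Finset.sdiff_disjoint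
  · refine absurd ?_ (hcol fun v => if v ∈ A then k else c v)
    refine ⟨fun v hv => ?_, fun u hu v hv huv => ?_⟩
    · by_cases h : v ∈ A
      · simpa [h] using hlt
      · simpa [h] using (hc v (Finset.mem_sdiff.2 ⟨hv, h⟩)).trans hlt
    · by_cases h : u ∈ A <;> by_cases h' : v ∈ A
      · exact absurd huv (compl_adj _ _ _ |>.1 (hA h h' huv.ne)).2
      · simpa [h, h'] using (hc v (Finset.mem_sdiff.2 ⟨hv, h'⟩)).ne'
      · simpa [h, h'] using (hc u (Finset.mem_sdiff.2 ⟨hu, h⟩)).ne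
      · simpa [h, h'] using hadj u (Finset.mem_sdiff.2 ⟨hu, h⟩) v (Finset.mem_sdiff.2 ⟨hv, h'⟩) huv

/-- Gasparian's argument: the product bound on all subsets forces optimal colourings. -/
lemma cliqueMatchesColoring_of_cardLeCliqueMulStable {V : Type*} {G : SimpleGraph V}
    (h : ∀ S, CardLeCliqueMulStable G S) (S : Finset V) : CliqueMatchesColoring G S := by
  classical
  induction S using Finset.strongInduction with
  | H S ih =>
  obtain ⟨M, hM, hMmax⟩ := Finset.exists_max_image
    (S.powerset.filter fun K : Finset V => G.IsClique (K : Set V)) Finset.card ⟨∅, by simp⟩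
  rw [Finset.mem_filter, Finset.mem_powerset] at hM
  set w := M.card with hw
  have hmax : ∀ K ⊆ S, G.IsClique (K : Set V) → K.card ≤ w := fun K hK hc =>
    hMmax K (Finset.mem_filter.2 ⟨Finset.mem_powerset.2 hK, hc⟩)
  have hex : ∃ K ⊆ S, G.IsNClique w K := ⟨M, hM.1, hM.2, rfl⟩
  by_contra hbad
  have hcol : ∀ c, ¬ ColorsWithin G S w c := fun c hc => hbad ⟨w, hex, c, hc⟩
  have hSne : S.Nonempty := by
    rw [Finset.nonempty_iff_ne_empty]
    rintro rfl
    exact hcol (fun _ => 0) ⟨by simp, by simp⟩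
  obtain ⟨K₀, hK₀S, A₀, hA₀S, hK₀, hA₀, hcard⟩ := h S
  have hcard' : S.card ≤ A₀.card * w := by
    rw [mul_comm]
    exact hcard.trans (Nat.mul_le_mul_right _ (hmax K₀ hK₀S hK₀))
  have hdel : ∀ a : A₀, ∃ c : V → ℕ, ColorsWithin G (S.erase a) w c := by
    intro a
    obtain ⟨k, ⟨K, hKT, hK⟩, c, hc⟩ := ih _ (Finset.erase_ssubset (hA₀S a.2))
    exact ⟨c, hc.mono (hK.2 ▸ hmax K (hKT.trans (Finset.erase_subset _ _)) hK.1)⟩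
  choose c hc using hdel
  let A : Option (A₀ × Fin w) → Finset V := fun
    | none => A₀
    | some p => (S.erase p.1).filter fun v => c p.1 v = p.2
  have hAS : ∀ j, A j ⊆ S := by
    rintro (_ | p)
    · exact hA₀S
    · exact (Finset.filter_subset _ _).trans (Finset.erase_subset _ _)
  have hA : ∀ j, Gᶜ.IsClique (A j : Set V) := by
    rintro (_ | p)
    · exact hA₀
    · intro u hu v hv huv
      rw [Finset.mem_coe, Finset.mem_filter] at hu hv
      rw [compl_adj]
      exact ⟨huv, fun h => (hc p.1).2 u hu.1 v hv.1 h (hu.2.trans hv.2.symm)⟩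
  choose K hKS hK hdiag using fun j => exists_isNClique_disjoint ih hex hmax hcol (hAS j) (hA j)
  have hcover : ∀ v ∈ S, ∑ j, (if v ∈ A j then 1 else 0) = A₀.card := by
    intro v hv
    have hrow : ∀ a : A₀, ∑ i : Fin w, (if v ∈ A (some (a, i)) then 1 else 0)
        = if (a : V) = v then 0 else 1 := by
      intro a
      by_cases hav : (a : V) = v
      · simp [A, hav]
      · have hlt := (hc a).1 v (Finset.mem_erase.2 ⟨Ne.symm hav, hv⟩)
        rw [Finset.sum_eq_single (⟨c a v, hlt⟩ : Fin w)]
        · simp [A, hav, hv, Ne.symm hav]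
        · intro i _ hi
          have : c a v ≠ i := fun h => hi (Fin.ext h.symm)
          simp [A, this]
        · simp
    rw [Fintype.sum_option, Fintype.sum_prod_type]
    simp only [hrow]
    rw [Finset.sum_coe_sort A₀ (fun a => if a = v then 0 else 1)]
    have hsplit : ∑ a ∈ A₀, ((if a = v then 1 else 0) + (if a = v then 0 else 1)) = A₀.card := by
      rw [Finset.card_eq_sum_ones]
      exact Finset.sum_congr rfl fun a _ => by split_ifs <;> rfl
    rw [Finset.sum_add_distrib, Finset.sum_ite_eq'] at hsplit
    exact hsplit
  have htotal : ∀ i, ∑ j, (K i ∩ A j).card = A₀.card * w := by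
    intro i
    calc ∑ j, (K i ∩ A j).card = ∑ j, ∑ v ∈ K i, (if v ∈ A j then 1 else 0) := by
          refine Finset.sum_congr rfl fun j _ => ?_
          rw [Finset.sum_boole, Finset.filter_mem_eq_inter, Nat.cast_id]
      _ = ∑ v ∈ K i, A₀.card := by
          rw [Finset.sum_comm]
          exact Finset.sum_congr rfl fun v hv => hcover v (hKS i hv)
      _ = A₀.card * w := by rw [Finset.sum_const, (hK i).2, smul_eq_mul, mul_comm]
  have hoff : ∀ i j, j ≠ i → (K i ∩ A j).card = 1 := by
    intro i j hji
    have hle : ∀ j ∈ Finset.univ.erase i, (K i ∩ A j).card ≤ 1 := fun j _ =>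
      IsClique.card_inter_le_one (hK i).1 (hA j)
    refine (Finset.sum_eq_sum_iff_of_le hle).1 ?_ j (Finset.mem_erase.2 ⟨hji, Finset.mem_univ _⟩)
    have h1 := htotal i
    rw [← Finset.add_sum_erase _ _ (Finset.mem_univ i), hdiag i, zero_add] at h1
    rw [h1]
    simp [Finset.card_erase_of_mem]
  have hι : Fintype.card (Option (A₀ × Fin w)) = A₀.card * w + 1 := by simp
  have := card_le_of_inter_card_eq_one S A K hKS (by have := hSne.card_pos; omega) hdiag hoff
  omega

lemma isPerfect_iff_cliqueMatchesColoring {V : Type*} [Fintype V] (G : SimpleGraph V) :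
    IsPerfect G ↔ ∀ S, CliqueMatchesColoring G S := by
  classical
  constructor
  · intro h S
    have hS := h (S : Set V)
    obtain ⟨K, hK⟩ := (G.induce (S : Set V)).exists_isNClique_cliqueNum
    obtain ⟨C⟩ := chromaticNumber_le_iff_colorable.1 hS.ge
    refine ⟨(G.induce (S : Set V)).cliqueNum, ⟨K.map (Function.Embedding.subtype _), ?_, ?_⟩,
      fun v => if hv : v ∈ S then C ⟨v, hv⟩ else 0, ?_, ?_⟩
    · intro v hv
      obtain ⟨u, -, rfl⟩ := Finset.mem_map.1 hv
      exact u.2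
    · exact (hK.map (f := Function.Embedding.subtype _)).mono (map_comap_le _ _)
    · intro v hv
      simp [hv]
    · intro u hu v hv huv
      have : C ⟨u, hu⟩ ≠ C ⟨v, hv⟩ := C.valid huv
      simpa [hu, hv, Fin.ext_iff] using this
  · intro h S
    obtain ⟨k, ⟨K, hKS, hK⟩, c, hc, hadj⟩ := h S.toFinset
    simp only [Set.mem_toFinset] at hc hadj
    have hcol : (G.induce S).Colorable k :=
      ⟨Coloring.mk (fun v => (⟨c v, hc v v.2⟩ : Fin k)) fun {u v} huv heq =>
        hadj u u.2 v v.2 huv (Fin.ext_iff.1 heq)⟩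
    have hk : k ≤ (G.induce S).cliqueNum := by
      have hKS' : ∀ v ∈ K, v ∈ S := fun v hv => Set.mem_toFinset.1 (hKS hv)
      have hcl : (G.induce S).IsClique (K.subtype (· ∈ S) : Set S) := by
        intro u hu v hv huv
        simp only [Finset.mem_coe, Finset.mem_subtype] at hu hv
        exact hK.1 hu hv fun h => huv (Subtype.ext h)
      have := hcl.card_le_cliqueNum
      rwa [Finset.card_subtype, Finset.filter_true_of_mem hKS', hK.2] at this
    refine le_antisymm ?_ ((chromaticNumber_le_iff_colorable.2 hcol).trans (by exact_mod_cast hk))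
    obtain ⟨L, hL⟩ := (G.induce S).exists_isNClique_cliqueNum
    have := hL.1.card_le_chromaticNumber
    rwa [hL.2] at this

lemma isPerfect_iff_cardLeCliqueMulStable {V : Type*} [Fintype V] (G : SimpleGraph V) :
    IsPerfect G ↔ ∀ S, CardLeCliqueMulStable G S := by
  rw [isPerfect_iff_cliqueMatchesColoring]
  exact ⟨fun h S => (h S).cardLeCliqueMulStable, cliqueMatchesColoring_of_cardLeCliqueMulStable⟩

/-- **Perfect Graph Theorem (Lovász).** A graph is perfect iff its complement is
perfect. -/
theorem perfect_graph_theorem {V : Type*} [Fintype V] (G : SimpleGraph V) :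
    IsPerfect G ↔ IsPerfect Gᶜ := by
  rw [isPerfect_iff_cardLeCliqueMulStable, isPerfect_iff_cardLeCliqueMulStable]
  exact ⟨fun h S => (h S).compl, fun h S => by simpa using (h S).compl⟩
end

section
/- A graph G is perfect if and only if, for every induced subgraph H of G, the number of vertices of H is at most α(H)·ω(H), where α(H) is the cardinality of a largest stable set of H and ω(H) is the cardinality of a largest clique of H. -/
open SimpleGraph

/-- The stability number: the cardinality of a largest stable set, i.e. the clique
number of the complement. -/
noncomputable def stableNum {V : Type*} (G : SimpleGraph V) : ℕ :=
  Gᶜ.cliqueNum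

namespace PerfectGraph

open Finset

variable {V : Type*}

lemma card_le_stableNum_mul [Fintype V] {G : SimpleGraph V} {k : ℕ} (h : G.Colorable k) :
    Fintype.card V ≤ stableNum G * k := by
  classical
  obtain ⟨C⟩ := h
  have key := Finset.card_le_mul_card_image_of_maps_to (s := (univ : Finset V))
    (t := (univ : Finset (Fin k))) (f := C) (fun _ _ => mem_univ _) (stableNum G) (by
      intro i _
      refine IsClique.card_le_cliqueNum (G := Gᶜ) (tc := ?_)
      rw [isClique_compl]
      intro u hu v hv _ hadj
      simp only [coe_filter, mem_univ, true_and, Set.mem_ofPred_eq] at hu hv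
      exact C.valid hadj (hu.trans hv.symm))
  simpa using key

lemma card_le_cliqueNum_induce [Finite V] (G : SimpleGraph V) {S : Set V} {K : Finset V}
    (hKS : (K : Set V) ⊆ S) (hK : G.IsClique K) : #K ≤ (G.induce S).cliqueNum := by
  classical
  have hc : (G.induce S).IsClique (K.subtype (· ∈ S) : Finset S) := by
    intro u hu v hv huv
    exact hK (by simpa using hu) (by simpa using hv) (fun h => huv (Subtype.ext h))
  have := IsClique.card_le_cliqueNum (tc := hc)
  rwa [card_subtype, filter_true_of_mem (fun x hx => hKS hx)] at this

lemma exists_isClique_card_eq_cliqueNum_induce [Finite V] (G : SimpleGraph V) (S : Set V) :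
    ∃ K : Finset V, (K : Set V) ⊆ S ∧ G.IsClique K ∧ #K = (G.induce S).cliqueNum := by
  obtain ⟨K, hK, hcard⟩ := (G.induce S).exists_isNClique_cliqueNum
  refine ⟨K.map (Function.Embedding.subtype _), ?_, ?_, by simpa using hcard⟩
  · intro x hx
    simp only [coe_map, Set.mem_image] at hx
    obtain ⟨y, -, rfl⟩ := hx
    exact y.2
  · rintro _ hu _ hv huv
    simp only [coe_map, Set.mem_image] at hu hv
    obtain ⟨u, hu, rfl⟩ := hu
    obtain ⟨v, hv, rfl⟩ := hv
    exact hK hu hv (fun h => huv (by rw [h]))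

lemma stableNum_induce (G : SimpleGraph V) (S : Set V) :
    stableNum (G.induce S) = (Gᶜ.induce S).cliqueNum := by
  unfold stableNum
  congr 1
  ext u v
  simp [Subtype.ext_iff]

lemma card_inter_le_one [DecidableEq V] {G : SimpleGraph V} {A K : Finset V}
    (hA : G.IsIndepSet A) (hK : G.IsClique K) : #(A ∩ K) ≤ 1 := by
  rw [card_le_one]
  intro u hu v hv
  by_contra huv
  rw [mem_inter] at hu hv
  exact hA hu.1 hv.1 huv (hK hu.2 hv.2 huv)

lemma exists_color_classes [Finite V] [DecidableEq V] {G : SimpleGraph V} {T : Set V} {k : ℕ}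
    (h : (G.induce T).Colorable k) :
    ∃ A : Fin k → Finset V, (∀ i, (A i : Set V) ⊆ T) ∧ (∀ i, G.IsIndepSet (A i : Set V)) ∧
      ∀ K : Finset V, (K : Set V) ⊆ T → ∑ i, #(A i ∩ K) = #K := by
  classical
  have := Fintype.ofFinite V
  obtain ⟨C⟩ := h
  refine ⟨fun i => univ.filter (fun v => ∃ h : v ∈ T, C ⟨v, h⟩ = i), ?_, ?_, ?_⟩
  · intro i v hv
    simp only [coe_filter, mem_univ, true_and, Set.mem_ofPred_eq] at hv
    exact hv.1
  · intro i u hu v hv _ hadj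
    simp only [coe_filter, mem_univ, true_and, Set.mem_ofPred_eq] at hu hv
    obtain ⟨hu, rfl⟩ := hu
    obtain ⟨hv, hc⟩ := hv
    exact C.valid (v := ⟨u, hu⟩) (w := ⟨v, hv⟩) hadj hc.symm
  · intro K hK
    rw [← card_biUnion]
    · congr 1
      ext v
      simp only [mem_biUnion, mem_univ, mem_inter, mem_filter, true_and]
      exact ⟨fun ⟨_, _, hv⟩ => hv, fun hv => ⟨C ⟨v, hK hv⟩, ⟨hK hv, rfl⟩, hv⟩⟩
    · intro i _ j _ hij
      rw [Function.onFun, Finset.disjoint_left]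
      intro v hi hj
      simp only [mem_inter, mem_filter, mem_univ, true_and] at hi hj
      obtain ⟨⟨_, hi⟩, -⟩ := hi
      obtain ⟨⟨_, hj⟩, -⟩ := hj
      exact hij (hi.symm.trans hj)

lemma colorable_induce_succ {G : SimpleGraph V} {S A : Set V} {k : ℕ} (hA : G.IsIndepSet A)
    (h : (G.induce (S \ A)).Colorable k) : (G.induce S).Colorable (k + 1) := by
  classical
  obtain ⟨C⟩ := h
  let D : (G.induce S).Coloring (Option (Fin k)) := Coloring.mk
    (fun v => if h : (v : V) ∈ A then none else some (C ⟨v, v.2, h⟩)) (by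
      intro u v huv
      by_cases hu : (u : V) ∈ A <;> by_cases hv : (v : V) ∈ A
      · exact absurd huv (hA hu hv (G.ne_of_adj huv))
      · simp [hu, hv]
      · simp [hu, hv]
      · simp only [hu, hv, dite_false, ne_eq, Option.some.injEq]
        exact C.valid (v := ⟨u, u.2, hu⟩) (w := ⟨v, v.2, hv⟩) huv)
  simpa using D.colorable

/-- A rank bound: the incidence matrix product is the all-ones matrix minus the identity. -/
lemma card_le_of_card_inter {ι : Type*} [Fintype ι] [DecidableEq ι] [DecidableEq V]
    {S : Finset V} {A K : ι → Finset V} (hι : Fintype.card ι ≠ 1) (hA : ∀ i, A i ⊆ S)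
    (h : ∀ i j, #(A i ∩ K j) = if i = j then 0 else 1) : Fintype.card ι ≤ #S := by
  let f : ι → S → ℚ := fun i v => if (v : V) ∈ A i then 1 else 0
  have hf : ∀ i j, ∑ v : S, f i v * (if (v : V) ∈ K j then 1 else 0)
      = 1 - if i = j then 1 else 0 := by
    intro i j
    have h1 : ∑ v : S, f i v * (if (v : V) ∈ K j then 1 else 0) = (#(A i ∩ K j) : ℚ) := by
      rw [Finset.sum_coe_sort S
        (fun v => (if v ∈ A i then (1 : ℚ) else 0) * (if v ∈ K j then 1 else 0))]
      simp only [← ite_and, mul_ite, mul_one, mul_zero, sum_boole]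
      congr 2
      ext v
      simp only [mem_filter, mem_inter]
      exact ⟨fun hv => ⟨hv.2.2, hv.2.1⟩, fun hv => ⟨hA i hv.1, hv.2, hv.1⟩⟩
    rw [h1, h]
    split_ifs <;> simp
  have hli : LinearIndependent ℚ f := by
    rw [Fintype.linearIndependent_iff]
    intro x hx
    have hsum : ∀ j, x j = ∑ i, x i := by
      intro j
      have h0 : ∑ v : S, (∑ i, x i • f i) v * (if (v : V) ∈ K j then 1 else 0) = 0 := by
        rw [hx]; simp
      simp only [Finset.sum_apply, Pi.smul_apply, smul_eq_mul, sum_mul] at h0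
      rw [sum_comm] at h0
      simp only [mul_assoc, ← mul_sum, hf, mul_sub, mul_one, sum_sub_distrib] at h0
      simp only [mul_ite, mul_one, mul_zero, sum_ite_eq', mem_univ, if_true] at h0
      linarith
    have hs : ∑ i, x i = Fintype.card ι * ∑ i, x i := by
      conv_lhs => rw [sum_congr rfl (fun i _ => hsum i)]
      simp
    have hz : ∑ i, x i = 0 := by
      have hne : (Fintype.card ι : ℚ) - 1 ≠ 0 := sub_ne_zero.mpr (by exact_mod_cast hι)
      exact (mul_eq_zero.mp (by linarith :
        ((Fintype.card ι : ℚ) - 1) * ∑ i, x i = 0)).resolve_left hne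
    exact fun i => (hsum i).trans hz
  simpa using hli.fintype_card_le_finrank

/-- The inductive step of the Lovász characterization, following Gasparian. -/
lemma colorable_cliqueNum_of_forall_ssubset [Finite V] (G : SimpleGraph V) (S : Set V)
    (hmin : ∀ T ⊂ S, (G.induce T).Colorable (G.induce T).cliqueNum)
    (hS : S.ncard ≤ stableNum (G.induce S) * (G.induce S).cliqueNum) :
    (G.induce S).Colorable (G.induce S).cliqueNum := by
  classical
  have := Fintype.ofFinite V
  by_contra hcol
  rw [stableNum_induce] at hS
  set w := (G.induce S).cliqueNum
  have hmono : ∀ T ⊆ S, (G.induce T).cliqueNum ≤ w := by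
    intro T hT
    obtain ⟨K, hKT, hK, hc⟩ := exists_isClique_card_eq_cliqueNum_induce G T
    exact hc ▸ card_le_cliqueNum_induce G (hKT.trans hT) hK
  obtain ⟨K₀, hK₀S, hK₀, hK₀c⟩ := exists_isClique_card_eq_cliqueNum_induce G S
  have hmiss : ∀ A : Finset V, (A : Set V) ⊆ S → G.IsIndepSet (A : Set V) →
      ∃ K : Finset V, (K : Set V) ⊆ S ∧ G.IsClique K ∧ #K = w ∧ #(A ∩ K) = 0 := by
    intro A hAS hA
    rcases A.eq_empty_or_nonempty with rfl | ⟨a, ha⟩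
    · exact ⟨K₀, hK₀S, hK₀, hK₀c, by simp⟩
    obtain ⟨K, hKT, hK, hc⟩ := exists_isClique_card_eq_cliqueNum_induce G (S \ (A : Set V))
    have hss : S \ (A : Set V) ⊂ S :=
      ⟨Set.sdiff_subset, fun h => (h (hAS ha)).2 ha⟩
    refine ⟨K, hKT.trans Set.sdiff_subset, hK, ?_, ?_⟩
    · refine le_antisymm (hc.trans_le (hmono _ Set.sdiff_subset)) ?_
      by_contra hlt
      exact hcol ((colorable_induce_succ hA (hmin _ hss)).mono (by omega))
    · rw [card_eq_zero, ← disjoint_iff_inter_eq_empty, disjoint_right]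
      exact fun v hv => (hKT hv).2
  obtain ⟨A₀, hA₀S, hA₀, hA₀c⟩ := exists_isClique_card_eq_cliqueNum_induce Gᶜ S
  rw [isClique_compl] at hA₀
  rw [← hA₀c] at hS
  have hclass : ∀ v : A₀, ∃ A : Fin w → Finset V, (∀ i, (A i : Set V) ⊆ S \ {(v : V)}) ∧
      (∀ i, G.IsIndepSet (A i : Set V)) ∧
      ∀ K : Finset V, (K : Set V) ⊆ S \ {(v : V)} → ∑ i, #(A i ∩ K) = #K := by
    intro v
    refine exists_color_classes ((hmin _ ?_).mono (hmono _ Set.sdiff_subset))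
    exact ⟨Set.sdiff_subset, fun h => (h (hA₀S v.2)).2 rfl⟩
  choose B hBS hB hBsum using hclass
  let A : Option (A₀ × Fin w) → Finset V := fun o => o.elim A₀ (fun p => B p.1 p.2)
  have hAS : ∀ o, (A o : Set V) ⊆ S := by
    rintro (_ | p)
    · exact hA₀S
    · exact (hBS p.1 p.2).trans Set.sdiff_subset
  have hA : ∀ o, G.IsIndepSet (A o : Set V) := by
    rintro (_ | p)
    · exact hA₀
    · exact hB p.1 p.2
  have hsum : ∀ K : Finset V, (K : Set V) ⊆ S → #K = w → ∑ o, #(A o ∩ K) = #A₀ * w := by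
    intro K hKS hKc
    have hv : ∀ v : A₀, ∑ i, #(B v i ∩ K) + (if (v : V) ∈ K then 1 else 0) = w := by
      intro v
      have h1 := hBsum v (K.erase v) (by
        intro x hx
        simp only [coe_erase, Set.mem_sdiff, mem_coe, Set.mem_singleton_iff] at hx
        exact ⟨hKS hx.1, hx.2⟩)
      have h2 : ∀ i, B v i ∩ K.erase v = B v i ∩ K := by
        intro i
        ext x
        simp only [mem_inter, mem_erase]
        exact ⟨fun h => ⟨h.1, h.2.2⟩, fun h => ⟨h.1, (hBS v i h.1).2, h.2⟩⟩
      simp only [h2] at h1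
      rw [h1, ← hKc]
      split_ifs with hvK
      · exact card_erase_add_one hvK
      · rw [erase_eq_of_notMem hvK, add_zero]
    have hA₀K : #(A₀ ∩ K) = ∑ v : A₀, if (v : V) ∈ K then 1 else 0 := by
      rw [Finset.sum_coe_sort A₀ (fun v => if v ∈ K then 1 else 0), sum_boole,
        filter_mem_eq_inter]
      rfl
    rw [Fintype.sum_option, Fintype.sum_prod_type]
    change #(A₀ ∩ K) + ∑ v, ∑ i, #(B v i ∩ K) = _
    rw [hA₀K, add_comm, ← sum_add_distrib, sum_congr rfl (fun v _ => hv v)]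
    simp
  choose K hKS hK hKc hKA using fun o => hmiss (A o) (hAS o) (hA o)
  have hinter : ∀ i j, #(A i ∩ K j) = if i = j then 0 else 1 := by
    intro i j
    split_ifs with hij
    · rw [hij]; exact hKA j
    have h1 := hsum (K j) (hKS j) (hKc j)
    rw [← add_sum_erase _ _ (mem_univ j), hKA, zero_add] at h1
    have hle : ∀ i ∈ univ.erase j, #(A i ∩ K j) ≤ 1 := fun i _ => card_inter_le_one (hA i) (hK j)
    refine (sum_eq_sum_iff_of_le hle).mp ?_ i (mem_erase.mpr ⟨hij, mem_univ _⟩)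
    rw [h1]
    simp
  have hne : #A₀ * w ≠ 0 := by
    intro h0
    rw [h0, Nat.le_zero, Set.ncard_eq_zero] at hS
    have : IsEmpty S := Set.isEmpty_coe_sort.mpr hS
    exact hcol (Colorable.of_isEmpty _)
  have hbound := card_le_of_card_inter (S := S.toFinset) (A := A) (K := K) (by simpa using hne)
    (fun i x hx => Set.mem_toFinset.mpr (hAS i hx)) hinter
  rw [← Set.ncard_eq_toFinset_card'] at hbound
  simp only [Fintype.card_option, Fintype.card_prod, Fintype.card_coe, Fintype.card_fin] at hbound
  omega

end PerfectGraph

/-- A graph `G` is perfect iff every induced subgraph `H` has at most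
`α(H) · ω(H)` vertices. -/
theorem perfect_iff_card_le_alpha_mul_omega {V : Type*} [Fintype V]
    (G : SimpleGraph V) :
    IsPerfect G ↔
      ∀ S : Set V, S.ncard ≤ stableNum (G.induce S) * (G.induce S).cliqueNum := by
  classical
  constructor
  · intro h S
    have hcol := chromaticNumber_le_iff_colorable.mp (h S).symm.le
    rw [Set.ncard_eq_toFinset_card', Set.toFinset_card]
    exact PerfectGraph.card_le_stableNum_mul hcol
  · intro h S
    refine le_antisymm ?_ (chromaticNumber_le_iff_colorable.mpr ?_)
    · exact (G.induce S).cliqueNum_le_chromaticNumber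
    · induction S using WellFoundedLT.induction with
      | ind S ih => exact PerfectGraph.colorable_cliqueNum_of_forall_ssubset G S ih (h S)
end

section
/- Every minimally imperfect graph H has at least α(H)·ω(H) + 1 vertices, where α(H) is the cardinality of a largest stable set of H and ω(H) is the cardinality of a largest clique of H. -/
open SimpleGraph

/-- A graph is minimally imperfect if it is not perfect but every proper induced
subgraph of it is perfect. -/
def MinimallyImperfect {V : Type*} (G : SimpleGraph V) : Prop :=
  ¬ IsPerfect G ∧ ∀ S : Set V, S ≠ Set.univ → IsPerfect (G.induce S)

open Finset in
/-- Two families of subsets of `V` whose incidence matrix is `J - I` have at most `|V|` members,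
provided that they have at least two. -/
theorem card_le_card_of_card_inter_eq {I V : Type*} [Fintype I] [Fintype V] [DecidableEq I]
    [DecidableEq V] (A K : I → Finset V) (hI : 2 ≤ Fintype.card I)
    (h : ∀ i j, #(A i ∩ K j) = if i = j then 0 else 1) :
    Fintype.card I ≤ Fintype.card V := by
  have hli : LinearIndependent ℚ fun j : I => fun v : V => if v ∈ K j then (1 : ℚ) else 0 := by
    rw [Fintype.linearIndependent_iff]
    intro g hg
    have hconst : ∀ i, g i = ∑ j, g j := by
      intro i
      have hsum : ∑ v ∈ A i, ∑ j, g j * (if v ∈ K j then (1 : ℚ) else 0) = 0 := by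
        refine sum_eq_zero fun v _ => ?_
        simpa using congrFun hg v
      have hcard : ∀ j, ∑ v ∈ A i, (if v ∈ K j then (1 : ℚ) else 0) = if i = j then 0 else 1 := by
        intro j
        rw [sum_boole, filter_mem_eq_inter, h i j]
        split_ifs <;> simp
      rw [sum_comm] at hsum
      simp_rw [← mul_sum, hcard] at hsum
      have hsplit : ∑ j, g j * (if i = j then (0 : ℚ) else 1) =
          ∑ j, (g j - if i = j then g j else 0) :=
        sum_congr rfl fun j _ => by split_ifs <;> simp
      rw [hsplit, sum_sub_distrib, sum_ite_eq] at hsum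
      simp only [mem_univ, if_true] at hsum
      linarith
    have htotal : ∑ j, g j = Fintype.card I * ∑ j, g j := by
      conv_lhs => rw [sum_congr rfl fun i _ => hconst i]
      simp
    have hcard : (2 : ℚ) ≤ Fintype.card I := by exact_mod_cast hI
    have hzero : ((Fintype.card I : ℚ) - 1) * ∑ j, g j = 0 := by linarith
    intro i
    rw [hconst i]
    exact (mul_eq_zero.mp hzero).resolve_left (by linarith)
  simpa using hli.fintype_card_le_finrank

theorem IsPerfect.colorable {V : Type*} [Finite V] {G : SimpleGraph V} (h : IsPerfect G) :
    G.Colorable G.cliqueNum :=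
  ((chromaticNumber_le_iff_colorable.mp (h Set.univ).ge).mono (G.cliqueNum_induce_le _)).of_hom
    (induceUnivIso G).symm.toHom

namespace MinimallyImperfect

variable {V : Type*} [Fintype V] {H : SimpleGraph V}

theorem not_colorable (h : MinimallyImperfect H) : ¬ H.Colorable H.cliqueNum := by
  refine fun hc => h.1 fun S => le_antisymm cliqueNum_le_chromaticNumber ?_
  rw [chromaticNumber_le_iff_colorable]
  by_cases hS : S = Set.univ
  · subst hS
    obtain ⟨s, hs⟩ := H.exists_isNClique_cliqueNum
    have hs' := hs.map (f := (induceUnivIso H).symm.toEquiv.toEmbedding)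
    have hle : H.cliqueNum ≤ (H.induce Set.univ).cliqueNum := by
      rw [← hs'.card_eq]
      refine IsClique.card_le_cliqueNum (tc := hs'.isClique.mono ?_)
      rw [map_le_iff_le_comap]
      exact fun a b hab => hab
    exact (hc.of_hom (induceUnivIso H).toHom).mono hle
  · exact (h.2 S hS).colorable

theorem nonempty (h : MinimallyImperfect H) : Nonempty V := by
  by_contra hV
  rw [not_nonempty_iff] at hV
  exact h.not_colorable (.of_isEmpty _)

/-- Every stable set of a minimally imperfect graph misses some maximum clique. -/
theorem exists_isNClique_disjoint (h : MinimallyImperfect H) {A : Finset V}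
    (hA : H.IsIndepSet (A : Set V)) :
    ∃ K : Finset V, H.IsNClique H.cliqueNum K ∧ Disjoint A K := by
  classical
  rcases A.eq_empty_or_nonempty with rfl | hne
  · obtain ⟨K, hK⟩ := H.exists_isNClique_cliqueNum
    exact ⟨K, hK, Finset.disjoint_empty_left _⟩
  by_contra! hcon
  have hproper : ((A : Set V)ᶜ) ≠ Set.univ := by
    obtain ⟨a, ha⟩ := hne
    exact fun hu => (hu ▸ Set.mem_univ a : a ∈ (A : Set V)ᶜ) ha
  have hlt : (H.induce (A : Set V)ᶜ).cliqueNum < H.cliqueNum := by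
    refine lt_of_le_of_ne (H.cliqueNum_induce_le _) fun heq => ?_
    obtain ⟨K, hK⟩ := (H.induce (A : Set V)ᶜ).exists_isNClique_cliqueNum
    have hK' := (hK.map (f := Function.Embedding.subtype _)).mono (SimpleGraph.map_comap_le _ H)
    refine hcon _ (heq ▸ hK') (Finset.disjoint_left.mpr fun a ha haK => ?_)
    obtain ⟨b, -, rfl⟩ := Finset.mem_map.mp haK
    exact b.2 ha
  obtain ⟨C⟩ := (h.2 _ hproper).colorable
  refine h.not_colorable (Colorable.mono hlt ?_)
  refine ⟨Coloring.mk
    (fun v => if hv : v ∈ A then Fin.last _ else (C ⟨v, hv⟩).castSucc) ?_⟩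
  intro v w hvw
  by_cases hv : v ∈ A <;> by_cases hw : w ∈ A
  · exact absurd hvw (hA hv hw hvw.ne)
  · simpa [hv, hw] using (Fin.castSucc_lt_last _).ne'
  · simp [hv, hw]
  · have hadj : (H.induce (A : Set V)ᶜ).Adj ⟨v, hv⟩ ⟨w, hw⟩ := hvw
    simpa [hv, hw] using C.valid hadj

/-- Deleting a vertex of a minimally imperfect graph leaves a graph that can be coloured with
as many colours as the clique number of the whole graph. -/
theorem exists_coloring_delete (h : MinimallyImperfect H) (s : V) :
    ∃ c : V → Fin H.cliqueNum, ∀ u v, u ≠ s → v ≠ s → H.Adj u v → c u ≠ c v := by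
  classical
  have hproper : ({s}ᶜ : Set V) ≠ Set.univ :=
    fun hu => (hu ▸ Set.mem_univ s : s ∈ ({s}ᶜ : Set V)) rfl
  obtain ⟨C⟩ := (h.2 _ hproper).colorable.mono (H.cliqueNum_induce_le _)
  have hpos : 0 < H.cliqueNum := by
    have : H.IsClique (({s} : Finset V) : Set V) := by simp
    simpa [Nat.one_le_iff_ne_zero, Nat.pos_iff_ne_zero] using this.card_le_cliqueNum
  refine ⟨fun v => if hv : v = s then ⟨0, hpos⟩ else C ⟨v, hv⟩, fun u v hu hv huv => ?_⟩
  have hadj : (H.induce ({s}ᶜ : Set V)).Adj ⟨u, hu⟩ ⟨v, hv⟩ := huv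
  simpa [hu, hv] using C.valid hadj

open Finset in
/-- There are `α(H) * ω(H) + 1` stable sets that cover every vertex exactly `α(H)` times. -/
theorem exists_stable_family [DecidableEq V] (h : MinimallyImperfect H) :
    ∃ A : Option (Fin (stableNum H) × Fin H.cliqueNum) → Finset V,
      (∀ i, H.IsIndepSet (A i : Set V)) ∧ ∀ v, #{i | v ∈ A i} = stableNum H := by
  obtain ⟨S, hS⟩ := Hᶜ.exists_isNClique_cliqueNum
  have hScard : #S = stableNum H := hS.card_eq
  let e : Fin (stableNum H) ≃ S := (S.equivFinOfCardEq hScard).symm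
  choose c hc using h.exists_coloring_delete
  let A : Option (Fin (stableNum H) × Fin H.cliqueNum) → Finset V := fun i =>
    i.elim S fun p => ({v : V | v ≠ e p.1 ∧ c (e p.1) v = p.2} : Finset V)
  refine ⟨A, ?_, fun v => ?_⟩
  · rintro (_ | ⟨k, a⟩)
    · exact (SimpleGraph.isClique_compl H).mp hS.isClique
    · intro u hu v hv _ hadj
      simp only [A, Option.elim_some, coe_filter, mem_univ, true_and, Set.mem_ofPred_eq] at hu hv
      exact hc _ u v hu.1 hv.1 hadj (hu.2.trans hv.2.symm)
  · have hrow : ∀ k, ∑ a, (if v ∈ A (some (k, a)) then 1 else 0) = if v ≠ e k then 1 else 0 := by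
      intro k
      by_cases hv : v = e k <;> simp [A, hv]
    have hsub : ∑ k, (if v ≠ e k then 1 else 0) + (if v ∈ S then 1 else 0) = stableNum H := by
      have heq : ∑ k, (if v = e k then 1 else 0) = if v ∈ S then 1 else 0 := by
        rw [e.sum_comp fun s : S => if v = s then 1 else 0,
          sum_coe_sort S fun s => if v = s then 1 else 0]
        simp
      rw [← heq, ← sum_add_distrib]
      trans ∑ _k : Fin (stableNum H), 1
      · exact sum_congr rfl fun k _ => by split_ifs <;> simp_all
      · simp
    rw [card_filter, Fintype.sum_option, Fintype.sum_prod_type]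
    simp_rw [hrow]
    rw [add_comm]
    exact hsub

end MinimallyImperfect

open Finset in
theorem card_inter_le_one_of_isIndepSet_of_isClique {V : Type*} [DecidableEq V]
    {G : SimpleGraph V} {A K : Finset V} (hA : G.IsIndepSet (A : Set V))
    (hK : G.IsClique (K : Set V)) : #(A ∩ K) ≤ 1 := by
  rw [card_le_one]
  intro a ha b hb
  rw [mem_inter] at ha hb
  by_contra hab
  exact hA ha.1 hb.1 hab (hK ha.2 hb.2 hab)

/-- Every minimally imperfect graph `H` has at least `α(H) · ω(H) + 1` vertices. -/
theorem minimallyImperfect_card_ge {V : Type*} [Fintype V] (H : SimpleGraph V)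
    (h : MinimallyImperfect H) :
    stableNum H * H.cliqueNum + 1 ≤ Fintype.card V := by
  classical
  obtain hzero | hpos := (stableNum H * H.cliqueNum).eq_zero_or_pos
  · have := h.nonempty
    rw [hzero]
    exact Fintype.card_pos
  obtain ⟨A, hA, hcover⟩ := h.exists_stable_family
  choose K hK hdisj using fun i => h.exists_isNClique_disjoint (hA i)
  have hcard : Fintype.card (Option (Fin (stableNum H) × Fin H.cliqueNum)) =
      stableNum H * H.cliqueNum + 1 := by simp
  rw [← hcard]
  refine card_le_card_of_card_inter_eq A K (by omega) fun i j => ?_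
  split_ifs with hij
  · subst hij
    simpa [Finset.disjoint_iff_inter_eq_empty] using hdisj i
  have hle : ∀ i, (A i ∩ K j).card ≤ if i = j then 0 else 1 := by
    intro i
    split_ifs with hij
    · subst hij
      simpa [Finset.disjoint_iff_inter_eq_empty] using hdisj i
    · exact card_inter_le_one_of_isIndepSet_of_isClique (hA i) (hK j).isClique
  have hsum : ∑ i, (A i ∩ K j).card = stableNum H * H.cliqueNum := by
    simp_rw [Finset.inter_comm _ (K j), ← Finset.filter_mem_eq_inter, Finset.card_filter]
    rw [Finset.sum_comm]
    simp_rw [← Finset.card_filter, hcover]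
    simp [(hK j).card_eq, mul_comm]
  have hones : ∑ i, (if i = j then 0 else 1) = stableNum H * H.cliqueNum := by
    simp [Finset.sum_ite, Finset.filter_ne']
  have heq := (Finset.sum_eq_sum_iff_of_le fun i _ => hle i).mp (hsum.trans hones.symm) i
    (Finset.mem_univ i)
  simpa [hij] using heq
end

section
/- The line graph of a bipartite graph is perfect. -/
open SimpleGraph

/-- `L` is the line graph of `B`: the vertices of `L` are (in bijection with) the
edges of `B`, and two vertices of `L` are adjacent iff the corresponding edges are
distinct and share an endpoint. -/
def IsLineGraphOf {W α : Type*} (L : SimpleGraph W) (B : SimpleGraph α) : Prop :=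
  ∃ f : W ≃ B.edgeSet, ∀ x y : W,
    L.Adj x y ↔ f x ≠ f y ∧ ∃ v : α, v ∈ (f x : Sym2 α) ∧ v ∈ (f y : Sym2 α)

/-- The elements on the alternating chain with colours `p` and `q` that starts at the `a`-vertex
`x`, where elements of `s` are edges with ends given by `a` and `b` and coloured by `c`. -/
inductive KempeChain {E X Y K : Type*} (s : Finset E) (a : E → X) (b : E → Y) (c : E → K)
    (p q : K) (x : X) : E → Prop
  | start {e : E} : e ∈ s → a e = x → c e = q → KempeChain s a b c p q x e
  | left {e f : E} : KempeChain s a b c p q x f → c f = p → e ∈ s → c e = q → a f = a e →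
      KempeChain s a b c p q x e
  | right {e f : E} : KempeChain s a b c p q x f → c f = q → e ∈ s → c e = p → b f = b e →
      KempeChain s a b c p q x e

/-- The map `c` properly colours the edges in `s`, where the ends of an edge are given by
`a` and `b`. -/
def IsEdgeColoringOn {E X Y K : Type*} (s : Finset E) (a : E → X) (b : E → Y) (c : E → K) :
    Prop :=
  ∀ e ∈ s, ∀ f ∈ s, e ≠ f → a e = a f ∨ b e = b f → c e ≠ c f

section KempeChain

variable {E X Y K : Type*} {s : Finset E} {a : E → X} {b : E → Y} {c : E → K} {p q : K} {x : X}

theorem KempeChain.mem {e : E} (h : KempeChain s a b c p q x e) : e ∈ s := by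
  cases h <;> assumption

theorem KempeChain.color_eq {e : E} (h : KempeChain s a b c p q x e) : c e = p ∨ c e = q := by
  cases h <;> simp [*]

/-- The chain is closed under passing to an adjacent element with colour `p` or `q`. -/
theorem KempeChain.of_adjacent (hc : IsEdgeColoringOn s a b c)
    (hp : ∀ e ∈ s, a e = x → c e ≠ p) {e f : E} (he : KempeChain s a b c p q x e) (hf : f ∈ s)
    (hadj : a e = a f ∨ b e = b f) (hcf : c f = p ∨ c f = q) : KempeChain s a b c p q x f := by
  by_cases hef : e = f
  · exact hef ▸ he
  have hne := hc e he.mem f hf hef hadj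
  have hes := he.mem
  have hq : c e = q → c f = p := by grind
  have hp' : c e = p → c f = q := by grind [he.color_eq]
  cases he with
  | start h1 h2 h3 =>
    rcases hadj with h | h
    · exact absurd (hq h3) (hp f hf (h ▸ h2))
    · exact .right (.start h1 h2 h3) h3 hf (hq h3) h
  | @left _ g h1 h2 h3 h4 h5 =>
    rcases hadj with h | h
    · by_cases hgf : g = f
      · exact hgf ▸ h1
      · exact absurd (h2.trans (hq h4).symm) (hc g h1.mem f hf hgf (.inl (h5.trans h)))
    · exact .right (.left h1 h2 h3 h4 h5) h4 hf (hq h4) h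
  | @right _ g h1 h2 h3 h4 h5 =>
    rcases hadj with h | h
    · exact .left (.right h1 h2 h3 h4 h5) h4 hf (hp' h4) h
    · by_cases hgf : g = f
      · exact hgf ▸ h1
      · exact absurd (h2.trans (hp' h4).symm) (hc g h1.mem f hf hgf (.inr (h5.trans h)))

/-- A chain does not reach a `b`-vertex at which the colour `q` is missing. -/
theorem KempeChain.right_ne {y : Y} (hq : ∀ e ∈ s, b e = y → c e ≠ q) {e : E}
    (he : KempeChain s a b c p q x e) : b e ≠ y := by
  intro hy
  cases he with
  | start h1 h2 h3 => exact hq e h1 hy h3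
  | left h1 h2 h3 h4 h5 => exact hq e h3 hy h4
  | right h1 h2 h3 h4 h5 => exact hq _ h1.mem (h5.trans hy) h2

/-- A colouring extends to one more edge, after swapping two colours along a chain, when each of
the two ends of the edge misses a colour. -/
theorem IsEdgeColoringOn.exists_insert [DecidableEq E] (hc : IsEdgeColoringOn s a b c) {e₀ : E}
    (he₀ : e₀ ∉ s) (hp : ∀ e ∈ s, a e = a e₀ → c e ≠ p) (hq : ∀ e ∈ s, b e = b e₀ → c e ≠ q) :
    ∃ c' : E → K, IsEdgeColoringOn (insert e₀ s) a b c' := by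
  classical
  let S := KempeChain s a b c p q (a e₀)
  let d : E → K := fun e => if S e then Equiv.swap p q (c e) else c e
  have hS : ∀ e, S e → c e = p ∨ c e = q := fun e => KempeChain.color_eq
  have hd : IsEdgeColoringOn s a b d := by
    have key : ∀ e ∈ s, ∀ f ∈ s, (a e = a f ∨ b e = b f) → S e → ¬ S f →
        Equiv.swap p q (c e) ≠ c f := by
      intro e _ f hf hadj he hf' h
      refine hf' (KempeChain.of_adjacent hc hp he hf hadj ?_)
      rcases hS e he with h' | h' <;> simp_all
    intro e he f hf hef hadj
    by_cases h1 : S e <;> by_cases h2 : S f <;> simp only [d, h1, h2, if_true, if_false]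
    · exact fun h => hc e he f hf hef hadj ((Equiv.swap p q).injective h)
    · exact key e he f hf hadj h1 h2
    · exact (key f hf e he (hadj.imp Eq.symm Eq.symm) h2 h1).symm
    · exact hc e he f hf hef hadj
  have hnew : ∀ e ∈ s, (a e = a e₀ ∨ b e = b e₀) → d e ≠ q := by
    intro e he hadj
    by_cases h1 : S e <;> simp only [d, h1, if_true, if_false]
    · have hb : b e ≠ b e₀ := KempeChain.right_ne hq h1
      have ha := hp e he (hadj.resolve_right hb)
      have hcq := (hS e h1).resolve_left ha
      rw [hcq, Equiv.swap_apply_right]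
      exact fun h => ha (hcq.trans h.symm)
    · rcases hadj with h | h
      · exact fun h' => h1 (.start he h h')
      · exact hq e he h
  refine ⟨Function.update d e₀ q, fun e he f hf hef hadj => ?_⟩
  rw [Finset.mem_insert] at he hf
  by_cases h1 : e = e₀
  · subst h1
    have h2 : f ≠ e := hef.symm
    rw [Function.update_self, Function.update_of_ne h2]
    exact (hnew f (hf.resolve_left h2) (hadj.imp Eq.symm Eq.symm)).symm
  · rw [Function.update_of_ne h1]
    by_cases h2 : f = e₀
    · subst h2
      rw [Function.update_self]
      exact hnew e (he.resolve_left h1) hadj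
    · rw [Function.update_of_ne h2]
      exact hd e (he.resolve_left h1) f (hf.resolve_left h2) hef hadj

end KempeChain

/-- If fewer than `k` edges of `s` are incident to a vertex, then some colour is missing there. -/
theorem exists_missing_color {E X : Type*} [DecidableEq E] [DecidableEq X] {k : ℕ} {s : Finset E}
    (a : E → X) (c : E → Fin k) {e₀ : E} (he₀ : e₀ ∉ s)
    (h : ((insert e₀ s).filter (fun e => a e = a e₀)).card ≤ k) :
    ∃ p, ∀ e ∈ s, a e = a e₀ → c e ≠ p := by
  rw [Finset.filter_insert, if_pos rfl, Finset.card_insert_of_notMem (by simp [he₀])] at h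
  have hlt : ((s.filter (fun e => a e = a e₀)).image c).card < Fintype.card (Fin k) := by
    rw [Fintype.card_fin]
    exact Finset.card_image_le.trans_lt h
  obtain ⟨p, hp⟩ := Finset.exists_mem_notMem_of_card_lt_card (t := Finset.univ) hlt
  exact ⟨p, fun e he hae hce => hp.2 (Finset.mem_image.2 ⟨e, by simp [he, hae], hce⟩)⟩

/-- **König's edge colouring theorem** for bipartite multigraphs: if every vertex is incident to
at most `k` edges, then the edges have a proper colouring with `k` colours. -/
theorem exists_isEdgeColoringOn {E X Y : Type*} [DecidableEq E] [DecidableEq X] [DecidableEq Y]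
    {k : ℕ} (a : E → X) (b : E → Y) (s : Finset E)
    (ha : ∀ e ∈ s, (s.filter (fun f => a f = a e)).card ≤ k)
    (hb : ∀ e ∈ s, (s.filter (fun f => b f = b e)).card ≤ k) (hk : Nonempty (E → Fin k)) :
    ∃ c : E → Fin k, IsEdgeColoringOn s a b c := by
  induction s using Finset.induction_on with
  | empty => exact ⟨hk.some, by simp [IsEdgeColoringOn]⟩
  | insert e₀ s he₀ ih =>
    have hsub := Finset.subset_insert e₀ s
    obtain ⟨c, hc⟩ := ih
      (fun e he => (Finset.card_le_card (Finset.filter_subset_filter _ hsub)).trans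
        (ha e (hsub he)))
      (fun e he => (Finset.card_le_card (Finset.filter_subset_filter _ hsub)).trans
        (hb e (hsub he)))
    obtain ⟨p, hp⟩ := exists_missing_color a c he₀ (ha e₀ (Finset.mem_insert_self _ _))
    obtain ⟨q, hq⟩ := exists_missing_color b c he₀ (hb e₀ (Finset.mem_insert_self _ _))
    exact hc.exists_insert he₀ hp hq

/-- A finite graph whose adjacency means agreeing under one of two maps has equal clique and
chromatic numbers. -/
theorem cliqueNum_eq_chromaticNumber_of_adj_iff {V X Y : Type*} [Finite V] (G : SimpleGraph V)
    (a : V → X) (b : V → Y) (hG : ∀ u v, G.Adj u v ↔ u ≠ v ∧ (a u = a v ∨ b u = b v)) :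
    (G.cliqueNum : ℕ∞) = G.chromaticNumber := by
  classical
  cases nonempty_fintype V
  refine le_antisymm G.cliqueNum_le_chromaticNumber ?_
  have ha : ∀ e, (Finset.univ.filter (fun f => a f = a e)).card ≤ G.cliqueNum := fun e =>
    IsClique.card_le_cliqueNum (tc := fun u hu v hv huv => (hG u v).2 ⟨huv, .inl (by simp_all)⟩)
  have hb : ∀ e, (Finset.univ.filter (fun f => b f = b e)).card ≤ G.cliqueNum := fun e =>
    IsClique.card_le_cliqueNum (tc := fun u hu v hv huv => (hG u v).2 ⟨huv, .inr (by simp_all)⟩)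
  have hk : Nonempty (V → Fin G.cliqueNum) :=
    ⟨fun e => ⟨0, (Finset.card_pos.2 ⟨e, by simp⟩).trans_le (ha e)⟩⟩
  obtain ⟨c, hc⟩ := exists_isEdgeColoringOn a b Finset.univ (fun e _ => ha e) (fun e _ => hb e) hk
  have hcol : G.Colorable G.cliqueNum := ⟨Coloring.mk c fun {u v} huv =>
    hc u (Finset.mem_univ u) v (Finset.mem_univ v) ((hG u v).1 huv).1 ((hG u v).1 huv).2⟩
  exact hcol.chromaticNumber_le

/-- In a 2-coloured graph, every edge has exactly one end of each colour. -/
theorem existsUnique_mem_edge_color_eq {α : Type*} {B : SimpleGraph α} (C : B.Coloring (Fin 2))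
    (i : Fin 2) (e : B.edgeSet) : ∃! v, v ∈ (e : Sym2 α) ∧ C v = i := by
  obtain ⟨e, he⟩ := e
  induction e using Sym2.ind with
  | _ x y =>
    have hxy : C x ≠ C y := C.valid he
    have h : C x = i ∨ C y = i := by omega
    rcases h with h | h
    · exact ⟨x, by simp [h], by grind⟩
    · exact ⟨y, by simp [h], by grind⟩

/-- The line graph of a bipartite graph is perfect. -/
theorem lineGraph_of_bipartite_isPerfect {W α : Type*} [Fintype W] [Fintype α]
    (B : SimpleGraph α) (L : SimpleGraph W)
    (hB : B.Colorable 2) (hL : IsLineGraphOf L B) :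
    IsPerfect L := by
  obtain ⟨C⟩ := hB
  obtain ⟨f, hf⟩ := hL
  choose t ht hu using existsUnique_mem_edge_color_eq C
  intro S
  refine cliqueNum_eq_chromaticNumber_of_adj_iff _ (fun w : S => t 0 (f w)) (fun w => t 1 (f w))
    fun u v => ?_
  rw [comap_adj, Function.Embedding.subtype_apply, Function.Embedding.subtype_apply, hf,
    f.injective.ne_iff, Subtype.coe_injective.ne_iff]
  refine and_congr_right fun _ => ⟨?_, ?_⟩
  · rintro ⟨w, hwu, hwv⟩
    have h : ∀ i, C w = i → t i (f u) = t i (f v) := fun i hi =>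
      (hu i _ w ⟨hwu, hi⟩).symm.trans (hu i _ w ⟨hwv, hi⟩)
    have hC : C w = 0 ∨ C w = 1 := by omega
    exact hC.imp (h 0) (h 1)
  · rintro (h | h)
    · exact ⟨_, (ht 0 (f u)).1, h ▸ (ht 0 (f v)).1⟩
    · exact ⟨_, (ht 1 (f u)).1, h ▸ (ht 1 (f v)).1⟩
end

section
/- Let G be a graph with a 2-join with parts V1, V2 and attachment sets A1, B1 ⊆ V1 and A2, B2 ⊆ V2, and let G1 and G2 be the two blocks of the 2-join decomposition. Then G is perfect if and only if both G1 and G2 are perfect. -/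
open SimpleGraph

/-- The data of a 2-join of `G` with parts `V1, V2` and attachment sets
`A1, B1 ⊆ V1`, `A2, B2 ⊆ V2`. -/
def IsTwoJoin {V : Type*} (G : SimpleGraph V)
    (V1 V2 A1 B1 A2 B2 : Set V) : Prop :=
  V1 ∪ V2 = Set.univ ∧ Disjoint V1 V2 ∧
  3 ≤ V1.ncard ∧ 3 ≤ V2.ncard ∧
  A1.Nonempty ∧ B1.Nonempty ∧ A2.Nonempty ∧ B2.Nonempty ∧
  A1 ⊆ V1 ∧ B1 ⊆ V1 ∧ A2 ⊆ V2 ∧ B2 ⊆ V2 ∧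
  Disjoint A1 B1 ∧ Disjoint A2 B2 ∧
  (∀ a1 ∈ A1, ∀ a2 ∈ A2, G.Adj a1 a2) ∧
  (∀ b1 ∈ B1, ∀ b2 ∈ B2, G.Adj b1 b2) ∧
  (∀ v1 ∈ V1, ∀ v2 ∈ V2, G.Adj v1 v2 →
    (v1 ∈ A1 ∧ v2 ∈ A2) ∨ (v1 ∈ B1 ∧ v2 ∈ B2))

/-- A graph has a 2-join. -/
def HasTwoJoin {V : Type*} (G : SimpleGraph V) : Prop :=
  ∃ V1 V2 A1 B1 A2 B2 : Set V, IsTwoJoin G V1 V2 A1 B1 A2 B2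

/-- `A2` and `B2` lie in different connected components of the subgraph of `G`
induced by `V2`. -/
def SeparatedSides {V : Type*} (G : SimpleGraph V) (V2 A2 B2 : Set V) : Prop :=
  ∀ p q : V2, (p : V) ∈ A2 → (q : V) ∈ B2 → ¬ (G.induce V2).Reachable p q

/-- `S` is the vertex set of the block of the 2-join on the side of `V1`: if `A2`
and `B2` lie in different components of `G(V2)` then `S = V1 ∪ {p, q}` with
`p ∈ A2`, `q ∈ B2`; otherwise `S = V1 ∪ V(P)` where `P` is a shortest path from
`A2` to `B2` inside `G(V2)`. -/
def IsBlockSet {V : Type*} (G : SimpleGraph V) (V1 V2 A2 B2 : Set V)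
    (S : Set V) : Prop :=
  (SeparatedSides G V2 A2 B2 ∧ ∃ p ∈ A2, ∃ q ∈ B2, S = V1 ∪ {p, q}) ∨
  (¬ SeparatedSides G V2 A2 B2 ∧
    ∃ (p q : V2) (P : (G.induce V2).Walk p q), (p : V) ∈ A2 ∧ (q : V) ∈ B2 ∧
      P.IsPath ∧
      (∀ (p' q' : V2) (P' : (G.induce V2).Walk p' q'),
        (p' : V) ∈ A2 → (q' : V) ∈ B2 → P'.IsPath → P.length ≤ P'.length) ∧
      S = V1 ∪ (Subtype.val '' {v : V2 | v ∈ P.support}))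

/-- Every clique contained in `T` has at most `n` vertices. -/
def CliqueBound {V : Type*} (G : SimpleGraph V) (T : Set V) (n : ℕ) : Prop :=
  ∀ K : Finset V, (K : Set V) ⊆ T → G.IsClique (K : Set V) → K.card ≤ n

/-- The vertices of `T` can be properly coloured from `C` in such a way that those in `A` receive
colours from `X` and those in `B` receive colours from `Y`. -/
def SideColorable {V : Type*} (G : SimpleGraph V) (T A B : Set V) (C X Y : Finset ℕ) : Prop :=
  ∃ f : V → ℕ, (∀ v ∈ T, f v ∈ C) ∧ (∀ u ∈ T, ∀ v ∈ T, G.Adj u v → f u ≠ f v) ∧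
    (∀ v ∈ T, v ∈ A → f v ∈ X) ∧ (∀ v ∈ T, v ∈ B → f v ∈ Y)

/-- Every subset of `S` can be properly coloured by as many colours as its cliques permit. -/
def PerfectOn {V : Type*} (G : SimpleGraph V) (S : Set V) : Prop :=
  ∀ T ⊆ S, ∀ C : Finset ℕ, CliqueBound G T C.card →
    ∃ f : V → ℕ, (∀ v ∈ T, f v ∈ C) ∧ ∀ u ∈ T, ∀ v ∈ T, G.Adj u v → f u ≠ f v

lemma CliqueBound.mono {V : Type*} {G : SimpleGraph V} {T T' : Set V} {m n : ℕ}
    (h : CliqueBound G T m) (hT : T' ⊆ T) (hn : m ≤ n) : CliqueBound G T' n :=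
  fun K hK hc => (h K (hK.trans hT) hc).trans hn

lemma PerfectOn.mono {V : Type*} {G : SimpleGraph V} {S S' : Set V}
    (h : PerfectOn G S) (hS : S' ⊆ S) : PerfectOn G S' :=
  fun T hT => h T (hT.trans hS)

lemma isPerfect_iff_perfectOn {V : Type*} [Finite V] (G : SimpleGraph V) :
    IsPerfect G ↔ PerfectOn G Set.univ := by
  classical
  constructor
  · intro h T _ C hT
    obtain ⟨s, hs⟩ := (G.induce T).exists_isNClique_cliqueNum
    have hle : (G.induce T).cliqueNum ≤ C.card := by
      rw [← hs.card_eq, ← Finset.card_map (Function.Embedding.subtype (· ∈ T))]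
      refine hT _ ?_ ?_
      · intro v hv
        simp only [Finset.coe_map, Set.mem_image] at hv
        obtain ⟨x, -, rfl⟩ := hv
        exact x.2
      · intro u hu v hv huv
        simp only [Finset.coe_map, Set.mem_image] at hu hv
        obtain ⟨x, hx, rfl⟩ := hu
        obtain ⟨y, hy, rfl⟩ := hv
        exact hs.isClique hx hy (fun e => huv (by rw [e]))
    have hcol : (G.induce T).Colorable C.card := by
      rw [← chromaticNumber_le_iff_colorable, ← h T]
      exact_mod_cast hle
    obtain ⟨col⟩ := hcol
    refine ⟨fun v => if hv : v ∈ T then (C.equivFin.symm (col ⟨v, hv⟩) : ℕ) else 0, ?_, ?_⟩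
    · intro v hv
      simp only [hv, dif_pos]
      exact (C.equivFin.symm _).2
    · intro u hu v hv huv
      simp only [hu, hv, dif_pos]
      intro e
      have := C.equivFin.symm.injective (Subtype.ext e)
      exact col.valid (v := ⟨u, hu⟩) (w := ⟨v, hv⟩) huv this
  · intro h T
    refine le_antisymm cliqueNum_le_chromaticNumber ?_
    rw [chromaticNumber_le_iff_colorable]
    have hT : CliqueBound G T (Finset.range (G.induce T).cliqueNum).card := by
      intro K hK hc
      rw [Finset.card_range]
      have : (K.subtype (· ∈ T)).card = K.card := by
        rw [Finset.card_subtype, Finset.filter_true_of_mem (fun x hx => hK hx)]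
      rw [← this]
      refine IsClique.card_le_cliqueNum (tc := ?_)
      intro u hu v hv huv
      simp only [Finset.mem_coe, Finset.mem_subtype] at hu hv
      exact hc hu hv (fun e => huv (Subtype.ext e))
    obtain ⟨f, hf, hp⟩ := h T (Set.subset_univ _) _ hT
    exact ⟨Coloring.mk (fun v => ⟨f v, Finset.mem_range.1 (hf v v.2)⟩)
      (fun {u v} huv e => hp u u.2 v v.2 huv (Fin.mk.inj_iff.1 e))⟩

lemma isPerfect_induce_iff_perfectOn {V : Type*} [Finite V] (G : SimpleGraph V) (S : Set V) :
    IsPerfect (G.induce S) ↔ PerfectOn G S := by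
  classical
  rw [isPerfect_iff_perfectOn]
  constructor
  · intro h T hTS C hT
    have : CliqueBound (G.induce S) (Subtype.val ⁻¹' T) C.card := by
      intro K hK hc
      rw [← Finset.card_map (Function.Embedding.subtype (· ∈ S))]
      refine hT _ ?_ ?_
      · intro v hv
        simp only [Finset.coe_map, Set.mem_image] at hv
        obtain ⟨x, hx, rfl⟩ := hv
        exact hK hx
      · intro u hu v hv huv
        simp only [Finset.coe_map, Set.mem_image] at hu hv
        obtain ⟨x, hx, rfl⟩ := hu
        obtain ⟨y, hy, rfl⟩ := hv
        exact hc hx hy (fun e => huv (by rw [e]))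
    obtain ⟨f, hf, hp⟩ := h _ (Set.subset_univ _) C this
    refine ⟨fun v => if hv : v ∈ S then f ⟨v, hv⟩ else 0, ?_, ?_⟩
    · intro v hv
      simp only [hTS hv, dif_pos]
      exact hf _ hv
    · intro u hu v hv huv
      simp only [hTS hu, hTS hv, dif_pos]
      exact hp _ hu _ hv huv
  · intro h T _ C hT
    have : CliqueBound G (Subtype.val '' T) C.card := by
      intro K hK hc
      have hKS : ∀ x ∈ K, x ∈ S := by
        intro x hx
        obtain ⟨y, -, rfl⟩ := hK hx
        exact y.2
      have e : (K.subtype (· ∈ S)).card = K.card := by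
        rw [Finset.card_subtype, Finset.filter_true_of_mem hKS]
      rw [← e]
      refine hT _ ?_ ?_
      · intro x hx
        simp only [Finset.mem_coe, Finset.mem_subtype] at hx
        obtain ⟨y, hy, hyx⟩ := hK hx
        rwa [← Subtype.ext hyx]
      · intro u hu v hv huv
        simp only [Finset.mem_coe, Finset.mem_subtype] at hu hv
        exact hc hu hv (fun e => huv (Subtype.ext e))
    obtain ⟨f, hf, hp⟩ := h _ (by rintro _ ⟨x, -, rfl⟩; exact x.2) C this
    exact ⟨fun v => f v, fun v hv => hf v ⟨v, hv, rfl⟩,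
      fun u hu v hv huv => hp u ⟨u, hu, rfl⟩ v ⟨v, hv, rfl⟩ huv⟩

/-- Weighted form of Lovász's replication lemma. -/
theorem PerfectOn.exists_multicoloring {V : Type*} [Fintype V] {G : SimpleGraph V} {S : Set V}
    (hS : PerfectOn G S) (w : V → ℕ) (hw : ∀ v ∉ S, w v = 0) (C : Finset ℕ)
    (hC : ∀ K : Finset V, G.IsClique (K : Set V) → ∑ v ∈ K, w v ≤ C.card) :
    ∃ c : V → Finset ℕ, (∀ v, c v ⊆ C) ∧ (∀ v, (c v).card = w v) ∧
      ∀ u v, G.Adj u v → Disjoint (c u) (c v) := by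
  classical
  induction hN : ∑ v, w v using Nat.strong_induction_on generalizing w C with
  | _ N ih =>
  subst hN
  by_cases h1 : ∀ v, w v ≤ 1
  · have hT : CliqueBound G {v | w v = 1} C.card := by
      intro K hK hc
      have := hC K hc
      rwa [Finset.sum_congr rfl (fun v hv => (hK hv : w v = 1)), Finset.sum_const, smul_eq_mul,
        mul_one] at this
    obtain ⟨f, hf, hp⟩ := hS {v | w v = 1}
      (fun v (hv : w v = 1) => by by_contra h; simp [hw v h] at hv) C hT
    refine ⟨fun v => if w v = 1 then {f v} else ∅, fun v => ?_, fun v => ?_, fun u v huv => ?_⟩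
    · dsimp only
      split_ifs with h
      · simpa using hf v h
      · simp
    · dsimp only
      split_ifs with h
      · simp [h]
      · have := h1 v
        simp; omega
    · dsimp only
      split_ifs with hu hv <;> try simp
      exact fun e => hp u hu v hv huv e
  · push Not at h1
    obtain ⟨x, hx⟩ := h1
    have hle : ∀ v, Function.update w x (w x - 1) v ≤ w v := by
      intro v
      by_cases h : v = x
      · subst h; simp
      · simp [h]
    obtain ⟨c, hcC, hcw, hcd⟩ := ih (∑ v, Function.update w x (w x - 1) v)
      (Finset.sum_lt_sum (fun v _ => hle v) ⟨x, Finset.mem_univ _, by simp; omega⟩)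
      (Function.update w x (w x - 1))
      (fun v hv => Nat.le_zero.1 ((hle v).trans (hw v hv).le)) C
      (fun K hK => (Finset.sum_le_sum fun v _ => hle v).trans (hC K hK)) rfl
    have hxne : (c x).Nonempty := by
      rw [← Finset.card_pos, hcw x]
      simp; omega
    obtain ⟨i, hi⟩ := hxne
    have hiC : i ∈ C := hcC x hi
    have hpos : ∀ v, i ∈ c v → 1 ≤ w v := by
      intro v hv
      refine le_trans ?_ (hle v)
      rw [← hcw v]
      exact Finset.card_pos.2 ⟨i, hv⟩
    set w' : V → ℕ := fun v => if i ∈ c v then w v - 1 else w v with hw'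
    have hle' : ∀ v, w' v ≤ w v := by
      intro v
      simp only [hw']
      split_ifs <;> omega
    have hlt' : ∀ v, i ∈ c v → w' v < w v := by
      intro v hv
      have := hpos v hv
      simp only [hw', hv, if_true]
      omega
    have hcl : ∀ K : Finset V, G.IsClique (K : Set V) → ∑ v ∈ K, w' v ≤ (C.erase i).card := by
      intro K hK
      rw [Finset.card_erase_of_mem hiC]
      by_cases hm : ∃ v ∈ K, i ∈ c v
      · obtain ⟨v, hvK, hv⟩ := hm
        have := (Finset.sum_lt_sum (fun v _ => hle' v) ⟨v, hvK, hlt' v hv⟩).trans_le (hC K hK)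
        omega
      · push Not at hm
        have hsum : ∑ v ∈ K, w' v = (K.biUnion c).card := by
          rw [Finset.card_biUnion]
          · refine Finset.sum_congr rfl fun v hv => ?_
            have hvx : v ≠ x := fun e => hm v hv (e ▸ hi)
            rw [hcw v, Function.update_of_ne hvx]
            simp [hw', hm v hv]
          · intro u hu v hv huv
            exact hcd u v (hK hu hv huv)
        rw [hsum, ← Finset.card_erase_of_mem hiC]
        refine Finset.card_le_card fun j hj => ?_
        obtain ⟨v, hv, hjv⟩ := Finset.mem_biUnion.1 hj
        exact Finset.mem_erase.2 ⟨fun e => hm v hv (e ▸ hjv), hcC v hjv⟩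
    obtain ⟨d, hdC, hdw, hdd⟩ := ih (∑ v, w' v)
      (Finset.sum_lt_sum (fun v _ => hle' v) ⟨x, Finset.mem_univ _, hlt' x hi⟩) w'
      (fun v hv => Nat.le_zero.1 ((hle' v).trans (hw v hv).le)) (C.erase i) hcl rfl
    have hid : ∀ v, i ∉ d v := fun v h => by simpa using hdC v h
    refine ⟨fun v => if i ∈ c v then insert i (d v) else d v, fun v => ?_, fun v => ?_,
      fun u v huv => ?_⟩
    · have := (hdC v).trans (Finset.erase_subset _ _)
      dsimp only
      split_ifs
      · exact Finset.insert_subset hiC this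
      · exact this
    · dsimp only
      split_ifs with h
      · have := hpos v h
        rw [Finset.card_insert_of_notMem (hid v), hdw v]
        simp only [hw', h, if_true]
        omega
      · rw [hdw v]
        simp only [hw', h, if_false]
    · have h1 := hdd u v huv
      have h2 := hid u
      have h3 := hid v
      dsimp only
      split_ifs with hu hv hv
      · exact absurd hv (Finset.disjoint_left.1 (hcd u v huv) hu)
      · exact Finset.disjoint_insert_left.2 ⟨h3, h1⟩
      · exact Finset.disjoint_insert_right.2 ⟨h2, h1⟩
      · exact h1

lemma exists_equiv_of_card_filter_eq (C : Finset ℕ) (P Q : ℕ → Prop) [DecidablePred P]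
    [DecidablePred Q] (h : (C.filter P).card = (C.filter Q).card) :
    Nonempty ({i : C // P i} ≃ {i : C // Q i}) := by
  have key : ∀ (R : ℕ → Prop) [DecidablePred R],
      Nonempty ({i : C // R i} ≃ {i // i ∈ C.filter R}) := fun R _ =>
    ⟨(Equiv.subtypeSubtypeEquivSubtypeInter (· ∈ C) R).trans
      (Equiv.subtypeEquivRight fun i => by simp)⟩
  obtain ⟨e⟩ := key P
  obtain ⟨e'⟩ := key Q
  exact ⟨(e.trans (Finset.equivOfCardEq h)).trans e'.symm⟩

lemma SideColorable.perm {V : Type*} {G : SimpleGraph V} {T A B : Set V} {C X Y X' Y' : Finset ℕ}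
    (h : SideColorable G T A B C X Y) (hX : X ⊆ C) (hY : Y ⊆ C) (hX' : X' ⊆ C) (hY' : Y' ⊆ C)
    (h1 : X.card = X'.card) (h2 : Y.card = Y'.card) (h3 : (X ∩ Y).card = (X' ∩ Y').card) :
    SideColorable G T A B C X' Y' := by
  classical
  have hfib : ∀ b : Prop × Prop, Nonempty
      ({i : C // ((i : ℕ) ∈ X, (i : ℕ) ∈ Y) = b} ≃ {i : C // ((i : ℕ) ∈ X', (i : ℕ) ∈ Y') = b}) := by
    rintro ⟨p, q⟩
    refine exists_equiv_of_card_filter_eq C (fun i => (i ∈ X, i ∈ Y) = (p, q))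
      (fun i => (i ∈ X', i ∈ Y') = (p, q)) ?_
    have e1 : ∀ X Y : Finset ℕ, X ⊆ C → Y ⊆ C →
        (C.filter fun i => (i ∈ X, i ∈ Y) = (p, q)).card =
        if p then (if q then (X ∩ Y).card else X.card - (X ∩ Y).card)
        else (if q then Y.card - (X ∩ Y).card
          else C.card - (X.card + Y.card - (X ∩ Y).card)) := by
      intro X Y hX hY
      by_cases hp : p <;> by_cases hq : q <;> simp only [hp, hq, if_true, if_false]
      · congr 1
        ext i
        have := @hX i
        simp only [Prod.mk.injEq, eq_iff_iff, Finset.mem_filter, Finset.mem_inter]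
        tauto
      · rw [← Finset.card_sdiff_of_subset Finset.inter_subset_left]
        congr 1
        ext i
        have := @hX i
        simp only [Prod.mk.injEq, eq_iff_iff, Finset.mem_filter, Finset.mem_inter,
          Finset.mem_sdiff]
        tauto
      · rw [← Finset.card_sdiff_of_subset Finset.inter_subset_right]
        congr 1
        ext i
        have := @hY i
        simp only [Prod.mk.injEq, eq_iff_iff, Finset.mem_filter, Finset.mem_inter,
          Finset.mem_sdiff]
        tauto
      · rw [← Finset.card_union, ← Finset.card_sdiff_of_subset (Finset.union_subset hX hY)]
        congr 1
        ext i
        simp only [Prod.mk.injEq, eq_iff_iff, Finset.mem_filter, Finset.mem_union,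
          Finset.mem_sdiff]
        tauto
    rw [e1 X Y hX hY, e1 X' Y' hX' hY', h1, h2, h3]
  let σ : C ≃ C := Equiv.ofFiberEquiv fun b => (hfib b).some
  have hσ : ∀ i : C, ((σ i : ℕ) ∈ X', (σ i : ℕ) ∈ Y') = ((i : ℕ) ∈ X, (i : ℕ) ∈ Y) := fun i =>
    Equiv.ofFiberEquiv_map (f := fun i : C => ((i : ℕ) ∈ X, (i : ℕ) ∈ Y))
      (g := fun i : C => ((i : ℕ) ∈ X', (i : ℕ) ∈ Y')) (fun b => (hfib b).some) i
  obtain ⟨f, hfC, hfp, hfA, hfB⟩ := h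
  refine ⟨fun v => if hv : f v ∈ C then σ ⟨f v, hv⟩ else 0, fun v hv => ?_,
    fun u hu v hv huv => ?_, fun v hv hA => ?_, fun v hv hB => ?_⟩
  · simp only [hfC v hv, dif_pos]
    exact (σ _).2
  · simp only [hfC v hv, hfC u hu, dif_pos]
    intro e
    exact hfp u hu v hv huv (Subtype.mk.inj (σ.injective (Subtype.ext e)))
  · simp only [hfC v hv, dif_pos]
    have := congrArg Prod.fst (hσ ⟨f v, hfC v hv⟩)
    exact this.mpr (hfA v hv hA)
  · simp only [hfC v hv, dif_pos]
    have := congrArg Prod.snd (hσ ⟨f v, hfC v hv⟩)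
    exact this.mpr (hfB v hv hB)

namespace IsTwoJoin

variable {V : Type*} {G : SimpleGraph V} {V1 V2 A1 B1 A2 B2 : Set V}

lemma symm (h : IsTwoJoin G V1 V2 A1 B1 A2 B2) : IsTwoJoin G V2 V1 A2 B2 A1 B1 := by
  obtain ⟨h1, h2, h3, h4, h5, h6, h7, h8, h9, h10, h11, h12, h13, h14, h15, h16, h17⟩ := h
  exact ⟨by rwa [Set.union_comm], h2.symm, h4, h3, h7, h8, h5, h6, h11, h12, h9, h10, h14, h13,
    fun a ha b hb => (h15 b hb a ha).symm, fun a ha b hb => (h16 b hb a ha).symm,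
    fun a ha b hb hab => (h17 b hb a ha hab.symm).imp And.symm And.symm⟩

lemma swap (h : IsTwoJoin G V1 V2 A1 B1 A2 B2) : IsTwoJoin G V1 V2 B1 A1 B2 A2 := by
  obtain ⟨h1, h2, h3, h4, h5, h6, h7, h8, h9, h10, h11, h12, h13, h14, h15, h16, h17⟩ := h
  exact ⟨h1, h2, h3, h4, h6, h5, h8, h7, h10, h9, h12, h11, h13.symm, h14.symm, h16, h15,
    fun a ha b hb hab => (h17 a ha b hb hab).symm⟩

lemma disjoint (h : IsTwoJoin G V1 V2 A1 B1 A2 B2) : Disjoint V1 V2 := h.2.1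

lemma disjoint_left (h : IsTwoJoin G V1 V2 A1 B1 A2 B2) : Disjoint A1 B1 :=
  h.2.2.2.2.2.2.2.2.2.2.2.2.1

lemma subset_left (h : IsTwoJoin G V1 V2 A1 B1 A2 B2) : A1 ⊆ V1 :=
  h.2.2.2.2.2.2.2.2.1

lemma mem_or_mem (h : IsTwoJoin G V1 V2 A1 B1 A2 B2) (v : V) : v ∈ V1 ∨ v ∈ V2 := by
  have := h.1.ge (Set.mem_univ v)
  exact this

lemma adj_iff (h : IsTwoJoin G V1 V2 A1 B1 A2 B2) {u v : V} (hu : u ∈ V1) (hv : v ∈ V2) :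
    G.Adj u v ↔ (u ∈ A1 ∧ v ∈ A2) ∨ (u ∈ B1 ∧ v ∈ B2) := by
  obtain ⟨h1, h2, h3, h4, h5, h6, h7, h8, h9, h10, h11, h12, h13, h14, h15, h16, h17⟩ := h
  refine ⟨h17 u hu v hv, ?_⟩
  rintro (⟨a, b⟩ | ⟨a, b⟩)
  exacts [h15 _ a _ b, h16 _ a _ b]

/-- Colour `W ⊆ V1` together with a multicolouring of a triangle-free set `Q ⊆ V2` with prescribed
numbers of colours `ω`. -/
theorem exists_coloring_of_weights [Fintype V] (h : IsTwoJoin G V1 V2 A1 B1 A2 B2) {S W Q : Set V}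
    (hS : PerfectOn G S) (hWS : W ⊆ S) (hQS : Q ⊆ S) (hWV : W ⊆ V1) (hQV : Q ⊆ V2)
    {C : Finset ℕ} {x y : ℕ} (ω : V → ℕ)
    (hW : CliqueBound G W C.card) (hA : CliqueBound G (W ∩ A1) x) (hB : CliqueBound G (W ∩ B1) y)
    (hωA : ∀ u ∈ Q, u ∈ A2 → ω u + x ≤ C.card) (hωB : ∀ u ∈ Q, u ∈ B2 → ω u + y ≤ C.card)
    (hω : ∀ u ∈ Q, ω u ≤ C.card)
    (hω2 : ∀ u ∈ Q, ∀ v ∈ Q, G.Adj u v → ω u + ω v ≤ C.card)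
    (hQ3 : ∀ u ∈ Q, ∀ v ∈ Q, ∀ z ∈ Q, G.Adj u v → G.Adj u z → ¬ G.Adj v z)
    (hQA : ∀ u ∈ Q, ∀ v ∈ Q, u ∈ A2 → v ∈ A2 → ¬ G.Adj u v)
    (hQB : ∀ u ∈ Q, ∀ v ∈ Q, u ∈ B2 → v ∈ B2 → ¬ G.Adj u v) :
    ∃ (f : V → ℕ) (c : V → Finset ℕ), (∀ v ∈ W, f v ∈ C) ∧
      (∀ u ∈ W, ∀ v ∈ W, G.Adj u v → f u ≠ f v) ∧
      (∀ u ∈ Q, c u ⊆ C) ∧ (∀ u ∈ Q, (c u).card = ω u) ∧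
      (∀ u ∈ Q, ∀ v ∈ Q, G.Adj u v → Disjoint (c u) (c v)) ∧
      ∀ v ∈ W, ∀ u ∈ Q, G.Adj v u → f v ∉ c u := by
  classical
  have hdis : ∀ v ∈ W, v ∉ Q := fun v hv hq =>
    Set.disjoint_left.1 h.disjoint (hWV hv) (hQV hq)
  have hAB1 : ∀ v, v ∈ A1 → v ∉ B1 := fun _ hv => Set.disjoint_left.1 h.disjoint_left hv
  have hAB2 : ∀ v, v ∈ A2 → v ∉ B2 := fun _ hv => Set.disjoint_left.1 h.symm.disjoint_left hv
  obtain ⟨c, hcC, hcw, hcd⟩ := hS.exists_multicoloring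
    (fun v => (if v ∈ W then 1 else 0) + (if v ∈ Q then ω v else 0))
    (fun v hv => by simp [mt (@hWS v) hv, mt (@hQS v) hv]) C (by
      intro K hK
      rw [Finset.sum_add_distrib, ← Finset.card_filter, ← Finset.sum_filter]
      have hKW : ∀ D : Set V, (∀ z ∈ K, z ∈ W → z ∈ D) → ∀ n, CliqueBound G D n →
          (K.filter (· ∈ W)).card ≤ n := by
        intro D hD n hn
        refine hn _ (fun z hz => ?_) (hK.subset (Finset.coe_subset.2 (Finset.filter_subset _ _)))
        rw [Finset.mem_coe, Finset.mem_filter] at hz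
        exact hD z hz.1 hz.2
      have hadj : ∀ z ∈ K, z ∈ W → ∀ u ∈ K, u ∈ Q → (z ∈ A1 ∧ u ∈ A2) ∨ (z ∈ B1 ∧ u ∈ B2) :=
        fun z hz hzW u hu huQ => (h.adj_iff (hWV hzW) (hQV huQ)).1
          (hK hz hu (fun e => hdis z hzW (e ▸ huQ)))
      rcases Nat.lt_or_ge 2 (K.filter (· ∈ Q)).card with h3 | h2
      · obtain ⟨a, b, d, ha, hb, hd, hab, had, hbd⟩ := Finset.two_lt_card_iff.1 h3
        rw [Finset.mem_filter] at ha hb hd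
        exact absurd (hK hb.1 hd.1 hbd)
          (hQ3 a ha.2 b hb.2 d hd.2 (hK ha.1 hb.1 hab) (hK ha.1 hd.1 had))
      interval_cases hc : (K.filter (· ∈ Q)).card
      · rw [Finset.card_eq_zero] at hc
        rw [hc, Finset.sum_empty, add_zero]
        exact hKW W (fun z _ hz => hz) _ hW
      · obtain ⟨u, hu⟩ := Finset.card_eq_one.1 hc
        have huK : u ∈ K.filter (· ∈ Q) := by simp [hu]
        rw [Finset.mem_filter] at huK
        rw [hu, Finset.sum_singleton]
        by_cases huA : u ∈ A2
        · have := hKW (W ∩ A1) (fun z hz hzW => ⟨hzW, by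
            have := hadj z hz hzW u huK.1 huK.2
            have := hAB2 u huA
            tauto⟩) x hA
          have := hωA u huK.2 huA
          omega
        by_cases huB : u ∈ B2
        · have := hKW (W ∩ B1) (fun z hz hzW => ⟨hzW, by
            have := hadj z hz hzW u huK.1 huK.2
            tauto⟩) y hB
          have := hωB u huK.2 huB
          omega
        · have := hKW ∅ (fun z hz hzW => by
            have := hadj z hz hzW u huK.1 huK.2
            tauto) 0 (fun L hL _ => by simpa using hL)
          have := hω u huK.2
          omega
      · obtain ⟨u, v, huv, hQuv⟩ := Finset.card_eq_two.1 hc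
        have huK : u ∈ K.filter (· ∈ Q) := by simp [hQuv]
        have hvK : v ∈ K.filter (· ∈ Q) := by simp [hQuv]
        rw [Finset.mem_filter] at huK hvK
        have had := hK huK.1 hvK.1 huv
        rw [hQuv, Finset.sum_pair huv]
        have := hKW ∅ (fun z hz hzW => by
            have h1 := hadj z hz hzW u huK.1 huK.2
            have h2 := hadj z hz hzW v hvK.1 hvK.2
            have h3 := hQA u huK.2 v hvK.2
            have h4 := hQB u huK.2 v hvK.2
            have h5 := hAB1 z
            exfalso
            tauto) 0 (fun L hL _ => by simpa using hL)
        have := hω2 u huK.2 v hvK.2 had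
        omega)
  have hone : ∀ v, v ∈ W → ∃ i, c v = {i} := fun v hv =>
    Finset.card_eq_one.1 (by rw [hcw v]; simp [hv, hdis v hv])
  choose! f hf using hone
  refine ⟨f, c, fun v hv => ?_, fun u hu v hv huv e => ?_, fun u _ => hcC u, fun u hu => ?_,
    fun u _ v _ => hcd u v, fun v hv u _ hvu hm => ?_⟩
  · exact hcC v (by rw [hf v hv]; simp)
  · have := hcd u v huv
    rw [hf u hu, hf v hv, e] at this
    simp at this
  · rw [hcw u]
    have : u ∉ W := fun hw => hdis u hw hu
    simp [hu, this]
  · have := hcd v u hvu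
    rw [hf v hv] at this
    exact Finset.disjoint_singleton_left.1 this hm

end IsTwoJoin

/-- A chordless path with `n` edges inside `V2 ∩ S`, given by its sequence of vertices, from `A2`
to `B2` and with no interior vertex in `A2 ∪ B2`. -/
def HasConnectingPath {V : Type*} (G : SimpleGraph V) (V2 A2 B2 S : Set V) (n : ℕ) : Prop :=
  ∃ u : ℕ → V, (∀ i ≤ n, u i ∈ V2 ∧ u i ∈ S) ∧ u 0 ∈ A2 ∧ u n ∈ B2 ∧
    (∀ i ≤ n, u i ∈ A2 → i = 0) ∧ (∀ i ≤ n, u i ∈ B2 → i = n) ∧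
    (∀ i < n, G.Adj (u i) (u (i + 1))) ∧
    (∀ i j, i < j → j ≤ n → G.Adj (u i) (u j) → j = i + 1) ∧
    (∀ i ≤ n, ∀ j ≤ n, u i = u j → i = j)

lemma HasConnectingPath.swap {V : Type*} {G : SimpleGraph V} {V2 A2 B2 S : Set V} {n : ℕ}
    (h : HasConnectingPath G V2 A2 B2 S n) : HasConnectingPath G V2 B2 A2 S n := by
  obtain ⟨u, h1, h2, h3, h4, h5, h6, h7, h8⟩ := h
  refine ⟨fun i => u (n - i), fun i _ => h1 _ (by omega), by simpa using h3, by simpa using h2,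
    fun i hi hu => ?_, fun i hi hu => ?_, fun i hi => ?_, fun i j hij hj hu => ?_,
    fun i hi j hj hij => ?_⟩
  · have := h5 _ (by omega) hu
    omega
  · have := h4 _ (by omega) hu
    omega
  · have := h6 (n - (i + 1)) (by omega)
    rw [show n - (i + 1) + 1 = n - i by omega] at this
    exact this.symm
  · have := h7 (n - j) (n - i) (by omega) (by omega) hu.symm
    omega
  · have := h8 _ (by omega) _ (by omega) hij
    omega

lemma SideColorable.swap {V : Type*} {G : SimpleGraph V} {T A B : Set V} {C X Y : Finset ℕ}
    (h : SideColorable G T A B C X Y) : SideColorable G T B A C Y X := by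
  obtain ⟨f, h1, h2, h3, h4⟩ := h
  exact ⟨f, h1, h2, h4, h3⟩

namespace IsTwoJoin

variable {V : Type*} [Fintype V] {G : SimpleGraph V} {V1 V2 A1 B1 A2 B2 S W : Set V}

lemma sideColorable_of_mem_left (h : IsTwoJoin G V1 V2 A1 B1 A2 B2) (hS : PerfectOn G S)
    (hWS : W ⊆ S) (hWV : W ⊆ V1) {p : V} (hp : p ∈ A2) (hpS : p ∈ S) {C X : Finset ℕ} (hX : X ⊆ C)
    (hW : CliqueBound G W C.card) (hA : CliqueBound G (W ∩ A1) X.card) :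
    SideColorable G W A1 B1 C X C := by
  have hpB : p ∉ B2 := Set.disjoint_left.1 h.symm.disjoint_left hp
  have hpV : p ∈ V2 := h.symm.subset_left hp
  have hXC := Finset.card_le_card hX
  obtain ⟨f, c, hfC, hfp, hcC, hcw, -, hfc⟩ := h.exists_coloring_of_weights (Q := {p}) (C := C)
    (x := X.card) (y := C.card) hS hWS (by simpa using hpS) hWV (by simpa using hpV)
    (fun _ => C.card - X.card) hW hA (hW.mono Set.inter_subset_left le_rfl)
    (by intro u hu _; omega) (by rintro u rfl hu; exact absurd hu hpB) (by intro u hu; omega)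
    (by rintro u rfl v rfl huv; simp at huv) (by rintro u rfl v rfl z rfl huv; simp at huv)
    (by rintro u rfl v rfl _ _; simp) (by rintro u rfl v rfl _ _; simp)
  have hcp := hcC p rfl
  have h1 : SideColorable G W A1 B1 C (C \ c p) C :=
    ⟨f, hfC, hfp, fun v hv hA => Finset.mem_sdiff.2 ⟨hfC v hv,
      hfc v hv p rfl ((h.adj_iff (hWV hv) hpV).2 (Or.inl ⟨hA, hp⟩))⟩, fun v hv _ => hfC v hv⟩
  have h2 : (C \ c p).card = X.card := by
    rw [Finset.card_sdiff_of_subset hcp, hcw p rfl]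
    omega
  refine h1.perm Finset.sdiff_subset subset_rfl hX subset_rfl h2 rfl ?_
  rw [Finset.inter_eq_left.2 Finset.sdiff_subset, Finset.inter_eq_left.2 hX, h2]

lemma sideColorable_of_mem_right (h : IsTwoJoin G V1 V2 A1 B1 A2 B2) (hS : PerfectOn G S)
    (hWS : W ⊆ S) (hWV : W ⊆ V1) {q : V} (hq : q ∈ B2) (hqS : q ∈ S) {C Y : Finset ℕ} (hY : Y ⊆ C)
    (hW : CliqueBound G W C.card) (hB : CliqueBound G (W ∩ B1) Y.card) :
    SideColorable G W A1 B1 C C Y :=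
  (h.swap.sideColorable_of_mem_left hS hWS hWV hq hqS hY hW hB).swap

lemma exists_sideColorable_of_not_adj (h : IsTwoJoin G V1 V2 A1 B1 A2 B2) (hS : PerfectOn G S)
    (hWS : W ⊆ S) (hWV : W ⊆ V1) {p q : V} (hp : p ∈ A2) (hpS : p ∈ S) (hq : q ∈ B2) (hqS : q ∈ S)
    (hpq : ¬ G.Adj p q) {C : Finset ℕ} {x y : ℕ} (hx : x ≤ C.card) (hy : y ≤ C.card)
    (hW : CliqueBound G W C.card) (hA : CliqueBound G (W ∩ A1) x)
    (hB : CliqueBound G (W ∩ B1) y) :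
    ∃ X ⊆ C, ∃ Y ⊆ C, X.card = x ∧ Y.card = y ∧ SideColorable G W A1 B1 C X Y := by
  classical
  have hpV : p ∈ V2 := h.symm.subset_left hp
  have hqV : q ∈ V2 := h.symm.swap.subset_left hq
  have hqA : q ∉ A2 := Set.disjoint_right.1 h.symm.disjoint_left hq
  have hAB2 : ∀ v ∈ A2, v ∉ B2 := fun _ hv => Set.disjoint_left.1 h.symm.disjoint_left hv
  obtain ⟨ω, hωA, hωB⟩ : ∃ ω : V → ℕ, (∀ v ∈ A2, ω v = C.card - x) ∧
      ∀ v ∉ A2, ω v = C.card - y :=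
    ⟨fun v => if v ∈ A2 then C.card - x else C.card - y, fun v hv => if_pos hv,
      fun v hv => if_neg hv⟩
  have hQ : ∀ u ∈ ({p, q} : Set V), ∀ v ∈ ({p, q} : Set V), ¬ G.Adj u v := by
    rintro u (rfl | rfl) v (rfl | rfl)
    exacts [G.irrefl, hpq, fun e => hpq e.symm, G.irrefl]
  obtain ⟨f, c, hfC, hfp, hcC, hcw, -, hfc⟩ := h.exists_coloring_of_weights (Q := {p, q}) (C := C)
    (x := x) (y := y) hS hWS (Set.pair_subset hpS hqS) hWV (Set.pair_subset hpV hqV)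
    ω hW hA hB
    (by intro u _ hu; rw [hωA u hu]; omega)
    (by intro u _ hu; rw [hωB u (fun e => hAB2 u e hu)]; omega)
    (by intro u _; by_cases hu : u ∈ A2 <;> simp [hωA, hωB, hu])
    (fun u hu v hv huv => absurd huv (hQ u hu v hv))
    (fun u hu v hv _ _ huv => absurd huv (hQ u hu v hv))
    (fun u hu v hv _ _ => hQ u hu v hv) (fun u hu v hv _ _ => hQ u hu v hv)
  have hpQ : p ∈ ({p, q} : Set V) := by simp
  have hqQ : q ∈ ({p, q} : Set V) := by simp
  refine ⟨C \ c p, Finset.sdiff_subset, C \ c q, Finset.sdiff_subset, ?_, ?_, f, hfC, hfp,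
    fun v hv hA => Finset.mem_sdiff.2 ⟨hfC v hv,
      hfc v hv p hpQ ((h.adj_iff (hWV hv) hpV).2 (Or.inl ⟨hA, hp⟩))⟩,
    fun v hv hB => Finset.mem_sdiff.2 ⟨hfC v hv,
      hfc v hv q hqQ ((h.adj_iff (hWV hv) hqV).2 (Or.inr ⟨hB, hq⟩))⟩⟩
  · rw [Finset.card_sdiff_of_subset (hcC p hpQ), hcw p hpQ]
    rw [hωA p hp]
    omega
  · rw [Finset.card_sdiff_of_subset (hcC q hqQ), hcw q hqQ]
    rw [hωB q hqA]
    omega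

lemma exists_sideColorable_of_path (h : IsTwoJoin G V1 V2 A1 B1 A2 B2) (hS : PerfectOn G S)
    (hWS : W ⊆ S) (hWV : W ⊆ V1) {n : ℕ} (hP : HasConnectingPath G V2 A2 B2 S n)
    {C : Finset ℕ} {x y : ℕ} (hx : x ≤ C.card) (hy : y ≤ C.card)
    (hW : CliqueBound G W C.card) (hA : CliqueBound G (W ∩ A1) x)
    (hB : CliqueBound G (W ∩ B1) y) (hxy : Even n → x ≤ y) (hxy' : ¬ Even n → C.card ≤ x + y) :
    ∃ X ⊆ C, ∃ Y ⊆ C, X.card = x ∧ Y.card = y ∧ (Even n → X ⊆ Y) ∧ (¬ Even n → X ∪ Y = C) ∧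
      SideColorable G W A1 B1 C X Y := by
  classical
  obtain ⟨u, hu, hu0, hun, huA, huB, hsucc, hchord, hinj⟩ := hP
  obtain ⟨d, hd⟩ : ∃ d : V → ℕ, ∀ i ≤ n, d (u i) = i := by
    have hi : Set.InjOn u {i | i ≤ n} := fun i hi j hj => hinj i hi j hj
    exact ⟨Function.invFunOn u {i | i ≤ n}, fun i hin => hi.leftInvOn_invFunOn hin⟩
  have hn : n ≠ 0 := by
    rintro rfl
    exact Set.disjoint_left.1 h.symm.disjoint_left hu0 hun
  have hadj : ∀ i ≤ n, ∀ j ≤ n, G.Adj (u i) (u j) → j = i + 1 ∨ i = j + 1 := by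
    intro i hi j hj hij
    rcases lt_trichotomy i j with hlt | rfl | hlt
    · exact Or.inl (hchord i j hlt hj hij)
    · exact absurd hij G.irrefl
    · exact Or.inr (hchord j i hlt hi hij.symm)
  set g : ℕ → ℕ := fun i => if i = n then C.card - y else if Even i then C.card - x else x with hg
  have hgn : g n = C.card - y := by simp [hg]
  have hgi : ∀ i < n, g i = if Even i then C.card - x else x := fun i hi => by
    simp [hg, hi.ne]
  have hg0 : g 0 = C.card - x := by simp [hgi 0 (by omega)]
  have hgle : ∀ i, g i ≤ C.card := by
    intro i
    simp only [hg]
    split_ifs <;> omega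
  have hgs : ∀ i, i + 1 < n → g i + g (i + 1) = C.card := by
    intro i hi
    rw [hgi i (by omega), hgi (i + 1) hi]
    by_cases he : Even i
    · simp only [he, if_true, Nat.even_add_one, not_true, if_false]
      omega
    · simp only [he, if_false, Nat.even_add_one, not_false_iff, if_true]
      omega
  have hgs' : ∀ i < n, g i + g (i + 1) ≤ C.card := by
    intro i hi
    rcases Nat.lt_or_ge (i + 1) n with h1 | h1
    · exact (hgs i h1).le
    · obtain rfl : n = i + 1 := by omega
      rw [hgn, hgi i hi]
      rw [Nat.even_add_one] at hxy hxy'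
      split_ifs with he
      · have := hxy' (not_not.2 he)
        omega
      · have := hxy he
        omega
  obtain ⟨f, c, hfC, hfp, hcC, hcw, hcd, hfc⟩ := h.exists_coloring_of_weights
    (Q := {v | ∃ i ≤ n, v = u i}) (C := C) (x := x) (y := y) hS hWS
    (by rintro _ ⟨i, hi, rfl⟩; exact (hu i hi).2) hWV
    (by rintro _ ⟨i, hi, rfl⟩; exact (hu i hi).1) (fun v => g (d v)) hW hA hB
    (by
      rintro _ ⟨i, hi, rfl⟩ hiA
      obtain rfl := huA i hi hiA
      simp only [hd 0 hi]
      omega)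
    (by
      rintro _ ⟨i, hi, rfl⟩ hiB
      obtain rfl := huB i hi hiB
      simp only [hd i hi]
      omega)
    (fun v _ => hgle _)
    (by
      rintro _ ⟨i, hi, rfl⟩ _ ⟨j, hj, rfl⟩ hij
      simp only [hd i hi, hd j hj]
      rcases hadj i hi j hj hij with rfl | rfl
      · exact hgs' i hj
      · rw [add_comm]
        exact hgs' j hi)
    (by
      rintro _ ⟨i, hi, rfl⟩ _ ⟨j, hj, rfl⟩ _ ⟨k, hk, rfl⟩ hij hik hjk
      have := hadj i hi j hj hij
      have := hadj i hi k hk hik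
      have := hadj j hj k hk hjk
      omega)
    (by
      rintro _ ⟨i, hi, rfl⟩ _ ⟨j, hj, rfl⟩ hiA hjA
      rw [huA i hi hiA, huA j hj hjA]
      exact G.irrefl)
    (by
      rintro _ ⟨i, hi, rfl⟩ _ ⟨j, hj, rfl⟩ hiB hjB
      rw [huB i hi hiB, huB j hj hjB]
      exact G.irrefl)
  have hcC' : ∀ i ≤ n, c (u i) ⊆ C := fun i hi => hcC _ ⟨i, hi, rfl⟩
  have hcw' : ∀ i ≤ n, (c (u i)).card = g i := fun i hi => by
    rw [hcw _ ⟨i, hi, rfl⟩, hd i hi]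
  have hcd' : ∀ i < n, Disjoint (c (u i)) (c (u (i + 1))) := fun i hi =>
    hcd _ ⟨i, hi.le, rfl⟩ _ ⟨i + 1, hi, rfl⟩ (hsucc i hi)
  have hchain : ∀ i < n, c (u i) = if Even i then c (u 0) else C \ c (u 0) := by
    intro i hi
    induction i with
    | zero => simp
    | succ i ih =>
      have h1 : c (u (i + 1)) = C \ c (u i) := by
        refine Finset.eq_of_subset_of_card_le
          (Finset.subset_sdiff.2 ⟨hcC' _ hi.le, (hcd' i (by omega)).symm⟩) ?_
        rw [Finset.card_sdiff_of_subset (hcC' i (by omega)), hcw' i (by omega), hcw' _ hi.le]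
        have := hgs i hi
        omega
      rw [h1, ih (by omega)]
      by_cases he : Even i
      · simp [he, Nat.even_add_one]
      · simp [he, Nat.even_add_one, Finset.inter_eq_right.2 (hcC' 0 (Nat.zero_le _))]
  have hlast := hcd' (n - 1) (by omega)
  rw [hchain (n - 1) (by omega), show n - 1 + 1 = n by omega] at hlast
  have hpar : Even (n - 1) ↔ ¬ Even n := by
    conv_rhs => rw [show n = n - 1 + 1 by omega, Nat.even_add_one, not_not]
  have hc0 := hcC' 0 (Nat.zero_le _)
  have hcn := hcC' n le_rfl
  refine ⟨C \ c (u 0), Finset.sdiff_subset, C \ c (u n), Finset.sdiff_subset, ?_, ?_, fun he => ?_,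
    fun he => ?_, f, hfC, hfp,
    fun v hv hA => Finset.mem_sdiff.2 ⟨hfC v hv, hfc v hv _ ⟨0, Nat.zero_le _, rfl⟩
      ((h.adj_iff (hWV hv) (hu 0 (Nat.zero_le _)).1).2 (Or.inl ⟨hA, hu0⟩))⟩,
    fun v hv hB => Finset.mem_sdiff.2 ⟨hfC v hv, hfc v hv _ ⟨n, le_rfl, rfl⟩
      ((h.adj_iff (hWV hv) (hu n le_rfl).1).2 (Or.inr ⟨hB, hun⟩))⟩⟩
  · rw [Finset.card_sdiff_of_subset hc0, hcw' 0 (Nat.zero_le _), hg0]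
    omega
  · rw [Finset.card_sdiff_of_subset hcn, hcw' n le_rfl, hgn]
    omega
  · rw [if_neg (by rw [hpar]; exact not_not.2 he)] at hlast
    refine Finset.sdiff_subset_sdiff subset_rfl fun i hi => ?_
    by_contra hi0
    exact Finset.disjoint_right.1 hlast hi (Finset.mem_sdiff.2 ⟨hcn hi, hi0⟩)
  · rw [if_pos (hpar.2 he)] at hlast
    rw [← Finset.sdiff_inter_distrib_right, Finset.disjoint_iff_inter_eq_empty.1 hlast,
      Finset.sdiff_empty]

end IsTwoJoin

namespace IsTwoJoin

/-- Colourings of the two sides of a 2-join that use complementary sets of colours on the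
attachment sets fit together. -/
lemma exists_coloring_of_sideColorable {V : Type*} {G : SimpleGraph V} {V1 V2 A1 B1 A2 B2 : Set V}
    (h : IsTwoJoin G V1 V2 A1 B1 A2 B2) {H : Set V}
    {C X Y : Finset ℕ} (h1 : SideColorable G (H ∩ V1) A1 B1 C X Y)
    (h2 : SideColorable G (H ∩ V2) A2 B2 C (C \ X) (C \ Y)) :
    ∃ f : V → ℕ, (∀ v ∈ H, f v ∈ C) ∧ ∀ u ∈ H, ∀ v ∈ H, G.Adj u v → f u ≠ f v := by
  classical
  obtain ⟨f, hfC, hfp, hfA, hfB⟩ := h1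
  obtain ⟨g, hgC, hgp, hgA, hgB⟩ := h2
  have hV : ∀ v, v ∉ V1 → v ∈ V2 := fun v hv => (h.mem_or_mem v).resolve_left hv
  have hcross : ∀ u ∈ H, ∀ v ∈ H, u ∈ V1 → v ∈ V2 → G.Adj u v → f u ≠ g v := by
    intro u hu v hv hu1 hv2 huv e
    rcases (h.adj_iff hu1 hv2).1 huv with ⟨ha, hb⟩ | ⟨ha, hb⟩
    · exact (Finset.mem_sdiff.1 (hgA v ⟨hv, hv2⟩ hb)).2 (e ▸ hfA u ⟨hu, hu1⟩ ha)
    · exact (Finset.mem_sdiff.1 (hgB v ⟨hv, hv2⟩ hb)).2 (e ▸ hfB u ⟨hu, hu1⟩ ha)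
  refine ⟨fun v => if v ∈ V1 then f v else g v, fun v hv => ?_, fun u hu v hv huv => ?_⟩
  · dsimp only
    split_ifs with hv1
    · exact hfC v ⟨hv, hv1⟩
    · exact hgC v ⟨hv, hV v hv1⟩
  · dsimp only
    split_ifs with hu1 hv1 hv1
    · exact hfp u ⟨hu, hu1⟩ v ⟨hv, hv1⟩ huv
    · exact hcross u hu v hv hu1 (hV v hv1) huv
    · exact (hcross v hv u hu hv1 (hV u hu1) huv.symm).symm
    · exact hgp u ⟨hu, hV u hu1⟩ v ⟨hv, hV v hv1⟩ huv

variable {V : Type*} [Fintype V] {G : SimpleGraph V} {V1 V2 A1 B1 A2 B2 S W : Set V}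

lemma sideColorable_of_even_path (h : IsTwoJoin G V1 V2 A1 B1 A2 B2) (hS : PerfectOn G S)
    (hWS : W ⊆ S) (hWV : W ⊆ V1) {n : ℕ} (hP : HasConnectingPath G V2 A2 B2 S n) (hn : Even n)
    {C X Y : Finset ℕ} (hX : X ⊆ C) (hY : Y ⊆ C) (hXY : X ⊆ Y ∨ Y ⊆ X)
    (hW : CliqueBound G W C.card) (hA : CliqueBound G (W ∩ A1) X.card)
    (hB : CliqueBound G (W ∩ B1) Y.card) : SideColorable G W A1 B1 C X Y := by
  have key : ∀ {A1 B1 A2 B2 : Set V} {X Y : Finset ℕ}, IsTwoJoin G V1 V2 A1 B1 A2 B2 →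
      HasConnectingPath G V2 A2 B2 S n → X ⊆ C → Y ⊆ C → X ⊆ Y →
      CliqueBound G (W ∩ A1) X.card → CliqueBound G (W ∩ B1) Y.card →
      SideColorable G W A1 B1 C X Y := by
    intro A1 B1 A2 B2 X Y h hP hX hY hXY hA hB
    obtain ⟨X', hX', Y', hY', hXc, hYc, hXY', -, hcol⟩ := h.exists_sideColorable_of_path hS hWS
      hWV hP (Finset.card_le_card hX) (Finset.card_le_card hY) hW hA hB
      (fun _ => Finset.card_le_card hXY) (fun he => absurd hn he)
    refine hcol.perm hX' hY' hX hY hXc hYc ?_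
    rw [Finset.inter_eq_left.2 (hXY' hn), Finset.inter_eq_left.2 hXY, hXc]
  rcases hXY with hXY | hXY
  · exact key h hP hX hY hXY hA hB
  · exact (key h.swap hP.swap hY hX hXY hB hA).swap

lemma sideColorable_of_odd_path (h : IsTwoJoin G V1 V2 A1 B1 A2 B2) (hS : PerfectOn G S)
    (hWS : W ⊆ S) (hWV : W ⊆ V1) {n : ℕ} (hP : HasConnectingPath G V2 A2 B2 S n) (hn : ¬ Even n)
    {C X Y : Finset ℕ} (hX : X ⊆ C) (hY : Y ⊆ C) (hXY : X ∪ Y = C ∨ Disjoint X Y)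
    (hW : CliqueBound G W C.card) (hA : CliqueBound G (W ∩ A1) X.card)
    (hB : CliqueBound G (W ∩ B1) Y.card) : SideColorable G W A1 B1 C X Y := by
  have key : ∀ {X : Finset ℕ}, X ⊆ C → X ∪ Y = C → CliqueBound G (W ∩ A1) X.card →
      SideColorable G W A1 B1 C X Y := by
    intro X hX hXY hA
    obtain ⟨X', hX', Y', hY', hXc, hYc, -, hXY', hcol⟩ := h.exists_sideColorable_of_path hS hWS
      hWV hP (Finset.card_le_card hX) (Finset.card_le_card hY) hW hA hB
      (fun he => absurd he hn) (fun _ => by rw [← hXY]; exact Finset.card_union_le _ _)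
    refine hcol.perm hX' hY' hX hY hXc hYc ?_
    rw [Finset.card_inter, Finset.card_inter, hXY' hn, hXY, hXc, hYc]
  rcases hXY with hXY | hXY
  · exact key hX hXY hA
  have hXC : X ⊆ C \ Y := Finset.subset_sdiff.2 ⟨hX, hXY⟩
  obtain ⟨f, hfC, hfp, hfA, hfB⟩ := key (X := C \ Y) Finset.sdiff_subset
    (Finset.sdiff_union_of_subset hY) (hA.mono subset_rfl (Finset.card_le_card hXC))
  obtain ⟨u, hu, hu0, -⟩ := hP
  set W' : Set V := {v | v ∈ W ∧ f v ∉ Y} with hW'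
  have hW'W : W' ⊆ W := fun v hv => hv.1
  obtain ⟨g, hgC, hgp, hgA, -⟩ := h.sideColorable_of_mem_left hS (hW'W.trans hWS)
    (hW'W.trans hWV) hu0 (hu 0 (Nat.zero_le _)).2 hXC (fun K hK hc => by
      refine Finset.card_le_card_of_injOn f (fun v hv => ?_) (fun v hv w hw e => ?_)
      · exact Finset.mem_sdiff.2 ⟨hfC v (hK hv).1, (hK hv).2⟩
      · by_contra hne
        exact hfp v (hK hv).1 w (hK hw).1 (hc hv hw hne) e)
    (hA.mono (Set.inter_subset_inter_left _ hW'W) le_rfl)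
  have hgY : ∀ v ∈ W', g v ∉ Y := fun v hv => (Finset.mem_sdiff.1 (hgC v hv)).2
  refine ⟨fun v => if f v ∈ Y then f v else g v, fun v hv => ?_, fun v hv w hw hvw => ?_,
    fun v hv hA => ?_, fun v hv hB => ?_⟩
  · dsimp only
    split_ifs with h1
    · exact hfC v hv
    · exact (Finset.mem_sdiff.1 (hgC v ⟨hv, h1⟩)).1
  · dsimp only
    split_ifs with h1 h2 h2
    · exact hfp v hv w hw hvw
    · exact fun e => hgY w ⟨hw, h2⟩ (e ▸ h1)
    · exact fun e => hgY v ⟨hv, h1⟩ (e ▸ h2)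
    · exact hgp v ⟨hv, h1⟩ w ⟨hw, h2⟩ hvw
  · have h1 := (Finset.mem_sdiff.1 (hfA v hv hA)).2
    simp only [h1, if_false]
    exact hgA v ⟨hv, h1⟩ hA
  · simp only [hfB v hv hB, if_true]

lemma even_iff_even_of_paths (h : IsTwoJoin G V1 V2 A1 B1 A2 B2) (hS : PerfectOn G S)
    {m n : ℕ} (hP1 : HasConnectingPath G V1 A1 B1 S m) (hP2 : HasConnectingPath G V2 A2 B2 S n) :
    Even m ↔ Even n := by
  obtain ⟨u, hu, hu0, hum, huA, huB, hsucc, hchord, -⟩ := hP1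
  set W : Set V := {v | ∃ i ≤ m, v = u i} with hW
  have hWS : W ⊆ S := by rintro _ ⟨i, hi, rfl⟩; exact (hu i hi).2
  have hWV : W ⊆ V1 := by rintro _ ⟨i, hi, rfl⟩; exact (hu i hi).1
  have hadj : ∀ i ≤ m, ∀ j ≤ m, G.Adj (u i) (u j) → j = i + 1 ∨ i = j + 1 := by
    intro i hi j hj hij
    rcases lt_trichotomy i j with hlt | rfl | hlt
    · exact Or.inl (hchord i j hlt hj hij)
    · exact absurd hij G.irrefl
    · exact Or.inr (hchord j i hlt hi hij.symm)
  have hcl : CliqueBound G W ({0, 1} : Finset ℕ).card := by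
    intro K hK hc
    by_contra! hlt
    obtain ⟨a, b, d, ha, hb, hd, hab, had, hbd⟩ := Finset.two_lt_card_iff.1 hlt
    obtain ⟨i, hi, rfl⟩ := hK ha
    obtain ⟨j, hj, rfl⟩ := hK hb
    obtain ⟨k, hk, rfl⟩ := hK hd
    have := hadj i hi j hj (hc ha hb hab)
    have := hadj i hi k hk (hc ha hd had)
    have := hadj j hj k hk (hc hb hd hbd)
    omega
  have hA : CliqueBound G (W ∩ A1) ({0} : Finset ℕ).card := by
    intro K hK _
    refine Finset.card_le_one.2 fun a ha b hb => ?_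
    obtain ⟨⟨i, hi, rfl⟩, hiA⟩ := hK ha
    obtain ⟨⟨j, hj, rfl⟩, hjA⟩ := hK hb
    rw [huA i hi hiA, huA j hj hjA]
  have hB : ∀ z : ℕ, CliqueBound G (W ∩ B1) ({z} : Finset ℕ).card := by
    intro z K hK _
    refine Finset.card_le_one.2 fun a ha b hb => ?_
    obtain ⟨⟨i, hi, rfl⟩, hiB⟩ := hK ha
    obtain ⟨⟨j, hj, rfl⟩, hjB⟩ := hK hb
    rw [huB i hi hiB, huB j hj hjB]
  have key : ∀ z : ℕ, SideColorable G W A1 B1 {0, 1} {0} {z} →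
      (if Even m then 0 else 1) = z := by
    rintro z ⟨f, hfC, hfp, hfA, hfB⟩
    have hf : ∀ i ≤ m, f (u i) = if Even i then 0 else 1 := by
      intro i hi
      induction i with
      | zero => simpa using hfA (u 0) ⟨0, hi, rfl⟩ hu0
      | succ i ih =>
        have h1 := hfC (u (i + 1)) ⟨i + 1, hi, rfl⟩
        have h2 := hfp (u i) ⟨i, by omega, rfl⟩ (u (i + 1)) ⟨i + 1, hi, rfl⟩ (hsucc i hi)
        rw [ih (by omega)] at h2
        simp only [Finset.mem_insert, Finset.mem_singleton] at h1
        by_cases he : Even i <;> simp only [he, Nat.even_add_one, not_true, not_false_iff, if_true,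
          if_false] at h2 ⊢ <;> omega
    rw [← hf m le_rfl]
    simpa using hfB (u m) ⟨m, le_rfl, rfl⟩ hum
  by_cases hn : Even n
  · have := key 0 (h.sideColorable_of_even_path hS hWS hWV hP2 hn (by simp) (by simp)
      (Or.inl subset_rfl) hcl hA (hB 0))
    simpa [hn] using this
  · have := key 1 (h.sideColorable_of_odd_path hS hWS hWV hP2 hn (by simp) (by simp)
      (Or.inl rfl) hcl hA (hB 1))
    by_contra hm
    have : Even m := by tauto
    simp_all

lemma sideColorable_of_separatedSides (h : IsTwoJoin G V1 V2 A1 B1 A2 B2) (hS : PerfectOn G S)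
    (hsep : SeparatedSides G V1 A1 B1) (hWS : W ⊆ S) (hWV : W ⊆ V1) {p q : V} (hp : p ∈ A2)
    (hpS : p ∈ S) (hq : q ∈ B2) (hqS : q ∈ S) {C X Y : Finset ℕ} (hX : X ⊆ C) (hY : Y ⊆ C)
    (hW : CliqueBound G W C.card) (hA : CliqueBound G (W ∩ A1) X.card)
    (hB : CliqueBound G (W ∩ B1) Y.card) : SideColorable G W A1 B1 C X Y := by
  classical
  obtain ⟨f, hfC, hfp, hfA, -⟩ := h.sideColorable_of_mem_left hS hWS hWV hp hpS hX hW hA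
  obtain ⟨g, hgC, hgp, -, hgB⟩ := h.sideColorable_of_mem_right hS hWS hWV hq hqS hY hW hB
  let R : V → Prop := fun v => ∃ a z : V1, (a : V) ∈ A1 ∧ (z : V) = v ∧ (G.induce V1).Reachable a z
  have hR : ∀ u ∈ W, ∀ v ∈ W, G.Adj u v → R u → R v := by
    rintro u hu v hv huv ⟨a, z, ha, rfl, hz⟩
    refine ⟨a, ⟨v, hWV hv⟩, ha, rfl, hz.trans (Adj.reachable ?_)⟩
    exact huv
  refine ⟨fun v => if R v then f v else g v, fun v hv => ?_, fun u hu v hv huv => ?_,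
    fun v hv hA => ?_, fun v hv hB => ?_⟩
  · dsimp only
    split_ifs
    exacts [hfC v hv, hgC v hv]
  · dsimp only
    split_ifs with h1 h2 h2
    · exact hfp u hu v hv huv
    · exact absurd (hR u hu v hv huv h1) h2
    · exact absurd (hR v hv u hu huv.symm h2) h1
    · exact hgp u hu v hv huv
  · have : R v := ⟨⟨v, hWV hv⟩, ⟨v, hWV hv⟩, hA, rfl, Reachable.refl _⟩
    simp only [this, if_true]
    exact hfA v hv hA
  · have : ¬ R v := by
      rintro ⟨a, z, ha, rfl, hz⟩
      exact hsep a z ha hB hz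
    simp only [this, if_false]
    exact hgB v hv hB

end IsTwoJoin

lemma exists_maximum_clique {V : Type*} [Finite V] (G : SimpleGraph V) (T : Set V) :
    ∃ K : Finset V, (K : Set V) ⊆ T ∧ G.IsClique (K : Set V) ∧ CliqueBound G T K.card := by
  obtain ⟨K, ⟨h1, h2⟩, hK⟩ := Set.exists_max_image
    {K : Finset V | (K : Set V) ⊆ T ∧ G.IsClique (K : Set V)} Finset.card (Set.toFinite _)
    ⟨∅, by simp⟩
  exact ⟨K, h1, h2, fun L hL hc => hK L ⟨hL, hc⟩⟩

/-- A clique in one of two completely joined sets limits the cliques in the other. -/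
lemma CliqueBound.of_join {V : Type*} {G : SimpleGraph V} {T A B : Set V} {n : ℕ}
    (hT : CliqueBound G T n) (hAB : ∀ a ∈ A, ∀ b ∈ B, G.Adj a b) {K : Finset V}
    (hKT : (K : Set V) ⊆ T ∩ A) (hK : G.IsClique (K : Set V)) :
    CliqueBound G (T ∩ B) (n - K.card) := by
  classical
  intro L hLT hL
  have hd : Disjoint K L := Finset.disjoint_left.2 fun v hv hv' =>
    G.irrefl (hAB v (hKT hv).2 v (hLT hv').2)
  have := hT (K ∪ L) (by
      rw [Finset.coe_union]
      exact Set.union_subset (fun v hv => (hKT hv).1) (fun v hv => (hLT hv).1)) (by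
      rw [Finset.coe_union]
      rintro v (hv | hv) w (hw | hw) hvw
      · exact hK hv hw hvw
      · exact hAB v (hKT hv).2 w (hLT hw).2
      · exact (hAB w (hKT hw).2 v (hLT hv).2).symm
      · exact hL hv hw hvw)
  rw [Finset.card_union_of_disjoint hd] at this
  omega

lemma HasConnectingPath.of_subset {V : Type*} {G : SimpleGraph V} {V2 A2 B2 S S' : Set V} {n : ℕ}
    (h : HasConnectingPath G V2 A2 B2 S n) (hS : V2 ⊆ S') : HasConnectingPath G V2 A2 B2 S' n := by
  obtain ⟨u, h1, h2⟩ := h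
  exact ⟨u, fun i hi => ⟨(h1 i hi).1, hS (h1 i hi).1⟩, h2⟩

namespace IsBlockSet

variable {V : Type*} {G : SimpleGraph V} {V1 V2 A2 B2 S : Set V}

lemma subset (h : IsBlockSet G V1 V2 A2 B2 S) : V1 ⊆ S := by
  rcases h with ⟨-, p, -, q, -, rfl⟩ | ⟨-, p, q, P, -, -, -, -, rfl⟩ <;>
    exact Set.subset_union_left

lemma exists_mem_left (h : IsBlockSet G V1 V2 A2 B2 S) : ∃ p ∈ A2, p ∈ S := by
  rcases h with ⟨-, p, hp, q, -, rfl⟩ | ⟨-, p, q, P, hp, -, -, -, rfl⟩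
  · exact ⟨p, hp, by simp⟩
  · exact ⟨p, hp, Or.inr ⟨p, P.start_mem_support, rfl⟩⟩

lemma exists_mem_right (h : IsBlockSet G V1 V2 A2 B2 S) : ∃ q ∈ B2, q ∈ S := by
  rcases h with ⟨-, p, -, q, hq, rfl⟩ | ⟨-, p, q, P, -, hq, -, -, rfl⟩
  · exact ⟨q, hq, by simp⟩
  · exact ⟨q, hq, Or.inr ⟨q, P.end_mem_support, rfl⟩⟩

lemma exists_hasConnectingPath (h : IsBlockSet G V1 V2 A2 B2 S)
    (hsep : ¬ SeparatedSides G V2 A2 B2) : ∃ n, HasConnectingPath G V2 A2 B2 S n := by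
  classical
  rcases h with ⟨hs, -⟩ | ⟨-, p, q, P, hp, hq, hP, hmin, rfl⟩
  · exact absurd hs hsep
  have hmin' : ∀ (p' q' : V2) (P' : (G.induce V2).Walk p' q'), (p' : V) ∈ A2 → (q' : V) ∈ B2 →
      P.length ≤ P'.length := fun p' q' P' hp' hq' =>
    (hmin p' q' P'.bypass hp' hq' P'.bypass_isPath).trans P'.length_bypass_le_length
  refine ⟨P.length, fun i => P.getVert i, fun i hi => ⟨(P.getVert i).2, Or.inr
    ⟨_, P.getVert_mem_support i, rfl⟩⟩, by simpa using hp, by simpa using hq, fun i hi hA => ?_,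
    fun i hi hB => ?_, fun i hi => ?_, fun i j hij hj hadj => ?_, fun i hi j hj hij => ?_⟩
  · have := hmin' _ _ (P.drop i) hA hq
    rw [Walk.drop_length] at this
    omega
  · have := hmin' _ _ (P.take i) hp hB
    rw [Walk.take_length] at this
    omega
  · exact P.adj_getVert_succ hi
  · have h1 : (G.induce V2).Adj (P.getVert i) (P.getVert j) := hadj
    have := hmin' _ _ ((P.take i).append (Walk.cons h1 (P.drop j))) hp hq
    rw [Walk.length_append, Walk.length_cons, Walk.take_length, Walk.drop_length] at this
    omega
  · exact hP.getVert_injOn hi hj (Subtype.ext hij)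

end IsBlockSet

lemma exists_nested_finsets (C : Finset ℕ) {x y : ℕ} (hx : x ≤ C.card) (hy : y ≤ C.card) :
    ∃ X ⊆ C, ∃ Y ⊆ C, X.card = x ∧ Y.card = y ∧ (X ⊆ Y ∨ Y ⊆ X) := by
  rcases le_total x y with h | h
  · obtain ⟨Y, hY, rfl⟩ := Finset.exists_subset_card_eq hy
    obtain ⟨X, hX, rfl⟩ := Finset.exists_subset_card_eq h
    exact ⟨X, hX.trans hY, Y, hY, rfl, rfl, Or.inl hX⟩
  · obtain ⟨X, hX, rfl⟩ := Finset.exists_subset_card_eq hx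
    obtain ⟨Y, hY, rfl⟩ := Finset.exists_subset_card_eq h
    exact ⟨X, hX, Y, hY.trans hX, rfl, rfl, Or.inr hY⟩

lemma exists_disjoint_or_covering_finsets (C : Finset ℕ) {x y : ℕ} (hx : x ≤ C.card)
    (hy : y ≤ C.card) :
    ∃ X ⊆ C, ∃ Y ⊆ C, X.card = x ∧ Y.card = y ∧ (X ∪ Y = C ∨ Disjoint X Y) := by
  obtain ⟨X, hX, rfl⟩ := Finset.exists_subset_card_eq hx
  have hc := Finset.card_sdiff_of_subset hX
  rcases le_total y (C \ X).card with h | h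
  · obtain ⟨Y, hY, rfl⟩ := Finset.exists_subset_card_eq h
    exact ⟨X, hX, Y, hY.trans Finset.sdiff_subset, rfl, rfl,
      Or.inr (Finset.subset_sdiff.1 hY).2.symm⟩
  · obtain ⟨Y, hY, hYC, rfl⟩ := Finset.exists_subsuperset_card_eq Finset.sdiff_subset h hy
    refine ⟨X, hX, Y, hYC, rfl, rfl, Or.inl (subset_antisymm (Finset.union_subset hX hYC) ?_)⟩
    rw [← Finset.union_sdiff_of_subset hX]
    exact Finset.union_subset_union_right hY

namespace IsTwoJoin

variable {V : Type*} [Fintype V] {G : SimpleGraph V} {V1 V2 A1 B1 A2 B2 S1 S2 : Set V}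

lemma exists_bounds (h : IsTwoJoin G V1 V2 A1 B1 A2 B2) {H : Set V} {n : ℕ}
    (hH : CliqueBound G H n) : ∃ x ≤ n, ∃ y ≤ n,
      CliqueBound G (H ∩ V1 ∩ A1) x ∧ CliqueBound G (H ∩ V1 ∩ B1) y ∧
      CliqueBound G (H ∩ V2 ∩ A2) (n - x) ∧ CliqueBound G (H ∩ V2 ∩ B2) (n - y) := by
  obtain ⟨K, hKT, hK, hKb⟩ := exists_maximum_clique G (H ∩ A1)
  obtain ⟨L, hLT, hL, hLb⟩ := exists_maximum_clique G (H ∩ B1)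
  have hsub : ∀ D E : Set V, H ∩ D ∩ E ⊆ H ∩ E :=
    fun D E => Set.inter_subset_inter_left _ Set.inter_subset_left
  refine ⟨K.card, hH K (hKT.trans Set.inter_subset_left) hK,
    L.card, hH L (hLT.trans Set.inter_subset_left) hL, hKb.mono (hsub _ _) le_rfl,
    hLb.mono (hsub _ _) le_rfl, ?_, ?_⟩
  · exact (hH.of_join h.2.2.2.2.2.2.2.2.2.2.2.2.2.2.1 hKT hK).mono (hsub _ _) le_rfl
  · exact (hH.of_join h.2.2.2.2.2.2.2.2.2.2.2.2.2.2.2.1 hLT hL).mono (hsub _ _) le_rfl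

lemma perfectOn_univ_of_separatedSides (h : IsTwoJoin G V1 V2 A1 B1 A2 B2)
    (hS1 : IsBlockSet G V1 V2 A2 B2 S1) (hS2 : IsBlockSet G V2 V1 A1 B1 S2)
    (hP1 : PerfectOn G S1) (hP2 : PerfectOn G S2) (hsep : SeparatedSides G V2 A2 B2) :
    PerfectOn G Set.univ := by
  intro H _ C hH
  obtain ⟨x, hx, y, hy, hA1, hB1, hA2, hB2⟩ := h.exists_bounds hH
  obtain ⟨p, hp, hpS⟩ := hS1.exists_mem_left
  obtain ⟨q, hq, hqS⟩ := hS1.exists_mem_right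
  obtain ⟨p', hp', hpS'⟩ := hS2.exists_mem_left
  obtain ⟨q', hq', hqS'⟩ := hS2.exists_mem_right
  have hpq : ¬ G.Adj p q := fun hpq => hsep ⟨p, h.symm.subset_left hp⟩
    ⟨q, h.symm.swap.subset_left hq⟩ hp hq (Adj.reachable hpq)
  obtain ⟨X, hX, Y, hY, rfl, rfl, hcol⟩ := h.exists_sideColorable_of_not_adj (W := H ∩ V1) hP1
    (Set.inter_subset_right.trans hS1.subset) Set.inter_subset_right hp hpS hq hqS hpq hx hy
    (hH.mono Set.inter_subset_left le_rfl) hA1 hB1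
  refine h.exists_coloring_of_sideColorable hcol (h.symm.sideColorable_of_separatedSides hP2 hsep
    (Set.inter_subset_right.trans hS2.subset) Set.inter_subset_right hp' hpS' hq' hqS'
    Finset.sdiff_subset Finset.sdiff_subset (hH.mono Set.inter_subset_left le_rfl) ?_ ?_)
  · rwa [Finset.card_sdiff_of_subset hX]
  · rwa [Finset.card_sdiff_of_subset hY]

lemma perfectOn_univ_of_paths (h : IsTwoJoin G V1 V2 A1 B1 A2 B2)
    (hV1 : V1 ⊆ S1) (hV2 : V2 ⊆ S2) (hP1 : PerfectOn G S1) (hP2 : PerfectOn G S2) {m n : ℕ}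
    (hm : HasConnectingPath G V1 A1 B1 S2 m) (hn : HasConnectingPath G V2 A2 B2 S1 n) :
    PerfectOn G Set.univ := by
  intro H _ C hH
  obtain ⟨x, hx, y, hy, hA1, hB1, hA2, hB2⟩ := h.exists_bounds hH
  have hpar := h.even_iff_even_of_paths hP1 (hm.of_subset hV1) hn
  have hH1 : CliqueBound G (H ∩ V1) C.card := hH.mono Set.inter_subset_left le_rfl
  have hH2 : CliqueBound G (H ∩ V2) C.card := hH.mono Set.inter_subset_left le_rfl
  have hW1 : H ∩ V1 ⊆ S1 := Set.inter_subset_right.trans hV1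
  have hW2 : H ∩ V2 ⊆ S2 := Set.inter_subset_right.trans hV2
  by_cases he : Even n
  · obtain ⟨X, hX, Y, hY, rfl, rfl, hXY⟩ := exists_nested_finsets C hx hy
    rw [← Finset.card_sdiff_of_subset hX] at hA2
    rw [← Finset.card_sdiff_of_subset hY] at hB2
    exact h.exists_coloring_of_sideColorable
      (h.sideColorable_of_even_path hP1 hW1 Set.inter_subset_right hn he hX hY hXY hH1 hA1 hB1)
      (h.symm.sideColorable_of_even_path hP2 hW2 Set.inter_subset_right hm (hpar.2 he)
        Finset.sdiff_subset Finset.sdiff_subset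
        (hXY.symm.imp (Finset.sdiff_subset_sdiff subset_rfl) (Finset.sdiff_subset_sdiff subset_rfl))
        hH2 hA2 hB2)
  · obtain ⟨X, hX, Y, hY, rfl, rfl, hXY⟩ := exists_disjoint_or_covering_finsets C hx hy
    rw [← Finset.card_sdiff_of_subset hX] at hA2
    rw [← Finset.card_sdiff_of_subset hY] at hB2
    refine h.exists_coloring_of_sideColorable
      (h.sideColorable_of_odd_path hP1 hW1 Set.inter_subset_right hn he hX hY hXY hH1 hA1 hB1)
      (h.symm.sideColorable_of_odd_path hP2 hW2 Set.inter_subset_right hm (mt hpar.1 he)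
        Finset.sdiff_subset Finset.sdiff_subset ?_ hH2 hA2 hB2)
    rcases hXY with hXY | hXY
    · right
      rw [Finset.disjoint_left]
      intro i hi hi'
      rw [Finset.mem_sdiff] at hi hi'
      rw [← hXY, Finset.mem_union] at hi
      tauto
    · left
      rw [← Finset.sdiff_inter_distrib_right, Finset.disjoint_iff_inter_eq_empty.1 hXY,
        Finset.sdiff_empty]

end IsTwoJoin

/-- **2-join decomposition preserves perfection.** If `G` has a 2-join with blocks
`G₁ = G(S1)` and `G₂ = G(S2)`, then `G` is perfect iff both blocks are perfect. -/
theorem twoJoin_perfect_iff_blocks_perfect {V : Type*} [Fintype V]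
    (G : SimpleGraph V) (V1 V2 A1 B1 A2 B2 S1 S2 : Set V)
    (h2j : IsTwoJoin G V1 V2 A1 B1 A2 B2)
    (hS1 : IsBlockSet G V1 V2 A2 B2 S1)
    (hS2 : IsBlockSet G V2 V1 A1 B1 S2) :
    IsPerfect G ↔ (IsPerfect (G.induce S1) ∧ IsPerfect (G.induce S2)) := by
  rw [isPerfect_iff_perfectOn, isPerfect_induce_iff_perfectOn, isPerfect_induce_iff_perfectOn]
  refine ⟨fun h => ⟨h.mono (Set.subset_univ _), h.mono (Set.subset_univ _)⟩, fun ⟨h1, h2⟩ => ?_⟩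
  by_cases hsep2 : SeparatedSides G V2 A2 B2
  · exact h2j.perfectOn_univ_of_separatedSides hS1 hS2 h1 h2 hsep2
  by_cases hsep1 : SeparatedSides G V1 A1 B1
  · exact h2j.symm.perfectOn_univ_of_separatedSides hS2 hS1 h2 h1 hsep1
  obtain ⟨n, hn⟩ := hS1.exists_hasConnectingPath hsep2
  obtain ⟨m, hm⟩ := hS2.exists_hasConnectingPath hsep1
  exact h2j.perfectOn_univ_of_paths hS1.subset hS2.subset h1 h2 hm hn
end

section
/- If a minimally imperfect graph G has a 2-join, then G is an odd hole. -/
open SimpleGraph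

/-- A graph is an odd hole if it is a chordless cycle of odd length at least 4
(hence at least 5). -/
def IsOddHole {V : Type*} (G : SimpleGraph V) : Prop :=
  ∃ n : ℕ, 4 ≤ n ∧ Odd n ∧ Nonempty (G ≃g SimpleGraph.cycleGraph n)

namespace SimpleGraph

variable {V : Type*} {G : SimpleGraph V}

/-- A perfect graph all of whose cliques have at most `k` vertices is `k`-colorable. -/
lemma colorable_of_isPerfect (hG : IsPerfect G) {k : ℕ}
    (hk : ∀ Q : Finset V, G.IsClique (Q : Set V) → Q.card ≤ k) : G.Colorable k := by
  have h := hG Set.univ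
  obtain ⟨s, hs⟩ := (G.induce Set.univ).exists_isNClique_cliqueNum
  have hmap := hs.map (f := ⟨fun v : (Set.univ : Set V) => (v : V), Subtype.val_injective⟩)
  have hcard : (G.induce Set.univ).cliqueNum ≤ k := by
    rw [← hmap.card_eq]
    refine hk _ (hmap.isClique.mono ?_)
    intro u v huv
    rw [map_adj] at huv
    obtain ⟨a, b, hab, rfl, rfl⟩ := huv
    exact hab
  have hcol : (G.induce Set.univ).Colorable k := by
    rw [← chromaticNumber_le_iff_colorable, ← h]
    exact_mod_cast hcard
  exact hcol.of_hom (induceUnivIso G).symm.toHom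

/-- A finite perfect graph can be colored with as many colors as its clique number. -/
lemma colorable_cliqueNum_of_isPerfect [Finite V] (hG : IsPerfect G) :
    G.Colorable G.cliqueNum :=
  colorable_of_isPerfect hG fun _ hQ => IsClique.card_le_cliqueNum (tc := hQ)

/-- A minimally imperfect graph cannot be colored with as many colors as its clique number. -/
lemma not_colorable_cliqueNum_of_minimallyImperfect [Finite V] (hG : MinimallyImperfect G) :
    ¬ G.Colorable G.cliqueNum := by
  intro hcol
  refine hG.1 fun S => le_antisymm cliqueNum_le_chromaticNumber ?_
  by_cases hS : S = Set.univ
  · subst hS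
    have hn : G.cliqueNum ≤ (G.induce Set.univ).cliqueNum := by
      obtain ⟨s, hs⟩ := G.exists_isNClique_cliqueNum
      have hmap := hs.map (f := (induceUnivIso G).symm.toEquiv.toEmbedding)
      rw [← hmap.card_eq]
      have hc : (G.induce Set.univ).IsClique
          ((s.map (induceUnivIso G).symm.toEquiv.toEmbedding : Finset _) : Set _) := by
        refine hmap.isClique.mono ?_
        intro u v huv
        rw [map_adj] at huv
        obtain ⟨a, b, hab, rfl, rfl⟩ := huv
        exact (induceUnivIso G).symm.map_rel_iff.2 hab
      exact IsClique.card_le_cliqueNum (tc := hc)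
    have h := (hcol.mono hn).of_hom (induceUnivIso G).toHom
    exact chromaticNumber_le_iff_colorable.2 h
  · exact chromaticNumber_le_iff_colorable.2
      (colorable_cliqueNum_of_isPerfect (hG.2 S hS))

/-- The replication argument of Lovász, by induction on a bound `N` for the total weight; the colors are
the natural numbers below `k`. -/
lemma exists_weighted_coloring_range [Fintype V] (hG : ∀ S : Set V, S ≠ Set.univ →
    IsPerfect (G.induce S)) (z : V) (N : ℕ) :
    ∀ (w : V → ℕ) (k : ℕ), ∑ v, w v ≤ N → w z = 0 →
    (∀ Q : Finset V, G.IsClique (Q : Set V) → ∑ v ∈ Q, w v ≤ k) →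
    ∃ f : V → Finset ℕ, (∀ v, f v ⊆ Finset.range k) ∧ (∀ v, (f v).card = w v) ∧
      ∀ u v, G.Adj u v → Disjoint (f u) (f v) := by
  classical
  induction N with
  | zero =>
    intro w k hN _ _
    refine ⟨fun _ => ∅, by simp, fun v => ?_, by simp⟩
    have := Finset.single_le_sum (f := w) (fun _ _ => Nat.zero_le _) (Finset.mem_univ v)
    simp only [Finset.card_empty]
    omega
  | succ N ih =>
    intro w k hN hz hQ
    by_cases hw : ∀ v, w v ≤ 1
    · have hS : {v | w v = 1} ≠ Set.univ := by
        intro h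
        have : z ∈ {v | w v = 1} := h ▸ Set.mem_univ z
        simp [hz] at this
      obtain ⟨c⟩ := colorable_of_isPerfect (hG _ hS) (k := k) (by
        intro Q hc
        have h := hQ (Q.map ⟨Subtype.val, Subtype.val_injective⟩) (by
          intro u hu v hv huv
          simp only [Finset.coe_map, Set.mem_image, Finset.mem_coe,
            Function.Embedding.coeFn_mk] at hu hv
          obtain ⟨a, ha, rfl⟩ := hu
          obtain ⟨b, hb, rfl⟩ := hv
          exact hc ha hb (fun h => huv (by rw [h])))
        rw [Finset.sum_map, Finset.sum_congr rfl (fun x _ => x.2)] at h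
        simpa using h)
      refine ⟨fun v => if h : w v = 1 then {(c ⟨v, h⟩ : ℕ)} else ∅, ?_, ?_, ?_⟩
      · intro v
        dsimp only
        split_ifs with h
        · simp
        · simp
      · intro v
        dsimp only
        split_ifs with h
        · simp [h]
        · have := hw v
          simp
          omega
      · intro u v huv
        dsimp only
        split_ifs with hu hv
        · rw [Finset.disjoint_singleton]
          intro h
          exact c.valid (v := ⟨u, hu⟩) (w := ⟨v, hv⟩) huv (Fin.ext h)
        all_goals simp
    · push Not at hw
      obtain ⟨x, hx⟩ := hw
      have hlt : ∀ w' : V → ℕ, (∀ v, w' v ≤ w v) → w' x < w x → ∑ v, w' v ≤ N := by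
        intro w' hle hlt
        have := Finset.sum_lt_sum (fun v _ => hle v) ⟨x, Finset.mem_univ x, hlt⟩
        omega
      have hupd : ∀ v, Function.update w x (w x - 1) v ≤ w v := by
        intro v
        by_cases h : v = x
        · subst h; simp
        · simp [h]
      obtain ⟨f, hfk, hfw, hfd⟩ := ih (Function.update w x (w x - 1)) k
        (hlt _ hupd (by simp; omega)) (by have := hupd z; omega)
        (fun Q hc => (Finset.sum_le_sum fun v _ => hupd v).trans (hQ Q hc))
      obtain ⟨c, hc⟩ : (f x).Nonempty := by
        rw [← Finset.card_pos, hfw]; simp; omega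
      have hck : c < k := by simpa using hfk x hc
      have hpos : ∀ v, c ∈ f v → 1 ≤ w v := by
        intro v hv
        have := Finset.card_pos.2 ⟨c, hv⟩
        rw [hfw] at this
        have := hupd v
        omega
      have hle : ∀ v, (if c ∈ f v then w v - 1 else w v) ≤ w v := by
        intro v; split_ifs <;> omega
      obtain ⟨g, hgk, hgw, hgd⟩ := ih (fun v => if c ∈ f v then w v - 1 else w v) (k - 1)
        (hlt _ hle (by simp [hc]; omega)) (by have := hle z; omega) (by
          intro Q hQc
          by_cases h : ∃ q ∈ Q, c ∈ f q
          · obtain ⟨q, hq, hcq⟩ := h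
            have := Finset.sum_lt_sum (fun v (_ : v ∈ Q) => hle v)
              ⟨q, hq, by have := hpos q hcq; simp [hcq]; omega⟩
            have := hQ Q hQc
            omega
          · push Not at h
            have hsum : ∑ v ∈ Q, (if c ∈ f v then w v - 1 else w v) = (Q.biUnion f).card := by
              rw [Finset.card_biUnion]
              · refine Finset.sum_congr rfl fun v hv => ?_
                have hvx : v ≠ x := fun hvx => h v hv (hvx ▸ hc)
                rw [if_neg (h v hv), hfw, Function.update_of_ne hvx]
              · intro u hu v hv huv
                exact hfd u v (hQc hu hv huv)
            rw [hsum]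
            have hsub : Q.biUnion f ⊆ (Finset.range k).erase c := by
              intro i hi
              rw [Finset.mem_biUnion] at hi
              obtain ⟨v, hv, hiv⟩ := hi
              refine Finset.mem_erase.2 ⟨fun hic => h v hv (hic ▸ hiv), hfk v hiv⟩
            have := Finset.card_le_card hsub
            rwa [Finset.card_erase_of_mem (by simpa using hck), Finset.card_range] at this)
      have hnot : ∀ v, k - 1 ∉ g v := fun v hv => by
        have := hgk v hv
        simp at this
      refine ⟨fun v => if c ∈ f v then insert (k - 1) (g v) else g v, ?_, ?_, ?_⟩
      · intro v i hi
        have hgi : i ∈ g v → i < k := fun h => by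
          have := hgk v h
          simp at this
          omega
        dsimp only at hi
        rw [Finset.mem_range]
        split_ifs at hi with h
        · rcases Finset.mem_insert.1 hi with rfl | hi
          · omega
          · exact hgi hi
        · exact hgi hi
      · intro v
        have h1 := hgw v
        dsimp only at h1 ⊢
        split_ifs at h1 ⊢ with h
        · rw [Finset.card_insert_of_notMem (hnot v), h1]
          have := hpos v h
          omega
        · exact h1
      · intro u v huv
        have h1 := hgd u v huv
        have h2 : c ∈ f u → c ∉ f v := fun h => Finset.disjoint_left.1 (hfd u v huv) h
        dsimp only
        split_ifs with hu hv hv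
        · exact absurd hv (h2 hu)
        · exact Finset.disjoint_insert_left.2 ⟨hnot v, h1⟩
        · exact Finset.disjoint_insert_right.2 ⟨hnot u, h1⟩
        · exact h1

/-- Weighted colorings in graphs all of whose proper induced subgraphs are perfect: if the
weights vanish somewhere and every clique has total weight at most `k`, then each vertex `v` can
be given `w v` of `k` colors so that adjacent vertices receive disjoint sets of colors. -/
lemma exists_weighted_coloring [Fintype V] (hG : ∀ S : Set V, S ≠ Set.univ →
    IsPerfect (G.induce S)) {w : V → ℕ} {k : ℕ} {z : V} (hz : w z = 0)
    (hQ : ∀ Q : Finset V, G.IsClique (Q : Set V) → ∑ v ∈ Q, w v ≤ k) :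
    ∃ f : V → Finset (Fin k), (∀ v, (f v).card = w v) ∧
      ∀ u v, G.Adj u v → Disjoint (f u) (f v) := by
  obtain ⟨f, hfk, hfw, hfd⟩ := exists_weighted_coloring_range hG z _ w k le_rfl hz hQ
  refine ⟨fun v => (f v).attachFin fun i hi => Finset.mem_range.1 (hfk v hi), ?_, ?_⟩
  · simpa using hfw
  · intro u v huv
    rw [Finset.disjoint_left]
    intro i hi hj
    exact Finset.disjoint_left.1 (hfd u v huv) (by simpa using hi) (by simpa using hj)

/-- If `x` and `y` are two vertices outside `W` whose neighbors in `W` form the disjoint sets `A`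
and `B`, and some third vertex lies outside `W`, then `W` has a coloring in which `A` and `B` avoid
sets of `α` and `β` colors, provided that the clique sizes allow for it. -/
lemma exists_coloring_of_attached [Fintype V] (hG : ∀ S : Set V, S ≠ Set.univ →
    IsPerfect (G.induce S)) {W A B : Set V} {x y z : V} {k α β : ℕ}
    (hxW : x ∉ W) (hyW : y ∉ W) (hzW : z ∉ W) (hzx : z ≠ x) (hzy : z ≠ y)
    (hA : A.Nonempty) (hAW : A ⊆ W) (hBW : B ⊆ W) (hAB : Disjoint A B)
    (hx : ∀ v ∈ W, G.Adj x v ↔ v ∈ A) (hy : ∀ v ∈ W, G.Adj y v ↔ v ∈ B)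
    (hα : α ≤ k) (hβ : β ≤ k) (hxy : x ≠ y) (hadj : G.Adj x y → α + β ≤ k)
    (hcW : ∀ Q : Finset V, G.IsClique (Q : Set V) → (Q : Set V) ⊆ W → Q.card ≤ k)
    (hcA : ∀ Q : Finset V, G.IsClique (Q : Set V) → (Q : Set V) ⊆ A → Q.card ≤ k - α)
    (hcB : ∀ Q : Finset V, G.IsClique (Q : Set V) → (Q : Set V) ⊆ B → Q.card ≤ k - β) :
    ∃ (c : V → Fin k) (S T : Finset (Fin k)), S.card = k - α ∧ T.card = k - β ∧
      (∀ u ∈ W, ∀ v ∈ W, G.Adj u v → c u ≠ c v) ∧ (∀ v ∈ A, c v ∈ S) ∧ ∀ v ∈ B, c v ∈ T := by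
  classical
  obtain ⟨f, hfw, hfd⟩ := exists_weighted_coloring hG (k := k) (z := z)
    (w := fun v => (if v ∈ W then 1 else 0) + (if v = x then α else 0) + if v = y then β else 0)
    (by simp [hzW, hzx, hzy]) (by
      intro Q hQ
      rw [Finset.sum_add_distrib, Finset.sum_add_distrib, ← Finset.card_filter,
        Finset.sum_ite_eq', Finset.sum_ite_eq']
      have hR : G.IsClique ((Q.filter (· ∈ W) : Finset V) : Set V) :=
        hQ.subset (Finset.coe_subset.2 (Finset.filter_subset _ _))
      have hRW : ((Q.filter (· ∈ W) : Finset V) : Set V) ⊆ W := fun v hv => by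
        simp at hv; exact hv.2
      have hRA : x ∈ Q → ((Q.filter (· ∈ W) : Finset V) : Set V) ⊆ A := fun hxQ v hv => by
        simp at hv
        exact (hx v hv.2).1 (hQ hxQ hv.1 (by rintro rfl; exact hxW hv.2))
      have hRB : y ∈ Q → ((Q.filter (· ∈ W) : Finset V) : Set V) ⊆ B := fun hyQ v hv => by
        simp at hv
        exact (hy v hv.2).1 (hQ hyQ hv.1 (by rintro rfl; exact hyW hv.2))
      split_ifs with h1 h2 h2
      · have h0 : Q.filter (· ∈ W) = ∅ := by
          rw [Finset.eq_empty_iff_forall_notMem]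
          intro v hv
          exact Set.disjoint_left.1 hAB (hRA h1 hv) (hRB h2 hv)
        have := hadj (hQ h1 h2 hxy)
        rw [h0, Finset.card_empty]
        omega
      · have := hcA _ hR (hRA h1)
        omega
      · have := hcB _ hR (hRB h2)
        omega
      · have := hcW _ hR hRW
        omega)
  have hne : ∀ v ∈ W, (f v).Nonempty := fun v hv => by
    rw [← Finset.card_pos, hfw]
    simp [hv]
  obtain ⟨a, ha⟩ := hA
  have hc : ∀ v, ∃ i, v ∈ W → i ∈ f v := fun v => by
    by_cases hv : v ∈ W
    · exact (hne v hv).imp fun i hi _ => hi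
    · exact ⟨(hne a (hAW ha)).choose, fun h => absurd h hv⟩
  choose c hc using hc
  refine ⟨c, (f x)ᶜ, (f y)ᶜ, ?_, ?_, ?_, ?_, ?_⟩
  · rw [Finset.card_compl, hfw]
    simp [hxW, hxy]
  · rw [Finset.card_compl, hfw]
    simp [hyW, hxy.symm]
  · intro u hu v hv huv h
    exact Finset.disjoint_left.1 (hfd u v huv) (hc u hu) (h ▸ hc v hv)
  · intro v hv
    rw [Finset.mem_compl]
    exact fun h => Finset.disjoint_left.1 (hfd x v ((hx v (hAW hv)).2 hv)) h (hc v (hAW hv))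
  · intro v hv
    rw [Finset.mem_compl]
    exact fun h => Finset.disjoint_left.1 (hfd y v ((hy v (hBW hv)).2 hv)) h (hc v (hBW hv))

/-- The first `m + 1` terms of `p` form a walk inside `X`. -/
def IsWalkSeq (G : SimpleGraph V) (X : Set V) (m : ℕ) (p : ℕ → V) : Prop :=
  (∀ i ≤ m, p i ∈ X) ∧ ∀ i < m, G.Adj (p i) (p (i + 1))

/-- The first `m + 1` terms of `p` form an induced path inside `X` from `A` to `B` that has no
inner vertices in `A` or `B`. -/
def IsInducedPathSeq (G : SimpleGraph V) (X A B : Set V) (m : ℕ) (p : ℕ → V) : Prop :=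
  IsWalkSeq G X m p ∧ p 0 ∈ A ∧ p m ∈ B ∧ (∀ i ≤ m, p i ∈ A → i = 0) ∧
    (∀ i ≤ m, p i ∈ B → i = m) ∧
    ∀ i j, i < j → j ≤ m → p i ≠ p j ∧ (G.Adj (p i) (p j) ↔ j = i + 1)

lemma IsWalkSeq.exists_isInducedPathSeq {X A B : Set V} {m : ℕ} {p : ℕ → V}
    (hp : IsWalkSeq G X m p) (hA : p 0 ∈ A) (hB : p m ∈ B) :
    ∃ m p, IsInducedPathSeq G X A B m p := by
  classical
  have hex : ∃ m, ∃ p, IsWalkSeq G X m p ∧ p 0 ∈ A ∧ p m ∈ B := ⟨m, p, hp, hA, hB⟩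
  obtain ⟨q, hq, hqA, hqB⟩ := Nat.find_spec hex
  have hmin : ∀ l, (∃ p, IsWalkSeq G X l p ∧ p 0 ∈ A ∧ p l ∈ B) → Nat.find hex ≤ l :=
    fun l hl => Nat.find_min' hex hl
  generalize Nat.find hex = n at hq hqB hmin
  -- skipping the vertices strictly between positions `i` and `j` gives a shorter walk
  have hskip : ∀ i j, i + 1 < j → j ≤ n → ¬ G.Adj (q i) (q j) := by
    intro i j hij hj hadj
    have := hmin (n - (j - i - 1)) ⟨fun t => if t ≤ i then q t else q (t + (j - i - 1)), ⟨?_, ?_⟩,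
      ?_, ?_⟩
    · omega
    · intro t ht
      dsimp only
      split_ifs with h
      · exact hq.1 _ (by omega)
      · exact hq.1 _ (by omega)
    · intro t ht
      rcases lt_trichotomy t i with h | h | h
      · simpa [h.le, show t + 1 ≤ i from h] using hq.2 t (by omega)
      · subst h
        simpa [show t + 1 + (j - t - 1) = j by omega] using hadj
      · have h' := hq.2 (t + (j - i - 1)) (by omega)
        simpa [show ¬ t ≤ i by omega, show ¬ t + 1 ≤ i by omega,
          show t + 1 + (j - i - 1) = t + (j - i - 1) + 1 by omega] using h'
    · simpa using hqA
    · simpa [show ¬ n - (j - i - 1) ≤ i by omega, show n - (j - i - 1) + (j - i - 1) = n by omega]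
        using hqB
  have hne : ∀ i j, i < j → j ≤ n → q i ≠ q j := by
    intro i j hij hj h
    by_cases hjn : j = n
    · subst hjn
      have := hmin i ⟨q, ⟨fun t ht => hq.1 t (by omega), fun t ht => hq.2 t (by omega)⟩, hqA,
        h ▸ hqB⟩
      omega
    · refine hskip i (j + 1) (by omega) (by omega) ?_
      rw [h]
      exact hq.2 j (by omega)
  refine ⟨n, q, hq, hqA, hqB, ?_, ?_, ?_⟩
  · intro i hi hiA
    have := hmin (n - i) ⟨fun t => q (t + i), ⟨fun t ht => hq.1 _ (by omega), fun t ht => ?_⟩,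
      by simpa using hiA, by simpa [hi] using hqB⟩
    · omega
    · have h' := hq.2 (t + i) (by omega)
      rwa [show t + i + 1 = t + 1 + i by omega] at h'
  · intro i hi hiB
    have := hmin i ⟨q, ⟨fun t ht => hq.1 t (by omega), fun t ht => hq.2 t (by omega)⟩, hqA, hiB⟩
    omega
  · intro i j hij hj
    refine ⟨hne i j hij hj, fun hadj => ?_, ?_⟩
    · by_contra h
      exact hskip i j (by omega) hj hadj
    · rintro rfl
      exact hq.2 i (by omega)

/-- Kempe exchange: in a coloring of `W`, color `i` can be replaced by `j` on `B` without changing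
the colors of `A`, unless an induced path with colors `i` and `j` leads from `A` to `B`. -/
lemma exists_kempe_exchange {α : Type*} [DecidableEq α] {W A B : Set V} {c : V → α}
    (hc : ∀ u ∈ W, ∀ v ∈ W, G.Adj u v → c u ≠ c v) (hBW : B ⊆ W) {T : Finset α}
    (hT : ∀ v ∈ B, c v ∈ T) {i j : α} (hj : j ∉ T)
    (hpath : ¬ ∃ m p, IsInducedPathSeq G {v | v ∈ W ∧ (c v = i ∨ c v = j)} A B m p) :
    ∃ c' : V → α, (∀ u ∈ W, ∀ v ∈ W, G.Adj u v → c' u ≠ c' v) ∧ (∀ v ∈ A, c' v = c v) ∧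
      ∀ v ∈ B, c' v ∈ insert j (T.erase i) := by
  classical
  set X : Set V := {v | v ∈ W ∧ (c v = i ∨ c v = j)} with hX
  let R : Set V := {v | ∃ m p, IsWalkSeq G X m p ∧ p 0 = v ∧ p m ∈ B}
  have hRX : ∀ v ∈ R, v ∈ X := by
    rintro v ⟨m, p, hp, rfl, -⟩
    exact hp.1 0 (Nat.zero_le _)
  have hclosed : ∀ v ∈ R, ∀ u ∈ X, G.Adj u v → u ∈ R := by
    rintro v ⟨m, p, hp, rfl, hB⟩ u hu huv
    refine ⟨m + 1, fun t => if t = 0 then u else p (t - 1), ⟨?_, ?_⟩, by simp, by simpa using hB⟩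
    · intro t ht
      dsimp only
      split_ifs
      · exact hu
      · exact hp.1 _ (by omega)
    · intro t ht
      rcases Nat.eq_zero_or_pos t with rfl | h
      · simpa using huv
      · have h' := hp.2 (t - 1) (by omega)
        rw [Nat.sub_add_cancel h] at h'
        simpa [h.ne'] using h'
  have hAR : ∀ v ∈ A, v ∉ R := by
    rintro v hv ⟨m, p, hp, rfl, hB⟩
    exact hpath (hp.exists_isInducedPathSeq hv hB)
  have hcross : ∀ u ∈ R, ∀ v ∈ W, v ∉ R → G.Adj u v → Equiv.swap i j (c u) ≠ c v := by
    intro u hu v hv hvR huv h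
    refine hvR (hclosed u hu v ⟨hv, ?_⟩ huv.symm)
    rw [← h]
    rcases (hRX u hu).2 with h | h <;> simp [h]
  refine ⟨fun v => if v ∈ R then Equiv.swap i j (c v) else c v, ?_, ?_, ?_⟩
  · intro u hu v hv huv
    dsimp only
    split_ifs with h1 h2 h2
    · exact fun h => hc u hu v hv huv ((Equiv.swap i j).injective h)
    · exact hcross u h1 v hv h2 huv
    · exact (hcross v h2 u hu h1 huv.symm).symm
    · exact hc u hu v hv huv
  · intro v hv
    simp [hAR v hv]
  · intro v hv
    have hvT := hT v hv
    dsimp only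
    split_ifs with h
    · rcases (hRX v h).2 with h' | h'
      · simp [h']
      · exact absurd (h' ▸ hvT) hj
    · refine Finset.mem_insert_of_mem (Finset.mem_erase.2 ⟨fun h' => h ?_, hvT⟩)
      exact ⟨0, fun _ => v, ⟨fun _ _ => ⟨hBW hv, Or.inl h'⟩, by simp⟩, rfl, hv⟩

/-- The ends of a path with two colors have the same color exactly if its length is even. -/
lemma IsInducedPathSeq.even_iff {α : Type*} {W A B : Set V} {c : V → α}
    (hc : ∀ u ∈ W, ∀ v ∈ W, G.Adj u v → c u ≠ c v) {i j : α} {m : ℕ} {p : ℕ → V}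
    (hp : IsInducedPathSeq G {v | v ∈ W ∧ (c v = i ∨ c v = j)} A B m p) :
    Even m ↔ c (p 0) = c (p m) := by
  have key : ∀ t ≤ m, (Even t ↔ c (p 0) = c (p t)) := by
    intro t
    induction t with
    | zero => simp
    | succ t ih =>
      intro ht
      have h1 := hc _ (hp.1.1 t (by omega)).1 _ (hp.1.1 (t + 1) ht).1 (hp.1.2 t (by omega))
      have h2 := (hp.1.1 0 (by omega)).2
      have h3 := (hp.1.1 t (by omega)).2
      have h4 := (hp.1.1 (t + 1) ht).2
      rw [Nat.even_add_one, ih (by omega)]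
      grind
  exact key m le_rfl

/-- Adjacency in a cycle in terms of the underlying natural numbers. -/
lemma cycleGraph_adj_iff_val {n : ℕ} (hn : 3 ≤ n) {u v : Fin n} :
    (cycleGraph n).Adj u v ↔ (v : ℕ) = u + 1 ∨ (u : ℕ) = v + 1 ∨
      ((u : ℕ) = 0 ∧ (v : ℕ) + 1 = n) ∨ ((v : ℕ) = 0 ∧ (u : ℕ) + 1 = n) := by
  have hu := u.2
  have hv := v.2
  rw [cycleGraph_adj']
  rcases lt_trichotomy u v with h | h | h
  · rw [Fin.sub_val_of_le h.le, Fin.coe_sub_iff_lt.2 h]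
    have : (u : ℕ) < v := h
    omega
  · subst h
    rw [Fin.sub_val_of_le le_rfl]
    omega
  · rw [Fin.sub_val_of_le h.le, Fin.coe_sub_iff_lt.2 h]
    have : (v : ℕ) < u := h
    omega

/-- A minimally imperfect graph containing an odd hole is an odd hole. -/
lemma isOddHole_of_embedding (hG : MinimallyImperfect G) {n : ℕ} (hn : 5 ≤ n) (hodd : Odd n)
    (f : cycleGraph n ↪g G) : IsOddHole G := by
  by_cases hf : Set.range f = Set.univ
  · exact ⟨n, by omega, hodd,
      ⟨(RelIso.ofSurjective f (Set.range_eq_univ.1 hf)).symm⟩⟩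
  · exfalso
    have hcol : (G.induce (Set.range f)).Colorable 2 := by
      refine colorable_of_isPerfect (hG.2 _ hf) fun Q hQ => ?_
      by_contra! hlt
      obtain ⟨⟨_, a, rfl⟩, ⟨_, b, rfl⟩, ⟨_, c, rfl⟩, ha, hb, hc, hab, hac, hbc⟩ :=
        Finset.two_lt_card_iff.1 hlt
      have h1 : (cycleGraph n).Adj a b := f.map_adj_iff.1 (hQ ha hb hab)
      have h2 : (cycleGraph n).Adj a c := f.map_adj_iff.1 (hQ ha hc hac)
      have h3 : (cycleGraph n).Adj b c := f.map_adj_iff.1 (hQ hb hc hbc)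
      rw [cycleGraph_adj_iff_val (by omega)] at h1 h2 h3
      omega
    let g : cycleGraph n →g G.induce (Set.range f) :=
      ⟨fun v => ⟨f v, v, rfl⟩, fun h => f.map_adj_iff.2 h⟩
    have h := chromaticNumber_le_iff_colorable.2 (hcol.of_hom g)
    rw [chromaticNumber_cycleGraph_of_odd n (by omega) hodd] at h
    exact absurd h (by decide)

/-- Exchanging the two sides of a 2-join. -/
lemma IsTwoJoin_symm {V1 V2 A1 B1 A2 B2 : Set V} (h : IsTwoJoin G V1 V2 A1 B1 A2 B2) :
    IsTwoJoin G V2 V1 A2 B2 A1 B1 := by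
  obtain ⟨hU, hd, h1, h2, hA1, hB1, hA2, hB2, hA1s, hB1s, hA2s, hB2s, hAB1, hAB2, hA, hB, hE⟩ := h
  refine ⟨Set.union_comm V1 V2 ▸ hU, hd.symm, h2, h1, hA2, hB2, hA1, hB1, hA2s, hB2s, hA1s, hB1s,
    hAB2, hAB1, fun a ha b hb => (hA b hb a ha).symm, fun a ha b hb => (hB b hb a ha).symm, ?_⟩
  intro u hu v hv huv
  exact (hE v hv u hu huv.symm).imp And.symm And.symm

/-- Adjacency across a 2-join. -/
lemma IsTwoJoin_adj_iff {V1 V2 A1 B1 A2 B2 : Set V} (h : IsTwoJoin G V1 V2 A1 B1 A2 B2)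
    {u v : V} (hu : u ∈ V1) (hv : v ∈ V2) :
    G.Adj u v ↔ (u ∈ A1 ∧ v ∈ A2) ∨ (u ∈ B1 ∧ v ∈ B2) := by
  obtain ⟨-, -, -, -, -, -, -, -, -, -, -, -, -, -, hA, hB, hE⟩ := h
  exact ⟨hE u hu v hv, by rintro (h | h); exacts [hA u h.1 v h.2, hB u h.1 v h.2]⟩

/-- Induced paths between the attachment sets on both sides of a 2-join form a hole. -/
lemma nonempty_cycleGraph_embedding {V1 V2 A1 B1 A2 B2 : Set V}
    (h : IsTwoJoin G V1 V2 A1 B1 A2 B2) {X1 X2 : Set V} (hX1 : X1 ⊆ V1) (hX2 : X2 ⊆ V2)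
    {m l : ℕ} {p r : ℕ → V} (hp : IsInducedPathSeq G X1 A1 B1 m p)
    (hr : IsInducedPathSeq G X2 A2 B2 l r) (hml : 1 ≤ m + l) :
    Nonempty (cycleGraph (m + l + 2) ↪g G) := by
  obtain ⟨⟨hpX, -⟩, hpA, hpB, hpA', hpB', hpi⟩ := hp
  obtain ⟨⟨hrX, -⟩, hrA, hrB, hrA', hrB', hri⟩ := hr
  have hcross : ∀ i ≤ m, ∀ t ≤ l, G.Adj (p i) (r t) ↔ (i = 0 ∧ t = 0) ∨ (i = m ∧ t = l) := by
    intro i hi t ht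
    rw [IsTwoJoin_adj_iff h (hX1 (hpX i hi)) (hX2 (hrX t ht))]
    refine or_congr (and_congr ⟨hpA' i hi, ?_⟩ ⟨hrA' t ht, ?_⟩)
      (and_congr ⟨hpB' i hi, ?_⟩ ⟨hrB' t ht, ?_⟩) <;> rintro rfl <;> assumption
  have hne : ∀ i ≤ m, ∀ t ≤ l, p i ≠ r t := fun i hi t ht hit =>
    Set.disjoint_left.1 h.2.1 (hX1 (hpX i hi)) (hit ▸ hX2 (hrX t ht))
  let φ : ℕ → V := fun i => if i ≤ m then p i else r (m + l + 1 - i)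
  have key : ∀ i j, i < j → j < m + l + 2 → φ i ≠ φ j ∧
      (G.Adj (φ i) (φ j) ↔ j = i + 1 ∨ (i = 0 ∧ j = m + l + 1)) := by
    intro i j hij hj
    by_cases hjm : j ≤ m
    · have := hpi i j hij hjm
      simp only [φ, hjm, show i ≤ m by omega, if_true]
      refine ⟨this.1, this.2.trans ?_⟩
      omega
    by_cases him : i ≤ m
    · simp only [φ, hjm, him, if_true, if_false]
      refine ⟨hne i him _ (by omega), (hcross i him _ (by omega)).trans ?_⟩
      omega
    · have := hri (m + l + 1 - j) (m + l + 1 - i) (by omega) (by omega)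
      simp only [φ, hjm, him, if_false]
      rw [G.adj_comm]
      refine ⟨this.1.symm, this.2.trans ?_⟩
      omega
  refine ⟨⟨⟨fun i => φ i, ?_⟩, ?_⟩⟩
  · intro i j hij
    rcases lt_trichotomy i j with hlt | hlt | hlt
    · exact absurd hij (key i j hlt j.2).1
    · exact hlt
    · exact absurd hij.symm (key j i hlt i.2).1
  · intro i j
    have hi := i.2
    have hj := j.2
    rw [cycleGraph_adj_iff_val (by omega)]
    rcases lt_trichotomy i j with hlt | hlt | hlt
    · have hlt' : (i : ℕ) < j := hlt
      refine (key i j hlt j.2).2.trans ?_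
      omega
    · subst hlt
      exact ⟨fun h => absurd h G.irrefl, fun h => by omega⟩
    · have hlt' : (j : ℕ) < i := hlt
      refine (G.adj_comm _ _).trans ((key j i hlt i.2).2.trans ?_)
      omega

/-- Colorings of the two sides of a 2-join whose colors on the attachment sets are few enough can
be turned by Kempe exchanges into a coloring of the whole graph, unless there is an odd hole. -/
lemma colorable_or_odd_cycle {V1 V2 A1 B1 A2 B2 : Set V}
    (h : IsTwoJoin G V1 V2 A1 B1 A2 B2) {k : ℕ} {S1 S2 : Finset (Fin k)} (hS : Disjoint S1 S2)
    (N : ℕ) : ∀ (c1 c2 : V → Fin k) (T1 T2 : Finset (Fin k)),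
    (T1 ∩ T2).card ≤ N → T1.card + T2.card ≤ k →
    (∀ u ∈ V1, ∀ v ∈ V1, G.Adj u v → c1 u ≠ c1 v) →
    (∀ u ∈ V2, ∀ v ∈ V2, G.Adj u v → c2 u ≠ c2 v) →
    (∀ v ∈ A1, c1 v ∈ S1) → (∀ v ∈ A2, c2 v ∈ S2) →
    (∀ v ∈ B1, c1 v ∈ T1) → (∀ v ∈ B2, c2 v ∈ T2) →
    G.Colorable k ∨ ∃ n, 5 ≤ n ∧ Odd n ∧ Nonempty (cycleGraph n ↪g G) := by
  classical
  have hj := h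
  obtain ⟨hU, hd, -, -, -, -, -, -, hA1s, hB1s, hA2s, hB2s, hAB1, hAB2, -⟩ := hj
  have hexch : ∀ {T T' : Finset (Fin k)} {i j : Fin k}, i ∈ T → i ∈ T' → j ∉ T → j ∉ T' →
      (insert j (T.erase i) ∩ T').card < (T ∩ T').card ∧
        (insert j (T.erase i)).card = T.card := by
    intro T T' i j hi hi' hj hj'
    constructor
    · refine Finset.card_lt_card (Finset.ssubset_iff_of_subset ?_ |>.2 ⟨i, ?_, ?_⟩)
      · intro x hx
        grind
      · grind
      · grind
    · rw [Finset.card_insert_of_notMem (by grind), Finset.card_erase_of_mem hi]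
      have := Finset.card_pos.2 ⟨i, hi⟩
      omega
  induction N with
  | zero =>
    intro c1 c2 T1 T2 hN _ h1 h2 hSA1 hSA2 hTB1 hTB2
    have hT : Disjoint T1 T2 := by
      rw [Finset.disjoint_iff_inter_eq_empty, ← Finset.card_eq_zero]
      omega
    have hcross : ∀ u ∈ V1, ∀ v ∈ V2, G.Adj u v → c1 u ≠ c2 v := by
      intro u hu v hv huv heq
      rcases (IsTwoJoin_adj_iff h hu hv).1 huv with ⟨ha, hb⟩ | ⟨ha, hb⟩
      · exact Finset.disjoint_left.1 hS (hSA1 u ha) (heq ▸ hSA2 v hb)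
      · exact Finset.disjoint_left.1 hT (hTB1 u ha) (heq ▸ hTB2 v hb)
    have hV2 : ∀ v, v ∉ V1 → v ∈ V2 := fun v hv =>
      (hU.symm ▸ Set.mem_univ v : v ∈ V1 ∪ V2).resolve_left hv
    refine Or.inl ⟨Coloring.mk (fun v => if v ∈ V1 then c1 v else c2 v) ?_⟩
    intro u v huv
    split_ifs with hu hv hv
    · exact h1 u hu v hv huv
    · exact hcross u hu v (hV2 v hv) huv
    · exact (hcross v hv u (hV2 u hu) huv.symm).symm
    · exact h2 u (hV2 u hu) v (hV2 v hv) huv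
  | succ N ih =>
    intro c1 c2 T1 T2 hN hcard h1 h2 hSA1 hSA2 hTB1 hTB2
    by_cases hT : T1 ∩ T2 = ∅
    · exact ih c1 c2 T1 T2 (by simp [hT]) hcard h1 h2 hSA1 hSA2 hTB1 hTB2
    obtain ⟨i, hi⟩ := Finset.nonempty_iff_ne_empty.2 hT
    obtain ⟨hi1, hi2⟩ := Finset.mem_inter.1 hi
    obtain ⟨j, hj⟩ : ∃ j, j ∉ T1 ∪ T2 := by
      by_contra! hall
      have huniv : T1 ∪ T2 = Finset.univ := Finset.eq_univ_iff_forall.2 hall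
      have := Finset.card_union_add_card_inter T1 T2
      rw [huniv, Finset.card_univ, Fintype.card_fin] at this
      have := Finset.card_pos.2 ⟨i, hi⟩
      omega
    rw [Finset.mem_union, not_or] at hj
    obtain ⟨hj1, hj2⟩ := hj
    by_cases hp : ∃ m p, IsInducedPathSeq G {v | v ∈ V1 ∧ (c1 v = i ∨ c1 v = j)} A1 B1 m p
    swap
    · obtain ⟨c, hc, hcA, hcB⟩ := exists_kempe_exchange h1 hB1s hTB1 hj1 hp
      have := hexch hi1 hi2 hj1 hj2
      exact ih c c2 _ T2 (by omega) (by omega) hc h2 (fun v hv => hcA v hv ▸ hSA1 v hv) hSA2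
        hcB hTB2
    by_cases hr : ∃ m p, IsInducedPathSeq G {v | v ∈ V2 ∧ (c2 v = i ∨ c2 v = j)} A2 B2 m p
    swap
    · obtain ⟨c, hc, hcA, hcB⟩ := exists_kempe_exchange h2 hB2s hTB2 hj2 hr
      have := hexch hi2 hi1 hj2 hj1
      rw [Finset.inter_comm T2 T1, Finset.inter_comm _ T1] at this
      exact ih c1 c T1 _ (by omega) (by omega) h1 hc hSA1 (fun v hv => hcA v hv ▸ hSA2 v hv)
        hTB1 hcB
    obtain ⟨m, p, hp⟩ := hp
    obtain ⟨l, r, hr⟩ := hr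
    have hm : m ≠ 0 := by
      rintro rfl
      exact Set.disjoint_left.1 hAB1 hp.2.1 hp.2.2.1
    have hl : l ≠ 0 := by
      rintro rfl
      exact Set.disjoint_left.1 hAB2 hr.2.1 hr.2.2.1
    have hpe := hp.even_iff h1
    have hre := hr.even_iff h2
    have hodd : Odd (m + l + 2) := by
      have p0 := (hp.1.1 0 (Nat.zero_le _)).2
      have pm := (hp.1.1 m le_rfl).2
      have r0 := (hr.1.1 0 (Nat.zero_le _)).2
      have rl := (hr.1.1 l le_rfl).2
      have pS := hSA1 _ hp.2.1
      have rS := hSA2 _ hr.2.1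
      have pT := hTB1 _ hp.2.2.1
      have rT := hTB2 _ hr.2.2.1
      have hne : c1 (p 0) ≠ c2 (r 0) := fun heq => Finset.disjoint_left.1 hS pS (heq ▸ rS)
      have hpm : c1 (p m) = i := pm.resolve_right fun heq => hj1 (heq ▸ pT)
      have hrl : c2 (r l) = i := rl.resolve_right fun heq => hj2 (heq ▸ rT)
      rw [hpm] at hpe
      rw [hrl] at hre
      have : Even m ↔ ¬ Even l := by
        rw [hpe, hre]
        grind
      rw [← Nat.not_even_iff_odd]
      grind
    refine Or.inr ⟨m + l + 2, ?_, hodd,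
      nonempty_cycleGraph_embedding h (fun v hv => hv.1) (fun v hv => hv.1) hp hr (by omega)⟩
    obtain ⟨t, ht⟩ := hodd
    omega

/-- Every set of vertices contains a largest clique. -/
lemma exists_largest_clique [Fintype V] (G : SimpleGraph V) (A : Set V) :
    ∃ M : Finset V, G.IsClique (M : Set V) ∧ (M : Set V) ⊆ A ∧
      ∀ Q : Finset V, G.IsClique (Q : Set V) → (Q : Set V) ⊆ A → Q.card ≤ M.card := by
  classical
  obtain ⟨M, hM, hmax⟩ := Finset.exists_max_image
    (Finset.univ.filter fun Q : Finset V => G.IsClique (Q : Set V) ∧ (Q : Set V) ⊆ A)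
    Finset.card ⟨∅, by simp⟩
  simp only [Finset.mem_filter, Finset.mem_univ, true_and] at hM hmax
  exact ⟨M, hM.1, hM.2, fun Q hQ hQA => hmax Q ⟨hQ, hQA⟩⟩

/-- Cliques in disjoint sets that are completely adjacent can be united. -/
lemma card_add_card_le_cliqueNum [Finite V] {A B : Set V} {P Q : Finset V}
    (hAB : ∀ a ∈ A, ∀ b ∈ B, G.Adj a b) (hP : G.IsClique (P : Set V)) (hPA : (P : Set V) ⊆ A)
    (hQ : G.IsClique (Q : Set V)) (hQB : (Q : Set V) ⊆ B) :
    P.card + Q.card ≤ G.cliqueNum := by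
  classical
  have hd : Disjoint P Q := Finset.disjoint_left.2 fun v hv hv' =>
    G.irrefl (hAB v (hPA hv) v (hQB hv'))
  rw [← Finset.card_union_of_disjoint hd]
  refine IsClique.card_le_cliqueNum (tc := ?_)
  intro u hu v hv huv
  simp only [Finset.coe_union, Set.mem_union] at hu hv
  rcases hu with hu | hu <;> rcases hv with hv | hv
  · exact hP hu hv huv
  · exact hAB u (hPA hu) v (hQB hv)
  · exact (hAB v (hPA hv) u (hQB hu)).symm
  · exact hQ hu hv huv

/-- One side of a 2-join in a graph with perfect proper induced subgraphs can be colored with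
prescribed numbers of colors on the attachment sets. -/
lemma exists_coloring_side [Fintype V] (hG : ∀ S : Set V, S ≠ Set.univ → IsPerfect (G.induce S))
    {V1 V2 A1 B1 A2 B2 : Set V} (h : IsTwoJoin G V1 V2 A1 B1 A2 B2) {a b : ℕ}
    (ha : a ≤ G.cliqueNum) (hb : b ≤ G.cliqueNum)
    (hadj : ∃ x ∈ A2, ∃ y ∈ B2, G.Adj x y → G.cliqueNum ≤ a + b)
    (hcA : ∀ Q : Finset V, G.IsClique (Q : Set V) → (Q : Set V) ⊆ A1 → Q.card ≤ a)
    (hcB : ∀ Q : Finset V, G.IsClique (Q : Set V) → (Q : Set V) ⊆ B1 → Q.card ≤ b) :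
    ∃ (c : V → Fin G.cliqueNum) (S T : Finset (Fin G.cliqueNum)), S.card = a ∧ T.card = b ∧
      (∀ u ∈ V1, ∀ v ∈ V1, G.Adj u v → c u ≠ c v) ∧ (∀ v ∈ A1, c v ∈ S) ∧
        ∀ v ∈ B1, c v ∈ T := by
  obtain ⟨x, hx, y, hy, hxy⟩ := hadj
  have hj := h
  obtain ⟨-, hd, -, h3, hA1, -, -, -, hA1s, hB1s, hA2s, hB2s, hAB1, hAB2, -⟩ := hj
  obtain ⟨z, hz, hzx, hzy⟩ : ∃ z ∈ V2, z ≠ x ∧ z ≠ y := by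
    by_contra! hall
    have hsub : V2 ⊆ {x, y} := fun z hz => by
      by_cases hzx : z = x
      · exact Or.inl hzx
      · exact Or.inr (hall z hz hzx)
    have := (Set.ncard_le_ncard hsub).trans (Set.ncard_insert_le x {y})
    rw [Set.ncard_singleton] at this
    omega
  have hV1 : ∀ v ∈ V2, v ∉ V1 := fun v hv hv' => Set.disjoint_left.1 hd hv' hv
  have hxB : x ∉ B2 := fun hxB => Set.disjoint_left.1 hAB2 hx hxB
  have hyA : y ∉ A2 := fun hyA => Set.disjoint_left.1 hAB2 hyA hy
  have := exists_coloring_of_attached hG (k := G.cliqueNum) (α := G.cliqueNum - a)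
    (β := G.cliqueNum - b) (hV1 x (hA2s hx)) (hV1 y (hB2s hy)) (hV1 z hz) hzx hzy hA1 hA1s hB1s
    hAB1
    (fun v hv => by
      rw [IsTwoJoin_adj_iff (IsTwoJoin_symm h) (hA2s hx) hv]
      simp [hx, hxB])
    (fun v hv => by
      rw [IsTwoJoin_adj_iff (IsTwoJoin_symm h) (hB2s hy) hv]
      simp [hy, hyA])
    (by omega) (by omega) (fun hxy => hxB (hxy ▸ hy)) (fun had => by have := hxy had; omega)
    (fun Q hQ _ => IsClique.card_le_cliqueNum (tc := hQ))
    (fun Q hQ hQA => by have := hcA Q hQ hQA; omega)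
    (fun Q hQ hQB => by have := hcB Q hQ hQB; omega)
  rwa [Nat.sub_sub_self ha, Nat.sub_sub_self hb] at this

end SimpleGraph

/-- If a minimally imperfect graph has a 2-join, then it is an odd hole. -/
theorem minimallyImperfect_hasTwoJoin_isOddHole {V : Type*} [Fintype V]
    (G : SimpleGraph V) (hmi : MinimallyImperfect G) (h2j : HasTwoJoin G) :
    IsOddHole G := by
  obtain ⟨V1, V2, A1, B1, A2, B2, h⟩ := h2j
  have hj := h
  obtain ⟨-, -, -, -, ⟨x1, hx1⟩, ⟨y1, hy1⟩, ⟨x2, hx2⟩, ⟨y2, hy2⟩, -, -, -, -, -, -, hA, hB, -⟩ := hj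
  obtain ⟨P1, hP1, hP1A, hP1max⟩ := exists_largest_clique G A1
  obtain ⟨Q1, hQ1, hQ1B, hQ1max⟩ := exists_largest_clique G B1
  obtain ⟨P2, hP2, hP2A, hP2max⟩ := exists_largest_clique G A2
  obtain ⟨Q2, hQ2, hQ2B, hQ2max⟩ := exists_largest_clique G B2
  have hP := card_add_card_le_cliqueNum hA hP1 hP1A hP2 hP2A
  have hQ := card_add_card_le_cliqueNum hB hQ1 hQ1B hQ2 hQ2B
  -- the numbers of colors to be used by the cliques of the first side
  obtain ⟨a, b, ha1, ha2, hb1, hb2, hadj1, hadj2⟩ : ∃ a b, P1.card ≤ a ∧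
      a + P2.card ≤ G.cliqueNum ∧ Q1.card ≤ b ∧ b + Q2.card ≤ G.cliqueNum ∧
      (∃ x ∈ A2, ∃ y ∈ B2, G.Adj x y → G.cliqueNum ≤ a + b) ∧
      ∃ x ∈ A1, ∃ y ∈ B1, G.Adj x y → a + b ≤ G.cliqueNum := by
    by_cases h1 : G.cliqueNum < P1.card + Q1.card
    · refine ⟨P1.card, Q1.card, le_rfl, hP, le_rfl, hQ,
        ⟨x2, hx2, y2, hy2, fun _ => h1.le⟩, ?_⟩
      by_contra! hall
      have := card_add_card_le_cliqueNum (fun x hx y hy => (hall x hx y hy).1) hP1 hP1A hQ1 hQ1B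
      omega
    by_cases h2 : G.cliqueNum < P2.card + Q2.card
    · refine ⟨G.cliqueNum - P2.card, G.cliqueNum - Q2.card, by omega, by omega, by omega,
        by omega, ?_, ⟨x1, hx1, y1, hy1, fun _ => by omega⟩⟩
      by_contra! hall
      have := card_add_card_le_cliqueNum (fun x hx y hy => (hall x hx y hy).1) hP2 hP2A hQ2 hQ2B
      omega
    · refine ⟨max P1.card Q2.card, G.cliqueNum - max P1.card Q2.card, by omega, by omega,
        by omega, by omega, ⟨x2, hx2, y2, hy2, fun _ => by omega⟩,
        ⟨x1, hx1, y1, hy1, fun _ => by omega⟩⟩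
  obtain ⟨c1, S1, T1, hS1, hT1, hc1, hcA1, hcB1⟩ := exists_coloring_side hmi.2 h (a := a) (b := b)
    (by omega) (by omega) hadj1 (fun Q hQ hQA => (hP1max Q hQ hQA).trans ha1)
    (fun Q hQ hQB => (hQ1max Q hQ hQB).trans hb1)
  obtain ⟨x, hx, y, hy, hxy⟩ := hadj2
  obtain ⟨c2, S2, T2, hS2, hT2, hc2, hcA2, hcB2⟩ := exists_coloring_side hmi.2 (IsTwoJoin_symm h)
    (a := G.cliqueNum - a) (b := G.cliqueNum - b) (by omega) (by omega)
    ⟨x, hx, y, hy, fun had => by have := hxy had; omega⟩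
    (fun Q hQ hQA => by have := hP2max Q hQ hQA; omega)
    (fun Q hQ hQB => by have := hQ2max Q hQ hQB; omega)
  -- rename the colors of the second side so that `A1` and `A2` have no common color
  have hcard : S2.card = S1ᶜ.card := by
    rw [Finset.card_compl, Fintype.card_fin, hS1, hS2]
  let σ := (Finset.equivOfCardEq hcard).extendSubtype
  have hσ : ∀ i ∈ S2, σ i ∈ S1ᶜ := (Finset.equivOfCardEq hcard).extendSubtype_mem
  rcases colorable_or_odd_cycle h (S1 := S1) (S2 := S1ᶜ) disjoint_compl_right _ c1
    (fun v => σ (c2 v)) T1 (T2.map σ.toEmbedding) le_rfl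
    (by rw [Finset.card_map]; omega) hc1
    (fun u hu v hv huv heq => hc2 u hu v hv huv (σ.injective heq)) hcA1
    (fun v hv => hσ _ (hcA2 v hv)) hcB1
    (fun v hv => Finset.mem_map_of_mem _ (hcB2 v hv)) with hcol | ⟨n, hn, hodd, ⟨f⟩⟩
  · exact absurd hcol (not_colorable_cliqueNum_of_minimallyImperfect hmi)
  · exact isOddHole_of_embedding hmi hn hodd f
end

section
/- No minimally imperfect graph contains a T-cutset; that is, no minimally imperfect graph has a skew partition A, B, C, D together with vertices u ∈ C and v ∈ D such that every vertex of A is adjacent to both u and v. -/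
open SimpleGraph

/-- `A, B, C, D` form a skew partition of `G`: all four sets are nonempty, they
partition the vertex set, every vertex of `A` is adjacent to every vertex of `B`,
and there are no edges between `C` and `D`. -/
def IsSkewPartition {V : Type*} (G : SimpleGraph V) (A B C D : Set V) : Prop :=
  A.Nonempty ∧ B.Nonempty ∧ C.Nonempty ∧ D.Nonempty ∧
  A ∪ B ∪ C ∪ D = Set.univ ∧
  Disjoint A B ∧ Disjoint A C ∧ Disjoint A D ∧
  Disjoint B C ∧ Disjoint B D ∧ Disjoint C D ∧
  (∀ a ∈ A, ∀ b ∈ B, G.Adj a b) ∧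
  (∀ c ∈ C, ∀ d ∈ D, ¬ G.Adj c d)

/-- A graph has a skew partition if its vertex set admits one. -/
def HasSkewPartition {V : Type*} (G : SimpleGraph V) : Prop :=
  ∃ A B C D : Set V, IsSkewPartition G A B C D

/-- Every clique of `G` contained in `S` has at most `n` vertices. -/
def CliqueBoundOn {V : Type*} (G : SimpleGraph V) (S : Finset V) (n : ℕ) : Prop :=
  ∀ t : Finset V, t ⊆ S → G.IsClique t → t.card ≤ n

/-- `c` is a proper colouring of `G[S]` by colours below `n`. -/
def IsColoringOn {V : Type*} (G : SimpleGraph V) (S : Finset V) (n : ℕ) (c : V → ℕ) : Prop :=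
  (∀ w ∈ S, c w < n) ∧ ∀ w ∈ S, ∀ w' ∈ S, G.Adj w w' → c w ≠ c w'

/-- `G[S]` has a proper colouring with as many colours as any bound on its cliques. -/
def CliqueColorable {V : Type*} (G : SimpleGraph V) (S : Finset V) : Prop :=
  ∀ n, CliqueBoundOn G S n → ∃ c, IsColoringOn G S n c

section

variable {V : Type*} {G : SimpleGraph V}

theorem CliqueBoundOn.mono {S T : Finset V} {n : ℕ} (h : CliqueBoundOn G T n) (hST : S ⊆ T) :
    CliqueBoundOn G S n :=
  fun t ht hc => h t (ht.trans hST) hc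

theorem CliqueBoundOn.exists_max (G : SimpleGraph V) (S : Finset V) :
    ∃ t ⊆ S, G.IsClique t ∧ CliqueBoundOn G S t.card := by
  classical
  obtain ⟨t, ht, hmax⟩ := (S.powerset.filter fun t : Finset V => G.IsClique t).exists_max_image
    Finset.card ⟨∅, by simp⟩
  simp only [Finset.mem_filter, Finset.mem_powerset] at ht hmax
  exact ⟨t, ht.1, ht.2, fun s hs hc => hmax s ⟨hs, hc⟩⟩

theorem CliqueBoundOn.cliqueNum_le {W : Type*} [Finite W] {H : SimpleGraph W} {S : Finset V}
    {n : ℕ} (h : CliqueBoundOn G S n) (f : H ↪g G) (hf : ∀ w, f w ∈ S) : H.cliqueNum ≤ n := by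
  classical
  obtain ⟨s, hs⟩ := H.exists_isNClique_cliqueNum
  rw [← hs.card_eq, ← Finset.card_map f.toEmbedding]
  refine h _ (fun x hx => ?_) ?_
  · obtain ⟨w, -, rfl⟩ := Finset.mem_map.1 hx
    exact hf w
  · rintro x hx y hy hxy
    simp only [Finset.coe_map, Set.mem_image, Finset.mem_coe] at hx hy
    obtain ⟨a, ha, rfl⟩ := hx
    obtain ⟨b, hb, rfl⟩ := hy
    exact f.map_adj_iff.2 (hs.isClique ha hb fun hab => hxy (by rw [hab]))

theorem IsColoringOn.injOn {S t : Finset V} {n : ℕ} {c : V → ℕ} (hc : IsColoringOn G S n c)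
    (ht : t ⊆ S) (hcl : G.IsClique t) : Set.InjOn c t := by
  intro x hx y hy hxy
  by_contra hne
  exact hc.2 x (ht hx) y (ht hy) (hcl hx hy hne) hxy

theorem IsColoringOn.card_le {S t : Finset V} {n : ℕ} {c : V → ℕ} (hc : IsColoringOn G S n c)
    (ht : t ⊆ S) (hcl : G.IsClique t) {K : Finset ℕ} (hK : ∀ w ∈ t, c w ∈ K) :
    t.card ≤ K.card :=
  Finset.card_le_card_of_injOn c hK (hc.injOn ht hcl)

theorem IsPerfect.cliqueColorable [Fintype V] {S : Finset V}
    (h : IsPerfect (G.induce (S : Set V))) : CliqueColorable G S := by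
  classical
  intro n hn
  have hle := hn.cliqueNum_le
    ((Embedding.induce (Set.univ : Set (S : Set V))).trans (Embedding.induce (S : Set V)))
    (fun w => w.1.2)
  have hcol : (((G.induce (S : Set V)).induce Set.univ).chromaticNumber : ℕ∞) ≤ n := by
    rw [← h Set.univ]
    exact_mod_cast hle
  obtain ⟨C⟩ := chromaticNumber_le_iff_colorable.1 hcol
  refine ⟨fun w => if hw : w ∈ S then (C ⟨⟨w, hw⟩, trivial⟩ : ℕ) else 0, ?_, ?_⟩
  · intro w hw
    simp [hw]
  · intro w hw w' hw' hadj
    simp only [hw, hw', dif_pos]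
    exact fun heq => C.valid (v := ⟨⟨w, hw⟩, trivial⟩) (w := ⟨⟨w', hw'⟩, trivial⟩) hadj
      (Fin.ext heq)

theorem isPerfect_of_cliqueColorable [Fintype V] (h : ∀ S : Finset V, CliqueColorable G S) :
    IsPerfect G := by
  classical
  intro S
  apply le_antisymm (G.induce S).cliqueNum_le_chromaticNumber
  obtain ⟨c, hlt, hc⟩ := h S.toFinset (G.induce S).cliqueNum (by
    intro t ht hcl
    have hsub : ∀ x ∈ t, x ∈ S := fun x hx => by simpa using ht hx
    rw [← Finset.filter_true_of_mem hsub, ← Finset.card_subtype]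
    refine IsClique.card_le_cliqueNum (t := t.subtype (· ∈ S)) (tc := ?_)
    intro x hx y hy hxy
    exact hcl (Finset.mem_subtype.1 hx) (Finset.mem_subtype.1 hy) fun h => hxy (Subtype.ext h))
  refine chromaticNumber_le_iff_colorable.2 ⟨Coloring.mk
    (fun w => ⟨c w, hlt w (by simp)⟩) ?_⟩
  intro w w' hadj heq
  exact hc w (by simp) w' (by simp) hadj (Fin.ext_iff.1 heq)

theorem MinimallyImperfect.cliqueColorable [Fintype V] (h : MinimallyImperfect G)
    {S : Finset V} (hS : S ≠ Finset.univ) : CliqueColorable G S :=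
  (h.2 S (by simpa using hS)).cliqueColorable

theorem MinimallyImperfect.not_cliqueColorable_univ [Fintype V] (h : MinimallyImperfect G) :
    ¬ CliqueColorable G Finset.univ := fun hu =>
  h.1 <| isPerfect_of_cliqueColorable fun S => by
    by_cases hS : S = Finset.univ
    · rwa [hS]
    · exact h.cliqueColorable hS

/-- In a perfect graph, some optimal colouring uses as few colours on the neighbourhood of a given
vertex as the cliques in that neighbourhood allow. -/
theorem exists_isColoringOn_card_image_neighbors_le [DecidableEq V] [DecidableRel G.Adj]
    {v : V} {m : ℕ} (n : ℕ) : ∀ {H : Finset V}, (∀ S ⊆ H, CliqueColorable G S) → v ∈ H →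
      CliqueBoundOn G (H.filter (G.Adj v)) m → CliqueBoundOn G H n →
      ∃ c, IsColoringOn G H n c ∧ ((H.filter (G.Adj v)).image c).card ≤ m := by
  induction n with
  | zero =>
    intro H _ hv _ hn
    simpa using hn {v} (by simpa using hv) (by simp)
  | succ k ih =>
    intro H hH hv hm hn
    obtain ⟨c, hc⟩ := hH H subset_rfl _ hn
    have himg : (H.filter (G.Adj v)).image c ⊆ (Finset.range (k + 1)).erase (c v) := by
      intro i hi
      obtain ⟨w, hw, rfl⟩ := Finset.mem_image.1 hi
      rw [Finset.mem_filter] at hw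
      simpa [hc.1 w hw.1] using (hc.2 v hv w hw.1 hw.2).symm
    have hcard : ((Finset.range (k + 1)).erase (c v)).card = k := by
      simp [Finset.card_erase_of_mem, hc.1 v hv]
    by_cases hkm : k ≤ m
    · exact ⟨c, hc, (Finset.card_le_card himg).trans (hcard.trans_le hkm)⟩
    let H' := H.filter fun w => c w = c v → w = v
    have hH' : H' ⊆ H := Finset.filter_subset _ _
    have hN : H'.filter (G.Adj v) = H.filter (G.Adj v) := by
      ext w
      simp only [H', Finset.mem_filter]
      refine ⟨fun h => ⟨h.1.1, h.2⟩, fun h => ⟨⟨h.1, fun e => ?_⟩, h.2⟩⟩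
      exact absurd e.symm (hc.2 v hv w h.1 h.2)
    have hbound : CliqueBoundOn G H' k := by
      intro t ht hcl
      by_cases hvt : v ∈ t
      · have hle := hm (t.erase v) (fun w hw => by
          rw [Finset.mem_erase] at hw
          exact Finset.mem_filter.2 ⟨hH' (ht hw.2), hcl hvt hw.2 hw.1.symm⟩)
          (hcl.subset (by simp))
        rw [Finset.card_erase_of_mem hvt] at hle
        omega
      · rw [← hcard]
        refine hc.card_le (ht.trans hH') hcl fun w hw => ?_
        have hwH := Finset.mem_filter.1 (ht hw)
        rw [Finset.mem_erase, Finset.mem_range]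
        exact ⟨fun e => hvt (hwH.2 e ▸ hw), hc.1 w hwH.1⟩
    obtain ⟨c', hc', hle⟩ := ih (fun S hS => hH S (hS.trans hH'))
      (Finset.mem_filter.2 ⟨hv, fun _ => rfl⟩) (hN ▸ hm) hbound
    rw [hN] at hle
    refine ⟨fun w => if w ∈ H' then c' w else k, ⟨fun w hw => ?_, fun w hw w' hw' hadj => ?_⟩, ?_⟩
    · dsimp only
      split_ifs with h
      · exact (hc'.1 w h).trans k.lt_succ_self
      · exact k.lt_succ_self
    · dsimp only
      split_ifs with h h' h'
      · exact hc'.2 w h w' h' hadj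
      · exact (hc'.1 w h).ne
      · exact (hc'.1 w' h').ne'
      · simp only [H', Finset.mem_filter, hw, hw', true_and, Classical.not_imp] at h h'
        exact absurd (h.1.trans h'.1.symm) (hc.2 w hw w' hw' hadj)
    · refine le_of_eq_of_le (congrArg Finset.card (Finset.image_congr fun w hw => ?_)) hle
      rw [← hN] at hw
      exact if_pos (Finset.mem_filter.1 hw).1

/-- A graph which splits into two parts that are colourable with as many colours as their clique
bounds is colourable with the sum of these bounds. -/
theorem exists_isColoringOn_univ_of_split [Fintype V] [DecidableEq V] {F : Finset V} {p q n : ℕ}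
    (hF : CliqueColorable G F) (hFc : CliqueColorable G Fᶜ) (hp : CliqueBoundOn G F p)
    (hq : CliqueBoundOn G Fᶜ q) (hpq : p + q ≤ n) : ∃ c, IsColoringOn G Finset.univ n c := by
  obtain ⟨c₁, h₁⟩ := hF p hp
  obtain ⟨c₂, h₂⟩ := hFc q hq
  have h₁' : ∀ w ∈ F, c₁ w < p := h₁.1
  have h₂' : ∀ w, w ∉ F → c₂ w < q := fun w hw => h₂.1 w (by simpa using hw)
  refine ⟨fun w => if w ∈ F then c₁ w else p + c₂ w, fun w _ => ?_, fun w _ w' _ hadj => ?_⟩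
  · dsimp only
    split_ifs with h
    · have := h₁' w h
      omega
    · have := h₂' w h
      omega
  · dsimp only
    split_ifs with h h' h'
    · exact h₁.2 w h w' h' hadj
    · have := h₁' w h
      omega
    · have := h₁' w' h'
      omega
    · have := h₂.2 w (by simpa using h) w' (by simpa using h') hadj
      omega

/-- The configuration of a T-cutset, without the vertex in `C`. -/
structure IsHalfTCutset [Fintype V] (G : SimpleGraph V) (A B C D : Finset V) (v : V) : Prop where
  nonempty_left : A.Nonempty
  nonempty_right : B.Nonempty
  cover : ∀ w, w ∈ A ∨ w ∈ B ∨ w ∈ C ∨ w ∈ D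
  disjoint_AD : Disjoint A D
  disjoint_BD : Disjoint B D
  disjoint_CD : Disjoint C D
  complete : ∀ a ∈ A, ∀ b ∈ B, G.Adj a b
  anticomplete : ∀ c ∈ C, ∀ d ∈ D, ¬ G.Adj c d
  mem : v ∈ D
  adj : ∀ a ∈ A, G.Adj a v

/-- If `D = {v}` then a colouring of `G - v` yields one of `G`. -/
theorem IsHalfTCutset.cliqueColorable_univ_of_singleton [Fintype V] [DecidableEq V]
    {A B C : Finset V} {v : V} (h : IsHalfTCutset G A B C {v} v)
    (hG : ∀ S : Finset V, S ≠ Finset.univ → CliqueColorable G S) :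
    CliqueColorable G Finset.univ := by
  intro n hn
  obtain ⟨a, ha⟩ := h.nonempty_left
  obtain ⟨b, hb⟩ := h.nonempty_right
  obtain ⟨K, hKA, hK, hKmax⟩ := CliqueBoundOn.exists_max G A
  have hvA : v ∉ A := by simpa using h.disjoint_AD
  have hvB : v ∉ B := by simpa using h.disjoint_BD
  have hAv : A ⊆ {v}ᶜ := fun w hw => by
    simp only [Finset.mem_compl, Finset.mem_singleton]
    rintro rfl
    exact hvA hw
  have hBv : B ⊆ {v}ᶜ := fun w hw => by
    simp only [Finset.mem_compl, Finset.mem_singleton]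
    rintro rfl
    exact hvB hw
  obtain ⟨c, hc⟩ := hG {v}ᶜ (fun e => by simpa using Finset.ext_iff.1 e v) n
    (hn.mono (Finset.subset_univ _))
  have hPn : A.image c ⊆ Finset.range n := by
    intro i hi
    obtain ⟨w, hw, rfl⟩ := Finset.mem_image.1 hi
    exact Finset.mem_range.2 (hc.1 w (hAv hw))
  have hPle : (A.image c).card ≤ n := by simpa using Finset.card_le_card hPn
  have hKP : K.card ≤ (A.image c).card :=
    hc.card_le (hKA.trans hAv) hK fun w hw => Finset.mem_image_of_mem c (hKA hw)
  have hBc : ∀ w ∈ B, c w ∉ A.image c := by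
    intro w hw hmem
    obtain ⟨x, hx, hxw⟩ := Finset.mem_image.1 hmem
    exact hc.2 x (hAv hx) w (hBv hw) (h.complete x hx w hw) hxw
  have hin : ∀ t : Finset V, v ∉ t → G.IsClique t → (∀ w ∈ t, c w ∈ A.image c) →
      t.card ≤ (A.image c).card := fun t hvt hcl ht =>
    hc.card_le (by simpa using hvt) hcl ht
  have hout : ∀ t : Finset V, v ∉ t → G.IsClique t → (∀ w ∈ t, c w ∉ A.image c) →
      t.card ≤ n - (A.image c).card := by
    intro t hvt hcl ht
    have hts : t ⊆ {v}ᶜ := by simpa using hvt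
    have := hc.card_le hts hcl (K := Finset.range n \ A.image c) fun w hw =>
      Finset.mem_sdiff.2 ⟨Finset.mem_range.2 (hc.1 w (hts hw)), ht w hw⟩
    rwa [Finset.card_sdiff_of_subset hPn, Finset.card_range] at this
  have hnbr : ∀ t : Finset V, v ∈ t → G.IsClique t → ∀ w ∈ t.erase v, w ∈ A ∨ w ∈ B := by
    intro t hvt hcl w hw
    rw [Finset.mem_erase] at hw
    rcases h.cover w with hA | hB | hC | hD
    · exact .inl hA
    · exact .inr hB
    · exact absurd (hcl hw.2 hvt hw.1) (h.anticomplete w hC v h.mem)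
    · exact absurd (Finset.mem_singleton.1 hD) hw.1
  by_cases hlt : K.card < (A.image c).card
  · refine exists_isColoringOn_univ_of_split
      (F := Finset.univ.filter fun w => w = v ∨ c w ∈ A.image c)
      (p := (A.image c).card) (q := n - (A.image c).card) (hG _ fun e => ?_) (hG _ fun e => ?_)
      ?_ ?_ (by omega)
    · have := Finset.ext_iff.1 e b
      simp only [Finset.mem_filter, Finset.mem_univ, true_and, iff_true] at this
      rcases this with rfl | hbc
      · exact hvB hb
      · exact hBc b hb hbc
    · simpa using Finset.ext_iff.1 e v
    · intro t ht hcl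
      by_cases hvt : v ∈ t
      · have hle := hKmax (t.erase v) (fun w hw => (hnbr t hvt hcl w hw).resolve_right fun hB => by
          have := Finset.mem_filter.1 (ht (Finset.mem_of_mem_erase hw))
          exact this.2.elim (Finset.ne_of_mem_erase hw) (hBc w hB)) (hcl.subset (by simp))
        rw [Finset.card_erase_of_mem hvt] at hle
        omega
      · refine hin t hvt hcl fun w hw => ?_
        exact (Finset.mem_filter.1 (ht hw)).2.resolve_left fun e => hvt (e ▸ hw)
    · intro t ht hcl
      have ht' : ∀ w ∈ t, w ≠ v ∧ c w ∉ A.image c := fun w hw => by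
        simpa only [Finset.mem_compl, Finset.mem_filter, Finset.mem_univ, true_and, not_or]
          using ht hw
      exact hout t (fun hvt => (ht' v hvt).1 rfl) hcl fun w hw => (ht' w hw).2
  · have hcard : (A.image c).card = K.card := le_antisymm (not_lt.1 hlt) hKP
    refine exists_isColoringOn_univ_of_split
      (F := Finset.univ.filter fun w => w ≠ v ∧ c w ∈ A.image c)
      (p := (A.image c).card) (q := n - (A.image c).card) (hG _ fun e => ?_) (hG _ fun e => ?_)
      ?_ ?_ (by omega)
    · simpa using Finset.ext_iff.1 e v
    · have := (Finset.ext_iff.1 e a).2 (Finset.mem_univ a)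
      rw [Finset.mem_compl, Finset.mem_filter] at this
      exact this ⟨Finset.mem_univ a, fun e => hvA (e ▸ ha), Finset.mem_image_of_mem c ha⟩
    · intro t ht hcl
      exact hin t (fun hvt => (Finset.mem_filter.1 (ht hvt)).2.1 rfl) hcl fun w hw =>
        (Finset.mem_filter.1 (ht hw)).2.2
    · intro t ht hcl
      have ht' : ∀ w ∈ t, w ≠ v → c w ∉ A.image c := fun w hw hwv hA => by
        have := ht hw
        rw [Finset.mem_compl, Finset.mem_filter] at this
        exact this ⟨Finset.mem_univ w, hwv, hA⟩
      by_cases hvt : v ∈ t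
      · have htB : ∀ w ∈ t, w ≠ v → w ∈ B := fun w hw hwv =>
          (hnbr t hvt hcl w (Finset.mem_erase.2 ⟨hwv, hw⟩)).resolve_left fun hA =>
            ht' w hw hwv (Finset.mem_image_of_mem c hA)
        have hadj : ∀ x ∈ K, ∀ w ∈ t, G.Adj x w := by
          intro x hx w hw
          by_cases hwv : w = v
          · exact hwv ▸ h.adj x (hKA hx)
          · exact h.complete x (hKA hx) w (htB w hw hwv)
        have hdisj : Disjoint t K := Finset.disjoint_left.2 fun w hw hwK =>
          (hadj w hwK w hw).ne rfl
        have hle := hn (t ∪ K) (Finset.subset_univ _) (by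
          intro x hx y hy hxy
          simp only [Finset.coe_union, Set.mem_union, Finset.mem_coe] at hx hy
          rcases hx with hx | hx <;> rcases hy with hy | hy
          · exact hcl hx hy hxy
          · exact (hadj y hy x hx).symm
          · exact hadj x hx y hy
          · exact hK hx hy hxy)
        rw [Finset.card_union_of_disjoint hdisj] at hle
        omega
      · exact hout t hvt hcl fun w hw => ht' w hw fun e => hvt (e ▸ hw)

/-- If `D` has a vertex besides `v`, then `A ∪ B ∪ C` splits into a part containing `A` and a part
containing `B`, the former with the same clique number as `A`. -/
theorem IsHalfTCutset.exists_split [Fintype V] [DecidableEq V]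
    {A B C D : Finset V} {v d : V} (h : IsHalfTCutset G A B C D v) (hd : d ∈ D) (hdv : d ≠ v)
    (hG : ∀ S : Finset V, S ≠ Finset.univ → CliqueColorable G S) {n : ℕ}
    (hn : CliqueBoundOn G Finset.univ n) {K : Finset V} (hKA : K ⊆ A) (hK : G.IsClique K)
    (hKmax : CliqueBoundOn G A K.card) :
    ∃ P : V → Prop, (∀ w ∈ A, P w) ∧ (∀ w ∈ B, ¬ P w) ∧
      (∀ t : Finset V, (∀ w ∈ t, w ∉ D ∧ P w) → G.IsClique t → t.card ≤ K.card) ∧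
      ∀ t : Finset V, (∀ w ∈ t, w ∉ D ∧ ¬ P w) → G.IsClique t → t.card + K.card ≤ n := by
  classical
  let H : Finset V := Finset.univ.filter fun w => w ∈ D → w = v
  have hHD : ∀ w, w ∉ D → w ∈ H := fun w hw =>
    Finset.mem_filter.2 ⟨Finset.mem_univ w, fun hD => absurd hD hw⟩
  have hdH : d ∉ H := fun hmem => hdv ((Finset.mem_filter.1 hmem).2 hd)
  have hAH : A ⊆ H := fun w hw => hHD w (Finset.disjoint_left.1 h.disjoint_AD hw)
  have hBH : B ⊆ H := fun w hw => hHD w (Finset.disjoint_left.1 h.disjoint_BD hw)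
  obtain ⟨L, hLB, hL, hLmax⟩ := CliqueBoundOn.exists_max G (B.filter (G.Adj v))
  have hN : ∀ w ∈ H.filter (G.Adj v), w ∈ A ∨ w ∈ B.filter (G.Adj v) := by
    intro w hw
    rw [Finset.mem_filter] at hw
    rcases h.cover w with hA | hB | hC | hD
    · exact .inl hA
    · exact .inr (Finset.mem_filter.2 ⟨hB, hw.2⟩)
    · exact absurd hw.2.symm (h.anticomplete w hC v h.mem)
    · exact absurd ((Finset.mem_filter.1 hw.1).2 hD).symm hw.2.ne
  obtain ⟨c, hc, hcN⟩ := exists_isColoringOn_card_image_neighbors_le (G := G) (v := v)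
    (m := K.card + L.card) n (H := H)
    (fun S hS => hG S fun e => hdH (hS (e ▸ Finset.mem_univ d)))
    (Finset.mem_filter.2 ⟨Finset.mem_univ v, fun _ => rfl⟩)
    (fun t ht hcl => by
      rw [← Finset.card_filter_add_card_filter_not (s := t) (· ∈ A)]
      refine add_le_add
        (hKmax _ (fun w hw => (Finset.mem_filter.1 hw).2)
          (hcl.subset (Finset.coe_subset.2 (Finset.filter_subset _ _))))
        (hLmax _ (fun w hw => ?_)
          (hcl.subset (Finset.coe_subset.2 (Finset.filter_subset _ _))))
      have hw := Finset.mem_filter.1 hw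
      exact (hN w (ht hw.1)).resolve_left hw.2)
    (hn.mono (Finset.subset_univ _))
  have hBc : ∀ w ∈ B, c w ∉ A.image c := by
    intro w hw hmem
    obtain ⟨x, hx, hxw⟩ := Finset.mem_image.1 hmem
    exact hc.2 x (hAH hx) w (hBH hw) (h.complete x hx w hw) hxw
  have hPn : A.image c ⊆ Finset.range n := by
    intro i hi
    obtain ⟨w, hw, rfl⟩ := Finset.mem_image.1 hi
    exact Finset.mem_range.2 (hc.1 w (hAH hw))
  have hKP : K.card ≤ (A.image c).card :=
    hc.card_le (hKA.trans hAH) hK fun w hw => Finset.mem_image_of_mem c (hKA hw)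
  have hPK : (A.image c).card ≤ K.card := by
    have hLc : L.card = (L.image c).card :=
      (Finset.card_image_of_injOn (hc.injOn
        ((hLB.trans (Finset.filter_subset _ _)).trans hBH) hL)).symm
    have hdisj : Disjoint (A.image c) (L.image c) := by
      rw [Finset.disjoint_right]
      intro i hi
      obtain ⟨w, hw, rfl⟩ := Finset.mem_image.1 hi
      exact hBc w (Finset.mem_filter.1 (hLB hw)).1
    have hsub : A.image c ∪ L.image c ⊆ (H.filter (G.Adj v)).image c := by
      rw [← Finset.image_union]
      refine Finset.image_subset_image (Finset.union_subset (fun w hw => ?_) fun w hw => ?_)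
      · exact Finset.mem_filter.2 ⟨hAH hw, (h.adj w hw).symm⟩
      · have hw := Finset.mem_filter.1 (hLB hw)
        exact Finset.mem_filter.2 ⟨hBH hw.1, hw.2⟩
    have hle := (Finset.card_le_card hsub).trans hcN
    rw [Finset.card_union_of_disjoint hdisj] at hle
    omega
  refine ⟨fun w => c w ∈ A.image c, fun w hw => Finset.mem_image_of_mem c hw, hBc, ?_, ?_⟩
  · intro t ht hcl
    exact (hc.card_le (fun w hw => hHD w (ht w hw).1) hcl fun w hw => (ht w hw).2).trans hPK
  · intro t ht hcl
    have hle := hc.card_le (fun w hw => hHD w (ht w hw).1) hcl (K := Finset.range n \ A.image c)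
      fun w hw => Finset.mem_sdiff.2
        ⟨Finset.mem_range.2 (hc.1 w (hHD w (ht w hw).1)), (ht w hw).2⟩
    have hPle := Finset.card_le_card hPn
    rw [Finset.card_sdiff_of_subset hPn] at hle
    rw [Finset.card_range] at hle hPle
    omega

theorem IsHalfTCutset.clique_avoids [Fintype V] {A B C D t : Finset V} {v : V}
    (h : IsHalfTCutset G A B C D v) (hcl : G.IsClique t) :
    (∀ w ∈ t, w ∉ D) ∨ ∀ w ∈ t, w ∉ C := by
  by_contra! hcon
  obtain ⟨⟨x, hx, hxD⟩, y, hy, hyC⟩ := hcon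
  have hne : y ≠ x := by
    rintro rfl
    exact Finset.disjoint_left.1 h.disjoint_CD hyC hxD
  exact h.anticomplete y hyC x hxD (hcl hy hx hne)

theorem IsHalfTCutset.cliqueColorable_univ [Fintype V] [DecidableEq V]
    {A B C D : Finset V} {u v : V} (h : IsHalfTCutset G A B C D v)
    (h' : IsHalfTCutset G A B D C u)
    (hG : ∀ S : Finset V, S ≠ Finset.univ → CliqueColorable G S) :
    CliqueColorable G Finset.univ := by
  classical
  by_cases hD : ∃ d ∈ D, d ≠ v
  swap
  · push Not at hD
    obtain rfl : D = {v} := Finset.eq_singleton_iff_unique_mem.2 ⟨h.mem, hD⟩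
    exact h.cliqueColorable_univ_of_singleton hG
  by_cases hC : ∃ d ∈ C, d ≠ u
  swap
  · push Not at hC
    obtain rfl : C = {u} := Finset.eq_singleton_iff_unique_mem.2 ⟨h'.mem, hC⟩
    exact h'.cliqueColorable_univ_of_singleton hG
  obtain ⟨d, hd, hdv⟩ := hD
  obtain ⟨e, he, heu⟩ := hC
  intro n hn
  obtain ⟨K, hKA, hK, hKmax⟩ := CliqueBoundOn.exists_max G A
  obtain ⟨P, hPA, hPB, hP, hPn⟩ := h.exists_split hd hdv hG hn hKA hK hKmax
  obtain ⟨Q, hQA, hQB, hQ, hQn⟩ := h'.exists_split he heu hG hn hKA hK hKmax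
  obtain ⟨a, ha⟩ := h.nonempty_left
  obtain ⟨b, hb⟩ := h.nonempty_right
  have hPQ : ∀ w, w ∉ C → w ∉ D → (P w ↔ Q w) := by
    intro w hwC hwD
    rcases h.cover w with hw | hw | hw | hw
    · exact iff_of_true (hPA w hw) (hQA w hw)
    · exact iff_of_false (hPB w hw) (hQB w hw)
    · exact absurd hw hwC
    · exact absurd hw hwD
  have hmem : ∀ w, (w ∈ Finset.univ.filter fun w => if w ∈ C then P w else Q w) ↔
      if w ∈ C then P w else Q w := by simp
  have hnC : ∀ w, w ∉ C → ((if w ∈ C then P w else Q w) ↔ Q w) := fun w hw => by simp [hw]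
  have hnD : ∀ w, w ∉ D → ((if w ∈ C then P w else Q w) ↔ P w) := fun w hw => by
    split_ifs with hC
    · rfl
    · exact (hPQ w hC hw).symm
  have haD := Finset.disjoint_left.1 h.disjoint_AD ha
  have hbD := Finset.disjoint_left.1 h.disjoint_BD hb
  refine exists_isColoringOn_univ_of_split
    (F := Finset.univ.filter fun w => if w ∈ C then P w else Q w)
    (p := K.card) (q := n - K.card) (hG _ fun e => ?_) (hG _ fun e => ?_) ?_ ?_
    (by have := hn K (Finset.subset_univ _) hK; omega)
  · exact hPB b hb ((hnD b hbD).1 ((hmem b).1 (e.symm.subset (Finset.mem_univ b))))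
  · have := (Finset.ext_iff.1 e a).2 (Finset.mem_univ a)
    rw [Finset.mem_compl, hmem, hnD a haD] at this
    exact this (hPA a ha)
  · intro t ht hcl
    rcases h.clique_avoids hcl with hav | hav
    · exact hP t (fun w hw => ⟨hav w hw, (hnD w (hav w hw)).1 ((hmem w).1 (ht hw))⟩) hcl
    · exact hQ t (fun w hw => ⟨hav w hw, (hnC w (hav w hw)).1 ((hmem w).1 (ht hw))⟩) hcl
  · intro t ht hcl
    have ht' : ∀ w ∈ t, ¬ if w ∈ C then P w else Q w := fun w hw => by
      rw [← hmem, ← Finset.mem_compl]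
      exact ht hw
    rcases h.clique_avoids hcl with hav | hav
    · have := hPn t (fun w hw => ⟨hav w hw, fun hp => ht' w hw ((hnD w (hav w hw)).2 hp)⟩) hcl
      omega
    · have := hQn t (fun w hw => ⟨hav w hw, fun hq => ht' w hw ((hnC w (hav w hw)).2 hq)⟩) hcl
      omega

end

/-- No minimally imperfect graph contains a T-cutset: a skew partition
`A, B, C, D` with `u ∈ C` and `v ∈ D` such that every vertex of `A` is adjacent to
both `u` and `v`. -/
theorem no_T_cutset {V : Type*} [Fintype V] (G : SimpleGraph V)
    (hmi : MinimallyImperfect G) :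
    ¬ ∃ (A B C D : Set V) (u v : V), IsSkewPartition G A B C D ∧
      u ∈ C ∧ v ∈ D ∧ (∀ a ∈ A, G.Adj a u ∧ G.Adj a v) := by
  classical
  rintro ⟨A, B, C, D, u, v, ⟨hA, hB, -, -, hcov, hAB, hAC, hAD, hBC, hBD, hCD, hcomp, hanti⟩,
    hu, hv, hadj⟩
  have hcov' : ∀ w, ((w ∈ A ∨ w ∈ B) ∨ w ∈ C) ∨ w ∈ D := fun w => by
    simpa only [Set.mem_union] using hcov.symm.subset (Set.mem_univ w)
  refine hmi.not_cliqueColorable_univ <| IsHalfTCutset.cliqueColorable_univ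
    (A := A.toFinset) (B := B.toFinset) (C := C.toFinset) (D := D.toFinset) (u := u) (v := v)
    ?_ ?_ fun S hS => hmi.cliqueColorable hS
  · exact ⟨by simpa, by simpa, fun w => by simpa [or_assoc] using hcov' w, by simpa,
      by simpa, by simpa, by simpa using hcomp, by simpa using hanti, by simpa,
      by simpa using fun a ha => (hadj a ha).2⟩
  · exact ⟨by simpa, by simpa, fun w => by simpa [or_assoc, or_comm (a := w ∈ C)] using hcov' w,
      by simpa, by simpa, by simpa using hCD.symm, by simpa using hcomp,
      by simpa using fun d hd c hc h => hanti c hc d hd h.symm, by simpa,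
      by simpa using fun a ha => (hadj a ha).1⟩
end
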